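/- Let d ≥ 2 and r ∈ ℝ \ {0}. Suppose Ω : ℝ^d \ {0} → ℝ is homogeneous of degree zero, ∫_{S^{d−1}} Ω(θ) dθ = 0, and ‖Ω‖_{L log⁺L(S^{d−1})} < ∞. Let the Muckenhoupt singular integral be given for f ∈ C_c^∞(ℝ^d) by T_{Ω,ir} f(x) = p.v. ∫_{ℝ^d} Ω(x−y) |x−y|^{−d−ir} f(y) dy (where |x−y|^{−d−ir} = |x−y|^{−d} e^{−ir log|x−y|}), assumed to exist a.e. for such f. Then there is a constant C depending only on d and r such that for all λ > 0 and f ∈ C_c^∞(ℝ^d), m({x ∈ ℝ^d : |T_{Ω,ir} f(x)| > λ}) ≤ C λ^{−1} 𝒞_Ω ‖f‖_{L¹}. -/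

import Mathlib

open MeasureTheory Metric Filter Topology ENNReal

noncomputable section

/-- The surface measure on the unit sphere `S^{d-1}` of `ℝ^d`. -/
def sphereMeasure (d : ℕ) :
    Measure (sphere (0 : EuclideanSpace ℝ (Fin d)) 1) :=
  (volume : Measure (EuclideanSpace ℝ (Fin d))).toSphere

/-- `‖Ω‖_{L¹(S^{d-1})}`. -/
def sphL1 (d : ℕ) (Ω : EuclideanSpace ℝ (Fin d) → ℝ) : ℝ :=
  ∫ θ : sphere (0 : EuclideanSpace ℝ (Fin d)) 1, |Ω θ| ∂(sphereMeasure d)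

/-- `‖Ω‖_{L log⁺ L(S^{d-1})} = ∫ |Ω| log(2+|Ω|)`. -/
def sphLlogL (d : ℕ) (Ω : EuclideanSpace ℝ (Fin d) → ℝ) : ℝ :=
  ∫ θ : sphere (0 : EuclideanSpace ℝ (Fin d)) 1,
    |Ω θ| * Real.log (2 + |Ω θ|) ∂(sphereMeasure d)

/-- The constant `𝒞_Ω`. -/
def COmega (d : ℕ) (Ω : EuclideanSpace ℝ (Fin d) → ℝ) : ℝ :=
  sphLlogL d Ω +
    ∫ θ : sphere (0 : EuclideanSpace ℝ (Fin d)) 1,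
      |Ω θ| * (1 + max (Real.log (|Ω θ| / sphL1 d Ω)) 0) ∂(sphereMeasure d)

section plancherel
open scoped FourierTransform SchwartzMap RealInnerProductSpace
variable {V : Type*} [NormedAddCommGroup V] [InnerProductSpace ℝ V] [FiniteDimensional ℝ V]
  [MeasurableSpace V] [BorelSpace V]

theorem memLp_two_of_bounded {f : V → ℂ} (hf : Integrable f) {C : ℝ} (hC : ∀ x, ‖f x‖ ≤ C) :
    MemLp f 2 := by
  have h1 : MemLp f 1 := memLp_one_iff_integrable.2 hf
  have h2 : MemLp f ∞ := memLp_top_of_bound hf.aestronglyMeasurable C (Eventually.of_forall hC)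
  rw [memLp_two_iff_integrable_sq_norm hf.aestronglyMeasurable]
  refine (hf.norm.mul_const C).mono' (hf.aestronglyMeasurable.norm.pow 2)
    (Eventually.of_forall fun x => ?_)
  rw [Real.norm_of_nonneg (by positivity), pow_two]
  exact mul_le_mul_of_nonneg_left (hC x) (norm_nonneg _)

theorem fourier_continuous {f : V → ℂ} (hf : Integrable f) : Continuous (𝓕 f) :=
  VectorFourier.fourierIntegral_continuous Real.continuous_fourierChar
    (by exact continuous_inner) hf

theorem eLpNorm_fourier_eq {f : V → ℂ} (hf : Integrable f) (hf2 : MemLp f 2) :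
    eLpNorm (𝓕 f) 2 = eLpNorm f 2 := by
  set F : Lp ℂ 2 (volume : Measure V) := hf2.toLp
  have hcoe : (F : V → ℂ) =ᵐ[volume] f := hf2.coeFn_toLp
  have key : ((𝓕 F : Lp ℂ 2 (volume : Measure V)) : V → ℂ) =ᵐ[volume] 𝓕 f := by
    apply ae_eq_of_integral_contDiff_smul_eq
    · exact (Lp.memLp (𝓕 F)).locallyIntegrable (by norm_num)
    · exact (fourier_continuous hf).locallyIntegrable
    intro g hg hgs
    have hg1 : HasCompactSupport (fun x => (g x : ℂ)) :=
      hgs.comp_left (g := fun t : ℝ => (t : ℂ)) (by simp)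
    have hg2 : ContDiff ℝ (⊤ : ℕ∞) (fun x => (g x : ℂ)) := Complex.ofRealCLM.contDiff.comp hg
    set G : 𝓢(V, ℂ) := hg1.toSchwartzMap hg2
    have hG : ∀ x, G x = g x := fun x => rfl
    have e1 := congrArg (fun T => T G) (Lp.fourier_toTemperedDistribution_eq F)
    simp only [TemperedDistribution.fourier_apply, Lp.toTemperedDistribution_apply] at e1
    have e2 : ∫ x, g x • ((𝓕 F : Lp ℂ 2 (volume : Measure V)) : V → ℂ) x
        = ∫ x, G x • ((𝓕 F : Lp ℂ 2 (volume : Measure V)) : V → ℂ) x := by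
      simp [hG]
    rw [e2, ← e1]
    have e3 : ∫ x, (𝓕 G) x • (F : V → ℂ) x = ∫ x, 𝓕 (G : V → ℂ) x • f x := by
      apply integral_congr_ae
      filter_upwards [hcoe] with x hx
      rw [hx, SchwartzMap.fourier_coe]
    rw [e3]
    have e4 := VectorFourier.integral_fourierIntegral_smul_eq_flip (μ := (volume : Measure V))
      (ν := (volume : Measure V)) (L := innerₗ V) (f := (G : V → ℂ)) (g := f)
      Real.continuous_fourierChar (by exact continuous_inner) G.integrable hf
    have : (innerₗ V).flip = innerₗ V := by
      ext x y; simp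
    rw [this] at e4
    change ∫ x, 𝓕 (G : V → ℂ) x • f x = ∫ x, G x • 𝓕 f x at e4
    rw [e4]
    simp [hG]
  rw [← eLpNorm_congr_ae key, ← eLpNorm_congr_ae hcoe]
  have := Lp.norm_fourier_eq F
  rw [Lp.norm_def, Lp.norm_def] at this
  exact (ENNReal.toReal_eq_toReal_iff' (Lp.eLpNorm_ne_top _) (Lp.eLpNorm_ne_top _)).1 this

theorem eLpNorm_two_sq {α : Type*} [MeasurableSpace α] {μ : Measure α} (f : α → ℂ) :
    eLpNorm f 2 μ ^ 2 = ∫⁻ x, ‖f x‖ₑ ^ 2 ∂μ := by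
  have := eLpNorm_nnreal_pow_eq_lintegral (f := f) (μ := μ) (p := 2) (by norm_num)
  simpa using this

theorem lintegral_fourier_sq {f : V → ℂ} (hf : Integrable f) {C : ℝ} (hC : ∀ x, ‖f x‖ ≤ C) :
    ∫⁻ ξ, ‖𝓕 f ξ‖ₑ ^ 2 = ∫⁻ x, ‖f x‖ₑ ^ 2 := by
  rw [← eLpNorm_two_sq, ← eLpNorm_two_sq, eLpNorm_fourier_eq hf (memLp_two_of_bounded hf hC)]

end plancherel

section convolution
open scoped FourierTransform RealInnerProductSpace
variable {V : Type*} [NormedAddCommGroup V] [InnerProductSpace ℝ V] [FiniteDimensional ℝ V]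
  [MeasurableSpace V] [BorelSpace V]

/-- Convolution of two complex functions. -/
def cv (K B : V → ℂ) (x : V) : ℂ := ∫ y, K (x - y) * B y

theorem cv_eq_convolution (K B : V → ℂ) :
    cv K B = convolution K B (ContinuousLinearMap.mul ℂ ℂ) volume := by
  ext x
  rw [cv, convolution_mul_swap]

theorem integrable_cv {K B : V → ℂ} (hK : Integrable K) (hB : Integrable B) :
    Integrable (cv K B) := by
  rw [cv_eq_convolution]
  exact hK.integrable_convolution (ContinuousLinearMap.mul ℂ ℂ) hB

theorem fourier_cv {K B : V → ℂ} (hK : Integrable K) (hB : Integrable B) (ξ : V) :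
    𝓕 (cv K B) ξ = 𝓕 K ξ * 𝓕 B ξ := by
  rw [cv_eq_convolution, Real.fourier_mul_convolution_eq hK hB]

theorem enorm_cv_le (K B : V → ℂ) (x : V) :
    ‖cv K B x‖ₑ ≤ ∫⁻ y, ‖K (x - y)‖ₑ * ‖B y‖ₑ := by
  refine (enorm_integral_le_lintegral_enorm _).trans_eq ?_
  simp [enorm_mul]

theorem lintegral_lintegral_conv {u v : V → ℝ≥0∞} (hu : Measurable u) (hv : Measurable v) :
    ∫⁻ x, ∫⁻ y, u (x - y) * v y = (∫⁻ x, u x) * ∫⁻ y, v y := by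
  rw [lintegral_lintegral_swap (by fun_prop)]
  have h : ∀ y, ∫⁻ x, u (x - y) * v y = (∫⁻ x, u x) * v y := fun y => by
    rw [lintegral_mul_const _ (by fun_prop), lintegral_sub_right_eq_self u y]
  simp_rw [h]
  rw [lintegral_const_mul _ hv]

theorem lintegral_cv_le {K B : V → ℂ} (hK : Measurable K) (hB : Measurable B) :
    ∫⁻ x, ‖cv K B x‖ₑ ≤ (∫⁻ x, ‖K x‖ₑ) * ∫⁻ x, ‖B x‖ₑ := by
  refine (lintegral_mono fun x => enorm_cv_le K B x).trans_eq ?_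
  exact lintegral_lintegral_conv hK.enorm hB.enorm

theorem norm_cv_le_left {K B : V → ℂ} {C : ℝ} (hK : ∀ x, ‖K x‖ ≤ C) (hB : Integrable B) (x : V) :
    ‖cv K B x‖ ≤ C * ∫ y, ‖B y‖ := by
  rw [cv, ← integral_const_mul]
  refine norm_integral_le_of_norm_le (hB.norm.const_mul C) (Eventually.of_forall fun y => ?_)
  rw [norm_mul]
  exact mul_le_mul_of_nonneg_right (hK _) (norm_nonneg _)

theorem integrable_cv_integrand {K B : V → ℂ} {C : ℝ} (hK : Integrable K) (hBm : Measurable B)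
    (hB : ∀ x, ‖B x‖ ≤ C) (x : V) : Integrable fun y => K (x - y) * B y :=
  (hK.comp_sub_left x).mul_bdd (c := C) hBm.aestronglyMeasurable (Eventually.of_forall hB)

theorem norm_cv_le_right {K B : V → ℂ} {C : ℝ} (hK : Integrable K) (hB : ∀ x, ‖B x‖ ≤ C) (x : V) :
    ‖cv K B x‖ ≤ (∫ y, ‖K y‖) * C := by
  rw [cv, ← integral_mul_const, ← integral_sub_left_eq_self (fun y => ‖K y‖ * C) volume x]
  refine norm_integral_le_of_norm_le ((hK.norm.mul_const C).comp_sub_left x)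
    (Eventually.of_forall fun y => ?_)
  rw [norm_mul]
  exact mul_le_mul_of_nonneg_left (hB _) (norm_nonneg _)

theorem measurable_cv {K B : V → ℂ} (hK : Measurable K) (hB : Measurable B) :
    Measurable (cv K B) := by
  have : Measurable fun p : V × V => K (p.1 - p.2) * B p.2 := by fun_prop
  exact (this.stronglyMeasurable.integral_prod_right).measurable

end convolution

section energy
open scoped FourierTransform RealInnerProductSpace
variable {V : Type*} [NormedAddCommGroup V] [InnerProductSpace ℝ V] [FiniteDimensional ℝ V]
  [MeasurableSpace V] [BorelSpace V]

theorem integrable_exp_neg_mul_norm_sq {b : ℝ} (hb : 0 < b) :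
    Integrable fun v : V => Real.exp (-b * ‖v‖ ^ 2) := by
  have h := GaussianFourier.integrable_cexp_neg_mul_sq_norm_add (V := V) (b := (b : ℂ))
    (by simpa using hb) 0 0
  refine h.norm.congr (Eventually.of_forall fun v => ?_)
  simp only [Complex.norm_exp, zero_mul, add_zero]
  norm_cast

theorem gaussian_energy {f : V → ℂ} (hf : Integrable f) (hfm : Measurable f) {b : ℝ} (hb : 0 < b)
    {Y : ℝ≥0∞} (hY : ∀ x, ∫⁻ y, ENNReal.ofReal (Real.exp (-b * ‖x - y‖ ^ 2)) * ‖f y‖ₑ ≤ Y) :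
    ∫⁻ ξ, ENNReal.ofReal (Real.exp (-(2 * Real.pi ^ 2 / b) * ‖ξ‖ ^ 2)) * ‖𝓕 f ξ‖ₑ ^ 2 ≤
      ENNReal.ofReal ((b / Real.pi) ^ ((Module.finrank ℝ V : ℝ) / 2)) * Y * ∫⁻ x, ‖f x‖ₑ := by
  set φ : V → ℂ := fun v => Complex.exp (-(b : ℂ) * ‖v‖ ^ 2) with hφ
  have hφr : ∀ v, φ v = ((Real.exp (-b * ‖v‖ ^ 2) : ℝ) : ℂ) := fun v => by simp [hφ]
  have hφn : ∀ v, ‖φ v‖ₑ = ENNReal.ofReal (Real.exp (-b * ‖v‖ ^ 2)) := fun v => by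
    rw [hφr, ← ofReal_norm, Complex.norm_real, Real.norm_of_nonneg (Real.exp_nonneg _)]
  have hφb : ∀ v, ‖φ v‖ ≤ 1 := fun v => by
    rw [hφr, Complex.norm_real, Real.norm_of_nonneg (Real.exp_nonneg _), Real.exp_le_one_iff]
    nlinarith [sq_nonneg ‖v‖]
  have hφm : Measurable φ := by fun_prop
  have hφi : Integrable φ := by
    rw [show φ = fun v => ((Real.exp (-b * ‖v‖ ^ 2) : ℝ) : ℂ) from funext hφr]
    exact (integrable_exp_neg_mul_norm_sq hb).ofReal
  set n : ℝ := ((Module.finrank ℝ V : ℕ) : ℝ)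
  have hpb : 0 < Real.pi / b := by positivity
  have hF : ∀ ξ, 𝓕 φ ξ = (((Real.pi / b) ^ (n / 2) *
      Real.exp (-Real.pi ^ 2 * ‖ξ‖ ^ 2 / b) : ℝ) : ℂ) := fun ξ => by
    rw [hφ, fourier_gaussian_innerProductSpace (by simpa using hb)]
    push_cast [Complex.ofReal_cpow hpb.le]
    rfl
  have hmass : ∫⁻ x, ‖φ x‖ₑ = ENNReal.ofReal ((Real.pi / b) ^ (n / 2)) := by
    simp_rw [hφn]
    rw [← GaussianFourier.integral_rexp_neg_mul_sq_norm hb,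
      ofReal_integral_eq_lintegral_ofReal (integrable_exp_neg_mul_norm_sq hb)
        (Eventually.of_forall fun _ => Real.exp_nonneg _)]
  have hP := lintegral_fourier_sq (integrable_cv hφi hf) (norm_cv_le_left hφb hf)
  have hR : ∫⁻ x, ‖cv φ f x‖ₑ ^ 2 ≤ Y * (ENNReal.ofReal ((Real.pi / b) ^ (n / 2)) * ∫⁻ x, ‖f x‖ₑ) := by
    calc ∫⁻ x, ‖cv φ f x‖ₑ ^ 2 ≤ ∫⁻ x, Y * ‖cv φ f x‖ₑ := by
          refine lintegral_mono fun x => ?_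
          rw [pow_two]
          gcongr
          refine (enorm_cv_le φ f x).trans ?_
          simp_rw [hφn]
          exact hY x
      _ = Y * ∫⁻ x, ‖cv φ f x‖ₑ := lintegral_const_mul _ (measurable_cv hφm hfm).enorm
      _ ≤ _ := by
          gcongr
          rw [← hmass]
          exact lintegral_cv_le hφm hfm
  have hL : ∫⁻ ξ, ‖𝓕 (cv φ f) ξ‖ₑ ^ 2 = ENNReal.ofReal ((Real.pi / b) ^ (n / 2)) ^ 2 *
      ∫⁻ ξ, ENNReal.ofReal (Real.exp (-(2 * Real.pi ^ 2 / b) * ‖ξ‖ ^ 2)) * ‖𝓕 f ξ‖ₑ ^ 2 := by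
    rw [← lintegral_const_mul]
    · refine lintegral_congr fun ξ => ?_
      rw [fourier_cv hφi hf, enorm_mul, mul_pow, hF, ← ofReal_norm, Complex.norm_real,
        Real.norm_of_nonneg (by positivity), ENNReal.ofReal_mul (by positivity), mul_pow, mul_assoc]
      congr 2
      rw [← ENNReal.ofReal_pow (by positivity), ← Real.exp_nat_mul]
      congr 2
      push_cast; ring
    · exact (by fun_prop : Measurable fun ξ : V => ENNReal.ofReal (Real.exp
        (-(2 * Real.pi ^ 2 / b) * ‖ξ‖ ^ 2))).mul
        ((fourier_continuous hf).measurable.enorm.pow_const 2)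
  rw [hP] at hL
  rw [hL] at hR
  set I := ∫⁻ ξ, ENNReal.ofReal (Real.exp (-(2 * Real.pi ^ 2 / b) * ‖ξ‖ ^ 2)) * ‖𝓕 f ξ‖ₑ ^ 2
  have hc : ENNReal.ofReal ((b / Real.pi) ^ (n / 2)) * ENNReal.ofReal ((Real.pi / b) ^ (n / 2))
      = 1 := by
    rw [← ENNReal.ofReal_mul (by positivity), ← Real.mul_rpow (by positivity) (by positivity)]
    have : b / Real.pi * (Real.pi / b) = 1 := by field_simp
    simp [this]
  set p := ENNReal.ofReal ((b / Real.pi) ^ (n / 2))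
  set q := ENNReal.ofReal ((Real.pi / b) ^ (n / 2))
  calc I = (p * q) ^ 2 * I := by rw [hc]; simp
    _ = p ^ 2 * (q ^ 2 * I) := by ring
    _ ≤ p ^ 2 * (Y * (q * ∫⁻ x, ‖f x‖ₑ)) := by gcongr
    _ = (p * q) * (p * Y * ∫⁻ x, ‖f x‖ₑ) := by ring
    _ = _ := by rw [hc, one_mul]

theorem one_add_rpow_le_lintegral (M : ℕ) {x : ℝ} (hx : 0 ≤ x) :
    ENNReal.ofReal (((1 + x) ^ (M + 1))⁻¹) ≤ ENNReal.ofReal ((M + 1) * Real.exp 1) *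
      ∫⁻ t in Set.Ioc (0 : ℝ) 1, ENNReal.ofReal (t ^ M * Real.exp (-t * x)) := by
  have h1 : (1 + x)⁻¹ ≤ 1 := inv_le_one_of_one_le₀ (by linarith)
  have h0 : 0 < (1 + x)⁻¹ := by positivity
  have key : ENNReal.ofReal (Real.exp (-1) * ((1 + x) ^ (M + 1))⁻¹ / (M + 1)) ≤
      ∫⁻ t in Set.Ioc (0 : ℝ) 1, ENNReal.ofReal (t ^ M * Real.exp (-t * x)) := by
    calc ENNReal.ofReal (Real.exp (-1) * ((1 + x) ^ (M + 1))⁻¹ / (M + 1))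
        = ∫⁻ t in Set.Ioc (0 : ℝ) (1 + x)⁻¹, ENNReal.ofReal (t ^ M * Real.exp (-1)) := by
          rw [← ofReal_integral_eq_lintegral_ofReal]
          · rw [integral_mul_const, ← intervalIntegral.integral_of_le h0.le, integral_pow]
            congr 1
            simp
            ring
          · exact (intervalIntegrable_iff_integrableOn_Ioc_of_le h0.le).1
              (Continuous.intervalIntegrable (by fun_prop) _ _)
          · refine (ae_restrict_iff' measurableSet_Ioc).2 (Eventually.of_forall fun t ht => ?_)
            have := ht.1
            positivity
      _ ≤ ∫⁻ t in Set.Ioc (0 : ℝ) (1 + x)⁻¹, ENNReal.ofReal (t ^ M * Real.exp (-t * x)) := by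
          refine setLIntegral_mono' measurableSet_Ioc fun t ht => ?_
          apply ENNReal.ofReal_le_ofReal
          have h0 := ht.1
          gcongr
          have h2 : t * (1 + x) ≤ 1 := by
            have := mul_le_mul_of_nonneg_right ht.2 (by linarith : 0 ≤ 1 + x)
            rwa [inv_mul_cancel₀ (by linarith)] at this
          nlinarith
      _ ≤ _ := lintegral_mono_set (Set.Ioc_subset_Ioc_right h1)
  calc ENNReal.ofReal (((1 + x) ^ (M + 1))⁻¹)
      = ENNReal.ofReal ((M + 1) * Real.exp 1) *
        ENNReal.ofReal (Real.exp (-1) * ((1 + x) ^ (M + 1))⁻¹ / (M + 1)) := by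
        rw [← ENNReal.ofReal_mul (by positivity), Real.exp_neg]
        congr 1
        field_simp
    _ ≤ _ := by gcongr

/-- Frequency-localized energy of `f` at frequencies at most `1/a`, up to polynomial tails, in terms
of the averages of `|f|` at scale `a`. -/
theorem weighted_energy : ∃ C : ℝ≥0∞, C ≠ ∞ ∧ ∀ (f : V → ℂ), Integrable f → Measurable f →
    ∀ (a : ℝ), 0 < a → ∀ Y : ℝ≥0∞,
    (∀ x, ∫⁻ y, ENNReal.ofReal (Real.exp (-(a ^ 2)⁻¹ * ‖x - y‖ ^ 2)) * ‖f y‖ₑ ≤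
      ENNReal.ofReal (a ^ Module.finrank ℝ V) * Y) →
    ∫⁻ ξ, ENNReal.ofReal (((1 + a ^ 2 * ‖ξ‖ ^ 2) ^ (Module.finrank ℝ V + 1))⁻¹) * ‖𝓕 f ξ‖ₑ ^ 2 ≤
      C * Y * ∫⁻ x, ‖f x‖ₑ := by
  set n := Module.finrank ℝ V with hn
  set c1 := ENNReal.ofReal ((n + 1) * Real.exp 1)
  set c2 := ENNReal.ofReal ((2 * Real.pi) ^ ((n : ℝ) / 2))
  refine ⟨c1 * c2, ENNReal.mul_ne_top ofReal_ne_top ofReal_ne_top, fun f hf hfm a ha Y hY => ?_⟩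
  have hFm : Measurable (𝓕 f) := (fourier_continuous hf).measurable
  calc ∫⁻ ξ, ENNReal.ofReal (((1 + a ^ 2 * ‖ξ‖ ^ 2) ^ (n + 1))⁻¹) * ‖𝓕 f ξ‖ₑ ^ 2
      ≤ ∫⁻ ξ, c1 * ∫⁻ t in Set.Ioc (0 : ℝ) 1,
          ENNReal.ofReal (t ^ n * Real.exp (-t * (a ^ 2 * ‖ξ‖ ^ 2))) * ‖𝓕 f ξ‖ₑ ^ 2 := by
        refine lintegral_mono fun ξ => ?_
        rw [lintegral_mul_const _ (by fun_prop), ← mul_assoc]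
        gcongr
        exact one_add_rpow_le_lintegral n (by positivity)
    _ = c1 * ∫⁻ t in Set.Ioc (0 : ℝ) 1, ∫⁻ ξ,
          ENNReal.ofReal (t ^ n * Real.exp (-t * (a ^ 2 * ‖ξ‖ ^ 2))) * ‖𝓕 f ξ‖ₑ ^ 2 := by
        rw [lintegral_const_mul, lintegral_lintegral_swap]
        · fun_prop
        · exact Measurable.lintegral_prod_right' (f := fun p : V × ℝ =>
            ENNReal.ofReal (p.2 ^ n * Real.exp (-p.2 * (a ^ 2 * ‖p.1‖ ^ 2))) * ‖𝓕 f p.1‖ₑ ^ 2)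
            (by fun_prop)
    _ ≤ c1 * ∫⁻ t in Set.Ioc (0 : ℝ) 1, c2 * Y * ∫⁻ x, ‖f x‖ₑ := by
        refine mul_le_mul_right (setLIntegral_mono' measurableSet_Ioc fun t ht => ?_) _
        have ht0 : 0 < t := ht.1
        set b := 2 * Real.pi ^ 2 / (t * a ^ 2) with hb
        have hb0 : 0 < b := by positivity
        have hba : (a ^ 2)⁻¹ ≤ b := by
          rw [hb, inv_eq_one_div, div_le_div_iff₀ (by positivity) (by positivity)]
          have : 1 ≤ Real.pi := by linarith [Real.pi_gt_three]
          have h3 : 1 ≤ Real.pi ^ 2 := one_le_pow₀ this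
          have h4 : 0 < a ^ 2 := by positivity
          have := ht.2
          nlinarith
        have h := gaussian_energy hf hfm hb0 (Y := ENNReal.ofReal (a ^ n) * Y) fun x =>
          le_trans (lintegral_mono fun y => by gcongr) (hY x)
        have e1 : 2 * Real.pi ^ 2 / b = t * a ^ 2 := by rw [hb]; field_simp
        simp_rw [ENNReal.ofReal_mul (pow_nonneg ht0.le n), mul_assoc]
        rw [lintegral_const_mul _ (by fun_prop)]
        have e2 : ∀ ξ : V, -t * (a ^ 2 * ‖ξ‖ ^ 2) = -(2 * Real.pi ^ 2 / b) * ‖ξ‖ ^ 2 :=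
          fun ξ => by rw [e1]; ring
        simp_rw [e2]
        refine (mul_le_mul_right h _).trans ?_
        rw [← hn]
        have e3 : ENNReal.ofReal (t ^ n) * (ENNReal.ofReal ((b / Real.pi) ^ ((n : ℝ) / 2)) *
            ENNReal.ofReal (a ^ n)) ≤ c2 := by
          rw [← ENNReal.ofReal_mul (by positivity), ← ENNReal.ofReal_mul (by positivity)]
          apply ENNReal.ofReal_le_ofReal
          have e4 : b / Real.pi = 2 * Real.pi * (t⁻¹ * (a ^ 2)⁻¹) := by rw [hb]; field_simp
          have e5 : ((a ^ 2)⁻¹) ^ ((n : ℝ) / 2) * a ^ n = 1 := by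
            rw [Real.inv_rpow (by positivity), ← Real.rpow_natCast a 2, ← Real.rpow_mul ha.le]
            have : ((2 : ℕ) : ℝ) * ((n : ℝ) / 2) = n := by push_cast; ring
            rw [this, Real.rpow_natCast]
            exact inv_mul_cancel₀ (by positivity)
          have e6 : t ^ n * (t⁻¹) ^ ((n : ℝ) / 2) ≤ 1 := by
            rw [Real.inv_rpow ht0.le, ← Real.rpow_natCast t n, ← Real.rpow_neg ht0.le,
              ← Real.rpow_add ht0]
            apply Real.rpow_le_one ht0.le ht.2
            have : (0 : ℝ) ≤ n := Nat.cast_nonneg n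
            linarith
          rw [e4, Real.mul_rpow (x := 2 * Real.pi) (by positivity) (by positivity),
            Real.mul_rpow (x := t⁻¹) (by positivity) (by positivity)]
          calc _ = (2 * Real.pi) ^ ((n : ℝ) / 2) * (t ^ n * (t⁻¹) ^ ((n : ℝ) / 2)) *
                (((a ^ 2)⁻¹) ^ ((n : ℝ) / 2) * a ^ n) := by ring
            _ ≤ (2 * Real.pi) ^ ((n : ℝ) / 2) * 1 * 1 := by rw [e5]; gcongr
            _ = _ := by ring
        calc _ = ENNReal.ofReal (t ^ n) * (ENNReal.ofReal ((b / Real.pi) ^ ((n : ℝ) / 2)) *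
            ENNReal.ofReal (a ^ n)) * (Y * ∫⁻ x, ‖f x‖ₑ) := by ring
          _ ≤ c2 * (Y * ∫⁻ x, ‖f x‖ₑ) := by gcongr
    _ = c1 * c2 * Y * ∫⁻ x, ‖f x‖ₑ := by
        rw [setLIntegral_const]; simp; ring

end energy

section cubes
variable {d : ℕ}

/-- The index of the dyadic cube of side length `2^k` containing `x`. -/
def cubeIdx (k : ℤ) (x : EuclideanSpace ℝ (Fin d)) : Fin d → ℤ := fun i => ⌊x i / 2 ^ k⌋

/-- The dyadic cube of side length `2^k` containing `x`. -/
def cube (k : ℤ) (x : EuclideanSpace ℝ (Fin d)) : Set (EuclideanSpace ℝ (Fin d)) :=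
  {y | cubeIdx k y = cubeIdx k x}

theorem mem_cube_comm {k : ℤ} {x y : EuclideanSpace ℝ (Fin d)} : y ∈ cube k x ↔ x ∈ cube k y :=
  eq_comm

theorem cube_eq_of_mem {k : ℤ} {x y : EuclideanSpace ℝ (Fin d)} (h : y ∈ cube k x) :
    cube k y = cube k x := by
  ext z
  change _ = _ ↔ _ = _
  rw [show cubeIdx k y = cubeIdx k x from h]

theorem measurable_cubeIdx (k : ℤ) : Measurable (cubeIdx (d := d) k) := by
  refine measurable_pi_lambda _ fun i => ?_
  unfold cubeIdx
  fun_prop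

theorem measurableSet_cube (k : ℤ) (x : EuclideanSpace ℝ (Fin d)) : MeasurableSet (cube k x) :=
  measurableSet_eq_fun (measurable_cubeIdx k) measurable_const

theorem measurableSet_cube_rel (k : ℤ) :
    MeasurableSet {p : EuclideanSpace ℝ (Fin d) × EuclideanSpace ℝ (Fin d) | p.2 ∈ cube k p.1} :=
  measurableSet_eq_fun ((measurable_cubeIdx k).comp measurable_snd)
    ((measurable_cubeIdx k).comp measurable_fst)

theorem volume_cube (k : ℤ) (x : EuclideanSpace ℝ (Fin d)) :
    volume (cube k x) = ENNReal.ofReal (((2 : ℝ) ^ k) ^ d) := by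
  have h0 : (0 : ℝ) < 2 ^ k := by positivity
  have h : cube k x = (WithLp.ofLp) ⁻¹' (Set.univ.pi fun i => Set.Ico
      ((cubeIdx k x i : ℝ) * 2 ^ k) (((cubeIdx k x i : ℝ) + 1) * 2 ^ k)) := by
    ext y
    simp only [cube, Set.mem_ofPred_eq, Set.mem_preimage, Set.mem_pi, Set.mem_univ, true_imp_iff,
      Set.mem_Ico, funext_iff]
    refine forall_congr' fun i => ?_
    rw [show cubeIdx k y i = ⌊y i / 2 ^ k⌋ from rfl, Int.floor_eq_iff, le_div_iff₀ h0,
      div_lt_iff₀ h0]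
  rw [h, (PiLp.volume_preserving_ofLp (Fin d)).measure_preimage
    (MeasurableSet.univ_pi fun i => measurableSet_Ico).nullMeasurableSet, Real.volume_pi_Ico]
  have : ∀ i, ((cubeIdx k x i : ℝ) + 1) * 2 ^ k - (cubeIdx k x i : ℝ) * 2 ^ k = 2 ^ k :=
    fun i => by ring
  simp_rw [this]
  rw [Finset.prod_const, Finset.card_univ, Fintype.card_fin, ENNReal.ofReal_pow h0.le]

theorem norm_sub_le_of_mem_cube {k : ℤ} {x y : EuclideanSpace ℝ (Fin d)} (h : y ∈ cube k x) :
    ‖x - y‖ ≤ d * 2 ^ k := by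
  have h0 : (0 : ℝ) < 2 ^ k := by positivity
  have hi : ∀ i, ‖(x - y) i‖ ≤ 2 ^ k := fun i => by
    have h1 : ⌊y i / 2 ^ k⌋ = ⌊x i / 2 ^ k⌋ := congrFun h i
    have h2 := Int.abs_sub_lt_one_of_floor_eq_floor h1
    rw [← sub_div, abs_div, abs_of_pos h0, div_lt_one h0, abs_sub_comm] at h2
    simpa using h2.le
  calc ‖x - y‖ ≤ ∑ i, ‖(x - y) i‖ := by
        rw [EuclideanSpace.norm_eq, Real.sqrt_le_left (Finset.sum_nonneg fun i _ => norm_nonneg _)]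
        exact Finset.sum_sq_le_sq_sum_of_nonneg fun i _ => norm_nonneg _
    _ ≤ ∑ i : Fin d, (2 : ℝ) ^ k := Finset.sum_le_sum fun i _ => hi i
    _ = _ := by simp

theorem cube_subset {k m : ℤ} (h : k ≤ m) (x : EuclideanSpace ℝ (Fin d)) :
    cube k x ⊆ cube m x := by
  obtain ⟨n, rfl⟩ := Int.le.dest h
  intro y hy
  have key : ∀ t : ℝ, ⌊t / 2 ^ (k + n)⌋ = ⌊t / 2 ^ k⌋ / ((2 ^ n : ℕ) : ℤ) := fun t => by
    rw [← Int.floor_div_natCast, div_div, zpow_add₀ two_ne_zero]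
    simp
  refine funext fun i => ?_
  change ⌊_⌋ = ⌊_⌋
  rw [key, key, show ⌊y i / 2 ^ k⌋ = ⌊x i / 2 ^ k⌋ from congrFun hy i]

/-- The average of a nonnegative function over the dyadic cube of side length `2^k`. -/
def eavg (k : ℤ) (u : EuclideanSpace ℝ (Fin d) → ℝ≥0∞) (x : EuclideanSpace ℝ (Fin d)) : ℝ≥0∞ :=
  (ENNReal.ofReal (((2 : ℝ) ^ k) ^ d))⁻¹ * ∫⁻ y in cube k x, u y

theorem cubeVol_ne_zero (k : ℤ) : ENNReal.ofReal (((2 : ℝ) ^ k) ^ d) ≠ 0 := by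
  simp; positivity

theorem eavg_congr {k m : ℤ} (hkm : k ≤ m) (u : EuclideanSpace ℝ (Fin d) → ℝ≥0∞)
    {x y : EuclideanSpace ℝ (Fin d)} (h : y ∈ cube k x) : eavg m u y = eavg m u x := by
  rw [eavg, eavg, cube_eq_of_mem (cube_subset hkm x h)]

theorem measurable_indicator_cube_rel (k : ℤ) {v : EuclideanSpace ℝ (Fin d) →
    EuclideanSpace ℝ (Fin d) → ℝ≥0∞} (hv : Measurable (Function.uncurry v)) :
    Measurable (Function.uncurry fun x y => (cube k x).indicator (v x) y) := by
  have : (Function.uncurry fun x y => (cube k x).indicator (v x) y) =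
      {p : EuclideanSpace ℝ (Fin d) × EuclideanSpace ℝ (Fin d) | p.2 ∈ cube k p.1}.indicator
        (Function.uncurry v) := by
    ext ⟨x, y⟩
    simp [Set.indicator, Function.uncurry]
  rw [this]
  exact hv.indicator (measurableSet_cube_rel k)

theorem lintegral_cube_swap (k : ℤ) {v : EuclideanSpace ℝ (Fin d) →
    EuclideanSpace ℝ (Fin d) → ℝ≥0∞} (hv : Measurable (Function.uncurry v)) :
    ∫⁻ x, ∫⁻ y in cube k x, v x y = ∫⁻ y, ∫⁻ x in cube k y, v x y := by
  simp_rw [← lintegral_indicator (measurableSet_cube k _)]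
  rw [lintegral_lintegral_swap (measurable_indicator_cube_rel k hv).aemeasurable]
  refine lintegral_congr fun y => lintegral_congr fun x => ?_
  by_cases h : y ∈ cube k x
  · simp [h, mem_cube_comm.1 h]
  · simp [h, mt mem_cube_comm.1 h]

theorem measurable_lintegral_cube (k : ℤ) {v : EuclideanSpace ℝ (Fin d) →
    EuclideanSpace ℝ (Fin d) → ℝ≥0∞} (hv : Measurable (Function.uncurry v)) :
    Measurable fun x => ∫⁻ y in cube k x, v x y := by
  simp_rw [← lintegral_indicator (measurableSet_cube k _)]
  exact (measurable_indicator_cube_rel k hv).lintegral_prod_right'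

theorem measurable_eavg (k : ℤ) {u : EuclideanSpace ℝ (Fin d) → ℝ≥0∞} (hu : Measurable u) :
    Measurable (eavg k u) :=
  (measurable_lintegral_cube k (v := fun _ y => u y) (hu.comp measurable_snd)).const_mul _

theorem cubeVol_inv_mul (k : ℤ) :
    (ENNReal.ofReal (((2 : ℝ) ^ k) ^ d))⁻¹ * ENNReal.ofReal (((2 : ℝ) ^ k) ^ d) = 1 :=
  ENNReal.inv_mul_cancel (cubeVol_ne_zero k) ofReal_ne_top

/-- Mass transport: moving `u` within cubes. -/
theorem lintegral_mul_le_eavg (k : ℤ) {u φ φ' : EuclideanSpace ℝ (Fin d) → ℝ≥0∞}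
    (hu : Measurable u) (hφ' : Measurable φ')
    (h : ∀ x, ∀ y ∈ cube k x, φ x ≤ φ' y) :
    ∫⁻ x, φ x * u x ≤ ∫⁻ x, φ' x * eavg k u x := by
  set c := ENNReal.ofReal (((2 : ℝ) ^ k) ^ d) with hc
  have hcm : c⁻¹ * c = 1 := cubeVol_inv_mul k
  calc ∫⁻ x, φ x * u x = ∫⁻ x, c⁻¹ * ∫⁻ y in cube k x, φ x * u x := by
        refine lintegral_congr fun x => ?_
        rw [setLIntegral_const, volume_cube, ← hc, mul_left_comm, hcm, mul_one]
    _ ≤ ∫⁻ x, c⁻¹ * ∫⁻ y in cube k x, φ' y * u x := by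
        refine lintegral_mono fun x => ?_
        refine mul_le_mul_right (setLIntegral_mono' (measurableSet_cube k x) fun y hy => ?_) _
        gcongr
        exact h x y hy
    _ = c⁻¹ * ∫⁻ x, ∫⁻ y in cube k x, φ' y * u x := by
        rw [lintegral_const_mul _ (measurable_lintegral_cube k (by fun_prop))]
    _ = c⁻¹ * ∫⁻ y, ∫⁻ x in cube k y, φ' y * u x := by
        rw [lintegral_cube_swap k (by fun_prop)]
    _ = ∫⁻ x, c⁻¹ * ∫⁻ y in cube k x, φ' x * u y := by
        rw [lintegral_const_mul _ (measurable_lintegral_cube k (by fun_prop))]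
    _ = _ := by
        refine lintegral_congr fun x => ?_
        rw [lintegral_const_mul _ hu, eavg]
        ring

theorem lintegral_mul_eavg (k : ℤ) {u φ : EuclideanSpace ℝ (Fin d) → ℝ≥0∞}
    (hu : Measurable u) (hφ : Measurable φ)
    (h : ∀ x, ∀ y ∈ cube k x, φ x = φ y) :
    ∫⁻ x, φ x * eavg k u x = ∫⁻ x, φ x * u x := by
  set c := ENNReal.ofReal (((2 : ℝ) ^ k) ^ d) with hc
  have hcm : c⁻¹ * c = 1 := cubeVol_inv_mul k
  symm
  calc ∫⁻ x, φ x * u x = ∫⁻ x, c⁻¹ * ∫⁻ y in cube k x, φ x * u x := by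
        refine lintegral_congr fun x => ?_
        rw [setLIntegral_const, volume_cube, ← hc, mul_left_comm, hcm, mul_one]
    _ = ∫⁻ x, c⁻¹ * ∫⁻ y in cube k x, φ y * u x := by
        refine lintegral_congr fun x => ?_
        congr 1
        refine setLIntegral_congr_fun (measurableSet_cube k x) fun y hy => ?_
        simp only [h x y hy]
    _ = c⁻¹ * ∫⁻ x, ∫⁻ y in cube k x, φ y * u x := by
        rw [lintegral_const_mul _ (measurable_lintegral_cube k (by fun_prop))]
    _ = c⁻¹ * ∫⁻ y, ∫⁻ x in cube k y, φ y * u x := by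
        rw [lintegral_cube_swap k (by fun_prop)]
    _ = ∫⁻ x, c⁻¹ * ∫⁻ y in cube k x, φ x * u y := by
        rw [lintegral_const_mul _ (measurable_lintegral_cube k (by fun_prop))]
    _ = _ := by
        refine lintegral_congr fun x => ?_
        rw [lintegral_const_mul _ hu, eavg]
        ring

theorem eavg_const (k : ℤ) (c : ℝ≥0∞) (x : EuclideanSpace ℝ (Fin d)) :
    eavg k (fun _ => c) x = c := by
  rw [eavg, setLIntegral_const, volume_cube, mul_comm c, ← mul_assoc, cubeVol_inv_mul, one_mul]

theorem eavg_mono (k : ℤ) {u v : EuclideanSpace ℝ (Fin d) → ℝ≥0∞} {x : EuclideanSpace ℝ (Fin d)}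
    (h : ∀ y ∈ cube k x, u y ≤ v y) : eavg k u x ≤ eavg k v x :=
  mul_le_mul_right (setLIntegral_mono' (measurableSet_cube k x) h) _

theorem eavg_add (k : ℤ) {u v : EuclideanSpace ℝ (Fin d) → ℝ≥0∞} (hu : Measurable u)
    (x : EuclideanSpace ℝ (Fin d)) : eavg k (fun y => u y + v y) x = eavg k u x + eavg k v x := by
  rw [eavg, eavg, eavg, lintegral_add_left hu, mul_add]

theorem eavg_le_eavg_succ (k : ℤ) (u : EuclideanSpace ℝ (Fin d) → ℝ≥0∞)
    (x : EuclideanSpace ℝ (Fin d)) : eavg k u x ≤ 2 ^ d * eavg (k + 1) u x := by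
  rw [eavg, eavg, ← mul_assoc]
  refine mul_le_mul' (le_of_eq ?_) (lintegral_mono_set (cube_subset (by omega) x))
  rw [zpow_add_one₀ two_ne_zero, mul_pow, ENNReal.ofReal_mul (by positivity),
    ENNReal.mul_inv (Or.inl (cubeVol_ne_zero k)) (Or.inl ofReal_ne_top)]
  have : ENNReal.ofReal ((2 : ℝ) ^ d) = 2 ^ d := by
    rw [ENNReal.ofReal_pow zero_le_two]; simp
  rw [this, mul_comm, mul_assoc, ENNReal.inv_mul_cancel (by simp) (by simp), mul_one]

theorem eavg_le_of_lintegral (k : ℤ) (u : EuclideanSpace ℝ (Fin d) → ℝ≥0∞)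
    (x : EuclideanSpace ℝ (Fin d)) :
    eavg k u x ≤ (ENNReal.ofReal (((2 : ℝ) ^ k) ^ d))⁻¹ * ∫⁻ y, u y :=
  mul_le_mul_right (setLIntegral_le_lintegral _ _) _

end cubes

section calderonZygmund
variable {d : ℕ}

/-- The average of a complex function over the dyadic cube of side length `2^k`. -/
def cavg (k : ℤ) (f : EuclideanSpace ℝ (Fin d) → ℂ) (x : EuclideanSpace ℝ (Fin d)) : ℂ :=
  ⨍ y in cube k x, f y

/-- The points at which `2^k` is the largest scale where the dyadic average of `u` exceeds `a`. -/
def stopSet (u : EuclideanSpace ℝ (Fin d) → ℝ≥0∞) (a : ℝ≥0∞) (k : ℤ) :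
    Set (EuclideanSpace ℝ (Fin d)) :=
  {x | a < eavg k u x ∧ ∀ m, k < m → eavg m u x ≤ a}

/-- The part of the bad function living on cubes of side length `2^k`. -/
def badPart (f : EuclideanSpace ℝ (Fin d) → ℂ) (a : ℝ≥0∞) (k : ℤ) :
    EuclideanSpace ℝ (Fin d) → ℂ :=
  (stopSet (fun x => ‖f x‖ₑ) a k).indicator fun x => f x - cavg k f x

/-- The properties of a family of bad functions that are used below: `B k` has mean zero on dyadic
cubes of side `2^k`, and at scales above `2^k` the sum of the `|B i|`, `i ≤ k`, has averages at
most `M`. -/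
structure IsBadFamily (S : Finset ℤ) (B : ℤ → EuclideanSpace ℝ (Fin d) → ℂ) (M : ℝ≥0∞) : Prop where
  measurable : ∀ k, Measurable (B k)
  bounded : ∃ C : ℝ, ∀ k x, ‖B k x‖ ≤ C
  integrable : ∀ k, Integrable (B k)
  mass : ∀ S' ⊆ S, ∀ k : ℤ, (∀ i ∈ S', i ≤ k) → ∀ φ φ' : EuclideanSpace ℝ (Fin d) → ℝ≥0∞,
    Measurable φ → Measurable φ' → (∀ x y, ‖x - y‖ ≤ d * 2 ^ k → φ x ≤ φ' y) →
    ∑ i ∈ S', ∫⁻ x, φ x * ‖B i x‖ₑ ≤ M * ∫⁻ x, φ' x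
  cancel : ∀ k x, ∫ y in cube k x, B k y = 0

theorem measurableSet_stopSet {u : EuclideanSpace ℝ (Fin d) → ℝ≥0∞} (hu : Measurable u) (a : ℝ≥0∞)
    (k : ℤ) : MeasurableSet (stopSet u a k) := by
  have : stopSet u a k = {x | a < eavg k u x} ∩ ⋂ m, ⋂ (_ : k < m), {x | eavg m u x ≤ a} := by
    ext x; simp [stopSet]
  rw [this]
  refine (measurableSet_lt measurable_const (measurable_eavg k hu)).inter
    (MeasurableSet.iInter fun m => MeasurableSet.iInter fun _ => ?_)
  exact measurableSet_le (measurable_eavg m hu) measurable_const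

theorem mem_stopSet_congr {u : EuclideanSpace ℝ (Fin d) → ℝ≥0∞} {a : ℝ≥0∞} {k : ℤ}
    {x y : EuclideanSpace ℝ (Fin d)} (h : y ∈ cube k x) :
    y ∈ stopSet u a k ↔ x ∈ stopSet u a k := by
  refine and_congr (by rw [eavg_congr le_rfl u h]) (forall_congr' fun m => ?_)
  exact imp_congr_right fun hm => by rw [eavg_congr hm.le u h]

theorem stopSet_disjoint {u : EuclideanSpace ℝ (Fin d) → ℝ≥0∞} {a : ℝ≥0∞} {k m : ℤ}
    {x : EuclideanSpace ℝ (Fin d)} (hk : x ∈ stopSet u a k) (hm : x ∈ stopSet u a m) : k = m := by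
  rcases lt_trichotomy k m with h | h | h
  · exact absurd hm.1 (hk.2 m h).not_gt
  · exact h
  · exact absurd hk.1 (hm.2 k h).not_gt

theorem sum_indicator_stopSet_le (u : EuclideanSpace ℝ (Fin d) → ℝ≥0∞) (a : ℝ≥0∞) (S : Finset ℤ)
    (x : EuclideanSpace ℝ (Fin d)) :
    ∑ k ∈ S, (stopSet u a k).indicator (fun _ => (1 : ℝ≥0∞)) x ≤ 1 := by
  by_cases h : ∃ k ∈ S, x ∈ stopSet u a k
  · obtain ⟨k, hk, hx⟩ := h
    rw [Finset.sum_eq_single_of_mem k hk]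
    · simp [hx]
    · intro m _ hm
      exact Set.indicator_of_notMem (fun h => hm (stopSet_disjoint h hx)) _
  · push Not at h
    rw [Finset.sum_eq_zero fun k hk => Set.indicator_of_notMem (h k hk) _]
    exact zero_le

theorem measureReal_cube (k : ℤ) (x : EuclideanSpace ℝ (Fin d)) :
    volume.real (cube k x) = ((2 : ℝ) ^ k) ^ d := by
  rw [Measure.real, volume_cube, ENNReal.toReal_ofReal (by positivity)]

theorem enorm_cavg_le (k : ℤ) (f : EuclideanSpace ℝ (Fin d) → ℂ) (x : EuclideanSpace ℝ (Fin d)) :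
    ‖cavg k f x‖ₑ ≤ eavg k (fun y => ‖f y‖ₑ) x := by
  rw [cavg, setAverage_eq, enorm_smul, eavg, measureReal_cube]
  refine mul_le_mul' (le_of_eq ?_) (enorm_integral_le_lintegral_enorm _)
  rw [enorm_inv (by positivity), Real.enorm_of_nonneg (by positivity)]

theorem measurable_cavg (k : ℤ) {f : EuclideanSpace ℝ (Fin d) → ℂ} (hf : Measurable f) :
    Measurable (cavg k f) := by
  have h : cavg k f = fun x => (((2 : ℝ) ^ k) ^ d)⁻¹ • ∫ y, (cube k x).indicator f y := by
    ext x
    rw [cavg, setAverage_eq, measureReal_cube, integral_indicator (measurableSet_cube k x)]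
  have h2 : Measurable (Function.uncurry fun x y => (cube k x).indicator f y) := by
    have : (Function.uncurry fun x y => (cube k x).indicator f y) =
        {p : EuclideanSpace ℝ (Fin d) × EuclideanSpace ℝ (Fin d) | p.2 ∈ cube k p.1}.indicator
          (fun p => f p.2) := by
      ext ⟨x, y⟩
      simp [Set.indicator, Function.uncurry]
    rw [this]
    exact (hf.comp measurable_snd).indicator (measurableSet_cube_rel k)
  rw [h]
  exact (h2.stronglyMeasurable.integral_prod_right (ν := volume)).measurable.const_smul (((2 : ℝ) ^ k) ^ d)⁻¹

theorem cavg_congr {k : ℤ} (f : EuclideanSpace ℝ (Fin d) → ℂ)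
    {x y : EuclideanSpace ℝ (Fin d)} (h : y ∈ cube k x) : cavg k f y = cavg k f x := by
  rw [cavg, cavg, cube_eq_of_mem h]

theorem setIntegral_badPart {f : EuclideanSpace ℝ (Fin d) → ℂ} (hf : Integrable f) (a : ℝ≥0∞)
    (k : ℤ) (x : EuclideanSpace ℝ (Fin d)) : ∫ y in cube k x, badPart f a k y = 0 := by
  by_cases hx : x ∈ stopSet (fun x => ‖f x‖ₑ) a k
  · have h : ∀ y ∈ cube k x, badPart f a k y = f y - cavg k f x := fun y hy => by
      rw [badPart, Set.indicator_of_mem ((mem_stopSet_congr hy).2 hx), cavg_congr f hy]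
    have hv : volume (cube k x) ≠ ∞ := by rw [volume_cube]; exact ofReal_ne_top
    rw [setIntegral_congr_fun (measurableSet_cube k x) h, integral_sub hf.integrableOn
      (integrableOn_const hv), setIntegral_const, cavg, setAverage_eq, measureReal_cube, smul_smul,
      mul_inv_cancel₀ (by positivity), one_smul, sub_self]
  · have h : ∀ y ∈ cube k x, badPart f a k y = 0 := fun y hy =>
      Set.indicator_of_notMem (fun h => hx ((mem_stopSet_congr hy).1 h)) _
    rw [setIntegral_congr_fun (measurableSet_cube k x) h, integral_zero]

theorem enorm_badPart_le (f : EuclideanSpace ℝ (Fin d) → ℂ) (a : ℝ≥0∞)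
    (k : ℤ) (x : EuclideanSpace ℝ (Fin d)) : ‖badPart f a k x‖ₑ ≤
      (stopSet (fun x => ‖f x‖ₑ) a k).indicator (fun _ => 1) x *
        (‖f x‖ₑ + eavg k (fun x => ‖f x‖ₑ) x) := by
  by_cases hx : x ∈ stopSet (fun x => ‖f x‖ₑ) a k
  · rw [badPart, Set.indicator_of_mem hx, Set.indicator_of_mem hx, one_mul]
    exact (enorm_sub_le).trans (add_le_add_right (enorm_cavg_le k f x) _)
  · simp [badPart, hx]

theorem measurable_badPart {f : EuclideanSpace ℝ (Fin d) → ℂ} (hf : Measurable f) (a : ℝ≥0∞)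
    (k : ℤ) : Measurable (badPart f a k) :=
  (hf.sub (measurable_cavg k hf)).indicator (measurableSet_stopSet hf.enorm a k)

theorem eavg_badPart_le {f : EuclideanSpace ℝ (Fin d) → ℂ} (hf : Measurable f) (a : ℝ≥0∞)
    (k : ℤ) (x : EuclideanSpace ℝ (Fin d)) : eavg k (fun y => ‖badPart f a k y‖ₑ) x ≤
      2 ^ (d + 1) * a * (stopSet (fun x => ‖f x‖ₑ) a k).indicator (fun _ => 1) x := by
  set u := fun x => ‖f x‖ₑ with hu
  by_cases hx : x ∈ stopSet u a k
  · rw [Set.indicator_of_mem hx, mul_one]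
    calc eavg k (fun y => ‖badPart f a k y‖ₑ) x ≤ eavg k (fun y => u y + eavg k u x) x := by
          refine eavg_mono k fun y hy => ?_
          rw [← eavg_congr le_rfl u hy]
          refine (enorm_badPart_le f a k y).trans ?_
          rw [Set.indicator_of_mem ((mem_stopSet_congr hy).2 hx), one_mul]
      _ = 2 * eavg k u x := by
          rw [eavg_add k hf.enorm, eavg_const, two_mul]
      _ ≤ 2 * (2 ^ d * a) := by
          gcongr
          exact (eavg_le_eavg_succ k u x).trans (by gcongr; exact hx.2 _ (by omega))
      _ = _ := by ring
  · refine le_of_eq_of_le ?_ zero_le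
    have h : ∀ y ∈ cube k x, ‖badPart f a k y‖ₑ = 0 := fun y hy => by
      rw [badPart, Set.indicator_of_notMem (fun h => hx ((mem_stopSet_congr hy).1 h)), enorm_zero]
    rw [eavg, setLIntegral_congr_fun (measurableSet_cube k x) h]
    simp

theorem sum_lintegral_indicator_mul_le {u v : EuclideanSpace ℝ (Fin d) → ℝ≥0∞} (hu : Measurable u)
    (hv : Measurable v) (a : ℝ≥0∞) (S : Finset ℤ) :
    ∑ k ∈ S, ∫⁻ x, (stopSet u a k).indicator (fun _ => 1) x * v x ≤ ∫⁻ x, v x := by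
  rw [← lintegral_finsetSum]
  · refine lintegral_mono fun x => ?_
    rw [← Finset.sum_mul]
    exact mul_le_of_le_one_left zero_le (sum_indicator_stopSet_le u a S x)
  · intro k _
    exact (measurable_const.indicator (measurableSet_stopSet hu a k)).mul hv

theorem lintegral_indicator_mul_eavg {u : EuclideanSpace ℝ (Fin d) → ℝ≥0∞} (hu : Measurable u)
    (a : ℝ≥0∞) (k : ℤ) :
    ∫⁻ x, (stopSet u a k).indicator (fun _ => 1) x * eavg k u x =
      ∫⁻ x, (stopSet u a k).indicator (fun _ => 1) x * u x := by
  refine lintegral_mul_eavg k hu (measurable_const.indicator (measurableSet_stopSet hu a k))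
    fun x y hy => ?_
  by_cases hx : x ∈ stopSet u a k
  · rw [Set.indicator_of_mem hx, Set.indicator_of_mem ((mem_stopSet_congr hy).2 hx)]
  · rw [Set.indicator_of_notMem hx,
      Set.indicator_of_notMem fun h => hx ((mem_stopSet_congr hy).1 h)]

theorem lintegral_badPart_le {f : EuclideanSpace ℝ (Fin d) → ℂ} (hf : Measurable f) (a : ℝ≥0∞)
    (k : ℤ) : ∫⁻ x, ‖badPart f a k x‖ₑ ≤
      2 * ∫⁻ x, (stopSet (fun x => ‖f x‖ₑ) a k).indicator (fun _ => 1) x * ‖f x‖ₑ := by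
  refine (lintegral_mono (enorm_badPart_le f a k)).trans_eq ?_
  simp_rw [mul_add]
  rw [lintegral_add_left, lintegral_indicator_mul_eavg hf.enorm, two_mul]
  exact (measurable_const.indicator (measurableSet_stopSet hf.enorm a k)).mul hf.enorm

theorem isBadFamily_badPart {f : EuclideanSpace ℝ (Fin d) → ℂ} (hf : Measurable f)
    (hfi : Integrable f) {C : ℝ} (hC : ∀ x, ‖f x‖ ≤ C) (a : ℝ≥0∞) (S : Finset ℤ) :
    IsBadFamily S (badPart f a) (2 ^ (d + 1) * a) where
  measurable k := measurable_badPart hf a k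
  bounded := by
    have hC0 : 0 ≤ C := (norm_nonneg _).trans (hC 0)
    have hCe : ∀ x, ‖f x‖ₑ ≤ ENNReal.ofReal C := fun x => by
      rw [← ofReal_norm]; exact ENNReal.ofReal_le_ofReal (hC x)
    refine ⟨2 * C, fun k x => ?_⟩
    rw [← ENNReal.ofReal_le_ofReal_iff (by positivity), ofReal_norm]
    refine (enorm_badPart_le f a k x).trans ((mul_le_of_le_one_left zero_le ?_).trans ?_)
    · exact Set.indicator_apply_le' (fun _ => le_rfl) fun _ => zero_le_one
    · rw [two_mul, ENNReal.ofReal_add hC0 hC0]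
      refine add_le_add (hCe x) ?_
      rw [← eavg_const k (ENNReal.ofReal C) x]
      exact eavg_mono k fun y _ => hCe y
  integrable k := by
    refine ⟨(measurable_badPart hf a k).aestronglyMeasurable, ?_⟩
    refine (lintegral_badPart_le hf a k).trans_lt (ENNReal.mul_lt_top (by simp) ?_)
    refine lt_of_le_of_lt (lintegral_mono fun x => mul_le_of_le_one_left zero_le ?_) hfi.2
    exact Set.indicator_apply_le' (fun _ => le_rfl) fun _ => zero_le_one
  mass S' _ k hk φ φ' _ hφ' h := by
    set u := fun x => ‖f x‖ₑ with hu
    calc ∑ i ∈ S', ∫⁻ x, φ x * ‖badPart f a i x‖ₑ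
        ≤ ∑ i ∈ S', ∫⁻ x, (stopSet u a i).indicator (fun _ => 1) x *
            (2 ^ (d + 1) * a * φ' x) := by
          refine Finset.sum_le_sum fun i hi => ?_
          refine (lintegral_mul_le_eavg i (measurable_badPart hf a i).enorm hφ'
            fun x y hy => h x y ?_).trans (lintegral_mono fun x => ?_)
          · refine (norm_sub_le_of_mem_cube hy).trans ?_
            gcongr
            · norm_num
            · exact hk i hi
          · refine (mul_le_mul_right (eavg_badPart_le hf a i x) _).trans_eq ?_
            ring
      _ ≤ ∫⁻ x, 2 ^ (d + 1) * a * φ' x :=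
          sum_lintegral_indicator_mul_le hf.enorm (by fun_prop) a S'
      _ = _ := lintegral_const_mul _ hφ'
  cancel k x := setIntegral_badPart hfi a k x

theorem sum_lintegral_badPart_le {f : EuclideanSpace ℝ (Fin d) → ℂ} (hf : Measurable f) (a : ℝ≥0∞)
    (S : Finset ℤ) : ∑ k ∈ S, ∫⁻ x, ‖badPart f a k x‖ₑ ≤ 2 * ∫⁻ x, ‖f x‖ₑ := by
  refine (Finset.sum_le_sum fun k _ => lintegral_badPart_le hf a k).trans ?_
  rw [← Finset.mul_sum]
  exact mul_le_mul_right (sum_lintegral_indicator_mul_le hf.enorm hf.enorm a S) _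

/-- The exceptional set: a neighbourhood, of width proportional to `2^k`, of the stopping cubes. -/
theorem exists_exceptional_set (d : ℕ) (L : ℝ) :
    ∃ C : ℝ≥0∞, C ≠ ∞ ∧ ∀ u : EuclideanSpace ℝ (Fin d) → ℝ≥0∞, Measurable u →
      ∀ a : ℝ≥0∞, a ≠ 0 → a ≠ ∞ → ∀ S : Finset ℤ, ∃ X : Set (EuclideanSpace ℝ (Fin d)),
        MeasurableSet X ∧ volume X ≤ C * a⁻¹ * ∫⁻ x, u x ∧
        ∀ k ∈ S, ∀ x y, y ∈ stopSet u a k → ‖x - y‖ ≤ L * 2 ^ k → x ∈ X := by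
  refine ⟨volume (closedBall (0 : EuclideanSpace ℝ (Fin d)) (L + d)),
    measure_closedBall_lt_top.ne, fun u hu a ha0 ha S => ?_⟩
  set N : ℝ≥0∞ := volume (closedBall (0 : EuclideanSpace ℝ (Fin d)) (L + d)) with hN
  set w : ℤ → EuclideanSpace ℝ (Fin d) → EuclideanSpace ℝ (Fin d) → ℝ≥0∞ := fun k x z =>
    (closedBall 0 ((L + d) * 2 ^ k)).indicator (fun _ => 1) (x - z) *
      (stopSet u a k).indicator (fun _ => 1) z with hw
  have hbm : ∀ k : ℤ, Measurable ((closedBall (0 : EuclideanSpace ℝ (Fin d)) ((L + d) * 2 ^ k)).indicator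
      (fun _ => (1 : ℝ≥0∞))) := fun k => measurable_const.indicator measurableSet_closedBall
  have hsm : ∀ k, Measurable ((stopSet u a k).indicator (fun _ => (1 : ℝ≥0∞))) := fun k =>
    measurable_const.indicator (measurableSet_stopSet hu a k)
  have hwm : ∀ k, Measurable fun x => ∫⁻ z, w k x z := fun k => by
    refine Measurable.lintegral_prod_right' (f := fun p : EuclideanSpace ℝ (Fin d) ×
      EuclideanSpace ℝ (Fin d) => w k p.1 p.2) ?_
    exact ((hbm k).comp (measurable_fst.sub measurable_snd)).mul ((hsm k).comp measurable_snd)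
  set X : ℤ → Set (EuclideanSpace ℝ (Fin d)) := fun k =>
    {x | ENNReal.ofReal (((2 : ℝ) ^ k) ^ d) ≤ ∫⁻ z, w k x z} with hX
  have hXm : ∀ k, MeasurableSet (X k) := fun k => measurableSet_le measurable_const (hwm k)
  have hXv : ∀ k, volume (X k) ≤
      N * a⁻¹ * ∫⁻ x, (stopSet u a k).indicator (fun _ => 1) x * u x := fun k => by
    have h2 : (0 : ℝ) < 2 ^ k := by positivity
    have hvol : volume (closedBall (0 : EuclideanSpace ℝ (Fin d)) ((L + d) * 2 ^ k)) =
        ENNReal.ofReal (((2 : ℝ) ^ k) ^ d) * N := by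
      have := Measure.addHaar_closedBall_mul_of_pos volume (0 : EuclideanSpace ℝ (Fin d)) h2 (L + d)
      rwa [finrank_euclideanSpace_fin, mul_comm _ (L + d)] at this
    have h1 : ENNReal.ofReal (((2 : ℝ) ^ k) ^ d) * volume (X k) ≤
        ENNReal.ofReal (((2 : ℝ) ^ k) ^ d) * (N * volume (stopSet u a k)) := by
      refine (mul_meas_ge_le_lintegral (hwm k) _).trans_eq ?_
      rw [hw, lintegral_lintegral_conv (hbm k) (hsm k), lintegral_indicator_const
        measurableSet_closedBall, lintegral_indicator_const (measurableSet_stopSet hu a k), hvol]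
      ring
    rw [ENNReal.mul_le_mul_iff_right (cubeVol_ne_zero k) ofReal_ne_top] at h1
    refine h1.trans ?_
    rw [mul_assoc]
    gcongr
    rw [← lintegral_indicator_mul_eavg hu, ← lintegral_const_mul a⁻¹ (f := fun x =>
      (stopSet u a k).indicator (fun _ => 1) x * eavg k u x)
      ((hsm k).mul (measurable_eavg k hu)), ← one_mul (volume _),
      ← lintegral_indicator_const (measurableSet_stopSet hu a k)]
    refine lintegral_mono fun x => ?_
    by_cases hx : x ∈ stopSet u a k
    · simp only [Set.indicator_of_mem hx, one_mul]
      rw [← ENNReal.inv_mul_cancel ha0 ha]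
      gcongr
      exact hx.1.le
    · simp [hx]
  refine ⟨⋃ k ∈ S, X k, Finset.measurableSet_biUnion _ fun k _ => hXm k, ?_, ?_⟩
  · refine (measure_biUnion_finset_le S X).trans ((Finset.sum_le_sum fun k _ => hXv k).trans ?_)
    rw [← Finset.mul_sum]
    exact mul_le_mul_right (sum_lintegral_indicator_mul_le hu hu a S) _
  · intro k hk x y hy hxy
    refine Set.mem_biUnion hk ?_
    rw [hX, Set.mem_ofPred_eq, ← volume_cube k y, ← one_mul (volume _), ← lintegral_indicator_const (measurableSet_cube k y)]
    refine lintegral_mono fun z => ?_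
    by_cases hz : z ∈ cube k y
    · have hxz : x - z ∈ closedBall (0 : EuclideanSpace ℝ (Fin d)) ((L + d) * 2 ^ k) := by
        rw [mem_closedBall_zero_iff, add_mul]
        refine (norm_sub_le_norm_sub_add_norm_sub x y z).trans ?_
        exact add_le_add hxy (norm_sub_le_of_mem_cube hz)
      simp [w, hz, hxz, (mem_stopSet_congr hz).2 hy]
    · simp [hz]

/-- Calderón–Zygmund decomposition. -/
theorem exists_calderonZygmund (hd : 1 ≤ d) {f : EuclideanSpace ℝ (Fin d) → ℂ} (hf : Continuous f)
    (hfc : HasCompactSupport f) {α : ℝ} (hα : 0 < α) :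
    ∃ S : Finset ℤ, ∀ x, ‖f x - ∑ k ∈ S, badPart f (ENNReal.ofReal α) k x‖ₑ ≤
      2 ^ d * ENNReal.ofReal α := by
  set a := ENNReal.ofReal α with ha
  have ha0 : a ≠ 0 := by simpa [ha] using hα
  set u := fun x => ‖f x‖ₑ with hu
  have hfi : Integrable f := hf.integrable_of_hasCompactSupport hfc
  have hI : ∫⁻ x, u x ≠ ∞ := hfi.2.ne
  obtain ⟨n, hn⟩ := pow_unbounded_of_one_lt ((∫⁻ x, u x).toReal / α) (one_lt_two (α := ℝ))
  have htop : ∀ m : ℤ, n ≤ m → ∀ x, eavg m u x ≤ a := fun m hm x => by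
    refine (eavg_le_of_lintegral m u x).trans ?_
    rw [ENNReal.inv_mul_le_iff (cubeVol_ne_zero m) ofReal_ne_top, ha,
      ← ENNReal.ofReal_mul (by positivity), ← ENNReal.ofReal_toReal hI]
    apply ENNReal.ofReal_le_ofReal
    rw [div_lt_iff₀ hα] at hn
    refine hn.le.trans ?_
    gcongr
    have h1 : (2 : ℝ) ^ n ≤ 2 ^ m := by
      rw [← zpow_natCast]; exact zpow_le_zpow_right₀ one_le_two hm
    refine h1.trans (le_self_pow₀ ((one_le_pow₀ one_le_two).trans h1) (by omega))
  obtain ⟨δ, hδ, hfδ⟩ := Metric.uniformContinuous_iff.1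
    (hfc.uniformContinuous_of_continuous hf) α hα
  obtain ⟨n0, hn0⟩ := exists_pow_lt_of_lt_one (y := (1 / 2 : ℝ)) (show 0 < δ / (d + 1) by positivity)
    (by norm_num)
  have hk0 : (d : ℝ) * 2 ^ (-(n0 : ℤ)) < δ := by
    rw [lt_div_iff₀ (by positivity)] at hn0
    have h3 : (1 / 2 : ℝ) ^ n0 = 2 ^ (-(n0 : ℤ)) := by simp
    have h4 : (0 : ℝ) < 2 ^ (-(n0 : ℤ)) := by positivity
    rw [h3] at hn0
    nlinarith
  have ha2 : a + a ≤ 2 ^ d * a := by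
    rw [← two_mul]
    gcongr
    exact le_self_pow₀ one_le_two (by omega)
  refine ⟨Finset.Icc (-(n0 : ℤ)) n, fun x => ?_⟩
  by_cases hx : ∃ k ∈ Finset.Icc (-(n0 : ℤ)) n, x ∈ stopSet u a k
  · obtain ⟨k, hk, hxk⟩ := hx
    rw [Finset.sum_eq_single_of_mem k hk, badPart, Set.indicator_of_mem hxk, _root_.sub_sub_cancel]
    · refine (enorm_cavg_le k f x).trans ((eavg_le_eavg_succ k u x).trans ?_)
      gcongr
      exact hxk.2 _ (by omega)
    · intro m _ hm
      exact Set.indicator_of_notMem (fun h => hm (stopSet_disjoint h hxk)) _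
  · push Not at hx
    have hz : ∑ k ∈ Finset.Icc (-(n0 : ℤ)) n, badPart f a k x = 0 :=
      Finset.sum_eq_zero fun k hk => Set.indicator_of_notMem (hx k hk) _
    rw [hz, sub_zero]
    have h0 : eavg (-(n0 : ℤ)) u x ≤ a := by
      by_contra! hcon
      obtain ⟨k, hk, hmax⟩ := Int.exists_greatest_of_bdd (P := fun k => a < eavg k u x)
        ⟨n, fun m hm => by
          by_contra! h
          exact (htop m h.le x).not_gt hm⟩ ⟨_, hcon⟩
      have hkn : k ≤ n := by
        by_contra! h
        exact (htop k h.le x).not_gt hk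
      exact hx k (Finset.mem_Icc.2 ⟨hmax _ hcon, hkn⟩) ⟨hk, fun m hm => by
        by_contra! h
        exact (hmax m h).not_gt hm⟩
    refine le_trans ?_ ha2
    calc ‖f x‖ₑ = eavg (-(n0 : ℤ)) (fun _ => ‖f x‖ₑ) x := (eavg_const _ _ _).symm
      _ ≤ eavg (-(n0 : ℤ)) (fun y => u y + a) x := by
          refine eavg_mono _ fun y hy => ?_
          have h1 : dist (f x) (f y) < α := hfδ (by
            rw [dist_eq_norm]; exact (norm_sub_le_of_mem_cube hy).trans_lt hk0)
          have h2 : ‖f x - f y‖ₑ ≤ a := by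
            rw [← ofReal_norm, ← dist_eq_norm]
            exact ENNReal.ofReal_le_ofReal h1.le
          calc ‖f x‖ₑ = ‖f y + (f x - f y)‖ₑ := by rw [add_sub_cancel]
            _ ≤ u y + ‖f x - f y‖ₑ := enorm_add_le _ _
            _ ≤ u y + a := by gcongr
      _ = eavg (-(n0 : ℤ)) u x + a := by rw [eavg_add _ hf.measurable.enorm, eavg_const]
      _ ≤ a + a := by gcongr

end calderonZygmund

section cancellation
variable {d : ℕ}

theorem cv_eq_of_cancel {K B : EuclideanSpace ℝ (Fin d) → ℂ} (hK : Measurable K)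
    {C : ℝ} (hKb : ∀ x, ‖K x‖ ≤ C) (hKi : Integrable K) (hB : Measurable B) (hBi : Integrable B)
    {k : ℤ} (hc : ∀ x, ∫ y in cube k x, B y = 0) (x : EuclideanSpace ℝ (Fin d)) :
    cv K B x = ∫ y, (((2 : ℝ) ^ k) ^ d)⁻¹ • (∫ z in cube k y, (K (x - y) - K (x - z))) * B y := by
  set c : ℝ := ((2 : ℝ) ^ k) ^ d with hcdef
  have hc0 : 0 < c := by positivity
  have hKx : Integrable fun z => K (x - z) := hKi.comp_sub_left x
  have hKm : Measurable fun z => K (x - z) := by fun_prop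
  set W : EuclideanSpace ℝ (Fin d) → EuclideanSpace ℝ (Fin d) → ℂ := fun y z =>
    (cube k y).indicator (fun z => K (x - z) * B y) z with hW
  have hWm : Measurable (Function.uncurry W) := by
    have : Function.uncurry W =
        {p : EuclideanSpace ℝ (Fin d) × EuclideanSpace ℝ (Fin d) | p.2 ∈ cube k p.1}.indicator
          (fun p => K (x - p.2) * B p.1) := by
      ext ⟨y, z⟩
      simp [W, Set.indicator, Function.uncurry]
    rw [this]
    exact (by fun_prop : Measurable fun p : EuclideanSpace ℝ (Fin d) × EuclideanSpace ℝ (Fin d) =>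
      K (x - p.2) * B p.1).indicator (measurableSet_cube_rel k)
  have hKe : ∀ z, ‖K z‖ₑ ≤ ENNReal.ofReal C := fun z => by
    rw [← ofReal_norm]; exact ENNReal.ofReal_le_ofReal (hKb z)
  have hWi : Integrable (Function.uncurry W) (volume.prod volume) := by
    refine ⟨hWm.aestronglyMeasurable, ?_⟩
    rw [hasFiniteIntegral_iff_enorm, lintegral_prod _ hWm.enorm.aemeasurable]
    calc ∫⁻ y, ∫⁻ z, ‖Function.uncurry W (y, z)‖ₑ
        ≤ ∫⁻ y, (ENNReal.ofReal C * ENNReal.ofReal c) * ‖B y‖ₑ := by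
          refine lintegral_mono fun y => ?_
          calc ∫⁻ z, ‖Function.uncurry W (y, z)‖ₑ
              ≤ ∫⁻ z, (cube k y).indicator (fun _ => ENNReal.ofReal C * ‖B y‖ₑ) z := by
                refine lintegral_mono fun z => ?_
                by_cases hz : z ∈ cube k y
                · simp only [Function.uncurry_apply_pair, W, Set.indicator_of_mem hz, enorm_mul]
                  gcongr
                  exact hKe _
                · simp [W, hz]
            _ = _ := by
                rw [lintegral_indicator_const (measurableSet_cube k y), volume_cube]
                ring
      _ = (ENNReal.ofReal C * ENNReal.ofReal c) * ∫⁻ y, ‖B y‖ₑ :=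
          lintegral_const_mul _ hB.enorm
      _ < ∞ := ENNReal.mul_lt_top (ENNReal.mul_lt_top ofReal_lt_top ofReal_lt_top) hBi.2
  have hswap : ∫ y, ∫ z, W y z = 0 := by
    rw [integral_integral_swap hWi]
    have : ∀ z, ∫ y, W y z = 0 := fun z => by
      have h1 : ∀ y, W y z = K (x - z) * (cube k z).indicator B y := fun y => by
        by_cases hz : z ∈ cube k y
        · simp [W, hz, mem_cube_comm.1 hz]
        · simp [W, hz, mt mem_cube_comm.1 hz]
      simp_rw [h1]
      rw [integral_const_mul, integral_indicator (measurableSet_cube k z), hc, mul_zero]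
    simp [this]
  have hWy : ∀ y, ∫ z, W y z = (∫ z in cube k y, K (x - z)) * B y := fun y => by
    rw [hW, integral_indicator (measurableSet_cube k y), integral_mul_const]
  have hpt : ∀ y, c⁻¹ • (∫ z in cube k y, (K (x - y) - K (x - z))) * B y =
      K (x - y) * B y - c⁻¹ • ∫ z, W y z := fun y => by
    have hv : volume (cube k y) ≠ ∞ := by rw [volume_cube]; exact ofReal_ne_top
    have hci : Integrable (fun _ : EuclideanSpace ℝ (Fin d) => K (x - y))
        (volume.restrict (cube k y)) := integrableOn_const hv
    rw [integral_sub hci hKx.integrableOn, setIntegral_const, measureReal_cube,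
      ← hcdef, smul_sub, smul_smul, inv_mul_cancel₀ hc0.ne', one_smul, sub_mul, hWy, smul_mul_assoc]
  simp_rw [hpt]
  have hKB : Integrable fun y => K (x - y) * B y :=
    hBi.bdd_mul (c := C) hKm.aestronglyMeasurable (Eventually.of_forall fun y => hKb _)
  have hWs : Integrable fun y => c⁻¹ • ∫ z, W y z := hWi.integral_prod_left.smul c⁻¹
  rw [integral_sub hKB hWs, integral_smul, hswap, smul_zero,
    sub_zero, cv]

theorem lintegral_cv_le_of_cancel {K B : EuclideanSpace ℝ (Fin d) → ℂ} (hK : Measurable K)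
    {C : ℝ} (hKb : ∀ x, ‖K x‖ ≤ C) (hKi : Integrable K) (hB : Measurable B) (hBi : Integrable B)
    {k : ℤ} (hc : ∀ x, ∫ y in cube k x, B y = 0) {ω : ℝ≥0∞}
    (hω : ∀ y z, ‖y - z‖ ≤ d * 2 ^ k → ∫⁻ x, ‖K (x - y) - K (x - z)‖ₑ ≤ ω) :
    ∫⁻ x, ‖cv K B x‖ₑ ≤ ω * ∫⁻ x, ‖B x‖ₑ := by
  set c := ENNReal.ofReal (((2 : ℝ) ^ k) ^ d) with hcdef
  have hcm : c⁻¹ * c = 1 := cubeVol_inv_mul k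
  have hm : Measurable fun p : (EuclideanSpace ℝ (Fin d) × EuclideanSpace ℝ (Fin d)) ×
      EuclideanSpace ℝ (Fin d) => (cube k p.1.2).indicator
        (fun z => ‖K (p.1.1 - p.1.2) - K (p.1.1 - z)‖ₑ) p.2 := by
    have : (fun p : (EuclideanSpace ℝ (Fin d) × EuclideanSpace ℝ (Fin d)) ×
        EuclideanSpace ℝ (Fin d) => (cube k p.1.2).indicator
        (fun z => ‖K (p.1.1 - p.1.2) - K (p.1.1 - z)‖ₑ) p.2) =
        {p | p.2 ∈ cube k p.1.2}.indicator
          (fun p => ‖K (p.1.1 - p.1.2) - K (p.1.1 - p.2)‖ₑ) := by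
      ext p
      simp [Set.indicator]
    rw [this]
    refine Measurable.indicator (by fun_prop) ?_
    exact measurableSet_eq_fun ((measurable_cubeIdx k).comp measurable_snd)
      ((measurable_cubeIdx k).comp (measurable_snd.comp measurable_fst))
  have hm2 : Measurable fun p : EuclideanSpace ℝ (Fin d) × EuclideanSpace ℝ (Fin d) =>
      ∫⁻ z in cube k p.2, ‖K (p.1 - p.2) - K (p.1 - z)‖ₑ := by
    simp_rw [← lintegral_indicator (measurableSet_cube k _)]
    exact hm.lintegral_prod_right'
  have hpt : ∀ x, ‖cv K B x‖ₑ ≤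
      ∫⁻ y, c⁻¹ * (∫⁻ z in cube k y, ‖K (x - y) - K (x - z)‖ₑ) * ‖B y‖ₑ := fun x => by
    rw [cv_eq_of_cancel hK hKb hKi hB hBi hc x]
    refine (enorm_integral_le_lintegral_enorm _).trans (lintegral_mono fun y => ?_)
    rw [enorm_mul, enorm_smul]
    gcongr
    · rw [enorm_inv (by positivity), Real.enorm_of_nonneg (by positivity)]
    · exact enorm_integral_le_lintegral_enorm _
  calc ∫⁻ x, ‖cv K B x‖ₑ
      ≤ ∫⁻ x, ∫⁻ y, c⁻¹ * (∫⁻ z in cube k y, ‖K (x - y) - K (x - z)‖ₑ) * ‖B y‖ₑ :=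
        lintegral_mono hpt
    _ = ∫⁻ y, ∫⁻ x, c⁻¹ * (∫⁻ z in cube k y, ‖K (x - y) - K (x - z)‖ₑ) * ‖B y‖ₑ := by
        rw [lintegral_lintegral_swap]
        exact ((hm2.const_mul c⁻¹).mul (hB.enorm.comp measurable_snd)).aemeasurable
    _ ≤ ∫⁻ y, ω * ‖B y‖ₑ := by
        refine lintegral_mono fun y => ?_
        have hmy : Measurable fun x => ∫⁻ z in cube k y, ‖K (x - y) - K (x - z)‖ₑ :=
          hm2.comp (measurable_id.prodMk measurable_const)
        rw [lintegral_mul_const _ (hmy.const_mul _), lintegral_const_mul _ hmy]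
        gcongr
        rw [lintegral_lintegral_swap (by fun_prop)]
        calc c⁻¹ * ∫⁻ z in cube k y, ∫⁻ x, ‖K (x - y) - K (x - z)‖ₑ
            ≤ c⁻¹ * ∫⁻ z in cube k y, ω := by
              refine mul_le_mul_right (setLIntegral_mono' (measurableSet_cube k y) fun z hz => ?_) _
              exact hω y z (norm_sub_le_of_mem_cube hz)
          _ = ω := by
              rw [setLIntegral_const, volume_cube, ← hcdef, mul_left_comm, hcm, mul_one]
    _ = _ := lintegral_const_mul _ hB.enorm

end cancellation

section mollifier
open scoped FourierTransform RealInnerProductSpace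
variable {d : ℕ}

/-- A mollifier at scale `t`. -/
structure IsMollifier (C : ℝ≥0∞) (t : ℝ) (η : EuclideanSpace ℝ (Fin d) → ℂ) : Prop where
  measurable : Measurable η
  bounded : ∃ M : ℝ, ∀ x, ‖η x‖ ≤ M
  integrable : Integrable η
  lintegral_le : ∫⁻ x, ‖η x‖ₑ ≤ 1
  support : ∀ x, t < ‖x‖ → η x = 0
  modulus : ∀ y z, ∫⁻ x, ‖η (x - y) - η (x - z)‖ₑ ≤ C * ENNReal.ofReal (‖y - z‖ / t)
  fourier_le : ∀ ξ, ‖1 - 𝓕 η ξ‖ ≤ 2 * Real.pi * t * ‖ξ‖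

/-- The tent function of radius `t`. -/
def tent (t : ℝ) (x : EuclideanSpace ℝ (Fin d)) : ℝ := max (1 - ‖x‖ / t) 0

theorem continuous_tent (t : ℝ) : Continuous (tent (d := d) t) := by
  unfold tent; fun_prop

theorem tent_nonneg (t : ℝ) (x : EuclideanSpace ℝ (Fin d)) : 0 ≤ tent t x := le_max_right _ _

theorem tent_le_one {t : ℝ} (ht : 0 < t) (x : EuclideanSpace ℝ (Fin d)) : tent t x ≤ 1 := by
  have : 0 ≤ ‖x‖ / t := by positivity
  exact max_le (by linarith) zero_le_one

theorem tent_eq_zero {t : ℝ} (ht : 0 < t) {x : EuclideanSpace ℝ (Fin d)} (h : t ≤ ‖x‖) :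
    tent t x = 0 := by
  refine max_eq_right ?_
  rw [sub_nonpos, le_div_iff₀ ht, one_mul]
  exact h

theorem hasCompactSupport_tent {t : ℝ} (ht : 0 < t) : HasCompactSupport (tent (d := d) t) := by
  refine HasCompactSupport.intro (isCompact_closedBall 0 t) fun x hx => tent_eq_zero ht ?_
  rw [mem_closedBall_zero_iff, not_le] at hx
  exact hx.le

theorem integrable_tent {t : ℝ} (ht : 0 < t) : Integrable (tent (d := d) t) :=
  (continuous_tent t).integrable_of_hasCompactSupport (hasCompactSupport_tent ht)

theorem abs_tent_sub_le {t : ℝ} (ht : 0 < t) (x y : EuclideanSpace ℝ (Fin d)) :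
    |tent t x - tent t y| ≤ ‖x - y‖ / t := by
  refine (abs_max_sub_max_le_abs _ _ _).trans ?_
  rw [_root_.sub_sub_sub_cancel_left, ← sub_div, abs_div, abs_of_pos ht]
  gcongr
  rw [abs_sub_comm]
  exact abs_norm_sub_norm_le x y

theorem tent_smul {t : ℝ} (ht : 0 < t) (x : EuclideanSpace ℝ (Fin d)) :
    tent t x = tent 1 (t⁻¹ • x) := by
  rw [tent, tent, norm_smul, Real.norm_of_nonneg (by positivity)]
  congr 2
  field_simp

theorem integral_tent {t : ℝ} (ht : 0 < t) :
    ∫ x : EuclideanSpace ℝ (Fin d), tent t x = t ^ d * ∫ x : EuclideanSpace ℝ (Fin d), tent 1 x := by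
  simp_rw [tent_smul ht]
  rw [Measure.integral_comp_inv_smul_of_nonneg _ _ ht.le, finrank_euclideanSpace_fin, smul_eq_mul]

theorem integral_tent_pos : 0 < ∫ x : EuclideanSpace ℝ (Fin d), tent 1 x := by
  refine (integral_pos_iff_support_of_nonneg (fun x => tent_nonneg 1 x)
    (integrable_tent one_pos)).2 ?_
  refine lt_of_lt_of_le (measure_ball_pos volume (0 : EuclideanSpace ℝ (Fin d)) one_pos)
    (measure_mono fun x hx => ?_)
  rw [mem_ball_zero_iff] at hx
  refine (lt_max_of_lt_left ?_).ne'
  simpa using hx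

theorem exists_isMollifier (d : ℕ) : ∃ C : ℝ≥0∞, C ≠ ∞ ∧ ∀ t : ℝ, 0 < t →
    ∃ η : EuclideanSpace ℝ (Fin d) → ℂ, IsMollifier C t η := by
  set I := ∫ x : EuclideanSpace ℝ (Fin d), tent 1 x with hI
  have hI0 : 0 < I := integral_tent_pos
  set V := volume (closedBall (0 : EuclideanSpace ℝ (Fin d)) 1) with hV
  refine ⟨ENNReal.ofReal I⁻¹ * (V + V), ENNReal.mul_ne_top ofReal_ne_top (by
    simpa [hV] using measure_closedBall_lt_top.ne), fun t ht => ?_⟩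
  have hc : 0 < (t ^ d * I)⁻¹ := by positivity
  set c := (t ^ d * I)⁻¹ with hcdef
  set η : EuclideanSpace ℝ (Fin d) → ℂ := fun x => ((c * tent t x : ℝ) : ℂ) with hη
  have hηc : Continuous η := by
    have := continuous_tent (d := d) t
    fun_prop
  have hηn : ∀ x, ‖η x‖ = c * tent t x := fun x => by
    rw [hη, Complex.norm_real, Real.norm_of_nonneg (mul_nonneg hc.le (tent_nonneg t x))]
  have hηi : Integrable η := ((integrable_tent ht).const_mul c).ofReal
  have hmass : ∫ x, η x = 1 := by
    rw [hη, integral_complex_ofReal, integral_const_mul, integral_tent ht, hcdef,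
      inv_mul_cancel₀ (by positivity), Complex.ofReal_one]
  have hnint : ∫ x, ‖η x‖ = 1 := by
    simp_rw [hηn]
    rw [integral_const_mul, integral_tent ht, hcdef, inv_mul_cancel₀ (by positivity)]
  have hsupp : ∀ x, t < ‖x‖ → η x = 0 := fun x hx => by
    simp [hη, tent_eq_zero ht hx.le]
  have hF : ∀ ξ, 1 - 𝓕 η ξ = ∫ x, (1 - (Real.fourierChar (-⟪x, ξ⟫) : ℂ)) * η x := fun ξ => by
    have h1 : ∀ x, (1 - (Real.fourierChar (-⟪x, ξ⟫) : ℂ)) * η x =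
        η x - Real.fourierChar (-⟪x, ξ⟫) • η x := fun x => by
      rw [sub_mul, one_mul, Circle.smul_def, smul_eq_mul]
    simp_rw [h1]
    rw [integral_sub hηi ((Real.fourierIntegral_convergent_iff ξ).2 hηi), hmass, Real.fourier_eq]
  refine ⟨η, hηc.measurable, ⟨c, fun x => ?_⟩, hηi, ?_, hsupp, fun y z => ?_, fun ξ => ?_⟩
  · rw [hηn]
    exact mul_le_of_le_one_right hc.le (tent_le_one ht x)
  · rw [← ofReal_integral_norm_eq_lintegral_enorm hηi, hnint, ENNReal.ofReal_one]
  · set D := ENNReal.ofReal (c * (‖y - z‖ / t)) with hD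
    have hball : ∀ y : EuclideanSpace ℝ (Fin d), volume (closedBall y t) =
        ENNReal.ofReal (t ^ d) * V := fun y => by
      rw [Measure.addHaar_closedBall' _ _ ht.le, finrank_euclideanSpace_fin]
    calc ∫⁻ x, ‖η (x - y) - η (x - z)‖ₑ
        ≤ ∫⁻ x, (closedBall y t).indicator (fun _ => D) x +
            (closedBall z t).indicator (fun _ => D) x := by
          refine lintegral_mono fun x => ?_
          by_cases h : x ∈ closedBall y t ∨ x ∈ closedBall z t
          · have h1 : ‖η (x - y) - η (x - z)‖ₑ ≤ D := by
              rw [← ofReal_norm]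
              apply ENNReal.ofReal_le_ofReal
              rw [hη, ← Complex.ofReal_sub, Complex.norm_real, ← mul_sub, norm_mul,
                Real.norm_of_nonneg hc.le]
              gcongr
              refine (abs_tent_sub_le ht _ _).trans_eq ?_
              rw [_root_.sub_sub_sub_cancel_left, norm_sub_rev]
            refine h1.trans ?_
            rcases h with h | h
            · rw [Set.indicator_of_mem h]; exact le_self_add
            · rw [Set.indicator_of_mem h (f := fun _ => D)]; exact le_add_self
          · push Not at h
            have h1 := h.1
            have h2 := h.2
            rw [mem_closedBall, not_le, dist_eq_norm] at h1 h2
            simp [hsupp _ h1, hsupp _ h2]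
      _ = D * (ENNReal.ofReal (t ^ d) * V) + D * (ENNReal.ofReal (t ^ d) * V) := by
          rw [lintegral_add_left (measurable_const.indicator measurableSet_closedBall),
            lintegral_indicator_const measurableSet_closedBall,
            lintegral_indicator_const measurableSet_closedBall, hball, hball]
      _ = ENNReal.ofReal I⁻¹ * (V + V) * ENNReal.ofReal (‖y - z‖ / t) := by
          have : D * ENNReal.ofReal (t ^ d) =
              ENNReal.ofReal I⁻¹ * ENNReal.ofReal (‖y - z‖ / t) := by
            rw [hD, ← ENNReal.ofReal_mul (by positivity), ← ENNReal.ofReal_mul (by positivity)]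
            congr 1
            rw [hcdef]
            field_simp
          rw [← mul_assoc, this]
          ring
      _ ≤ _ := le_rfl
  · rw [hF, ← mul_one (2 * Real.pi * t * ‖ξ‖), ← hnint, ← integral_const_mul]
    refine norm_integral_le_of_norm_le (hηi.norm.const_mul _) (Eventually.of_forall fun x => ?_)
    rw [norm_mul]
    by_cases hx : t < ‖x‖
    · simp [hsupp x hx]
    · push Not at hx
      gcongr
      rw [Real.fourierChar_apply, norm_sub_rev]
      have h1 := Real.norm_exp_I_mul_ofReal_sub_one_le (x := 2 * Real.pi * -⟪x, ξ⟫)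
      rw [mul_comm] at h1
      refine h1.trans ?_
      rw [norm_mul, norm_neg, Real.norm_of_nonneg (by positivity), mul_assoc (2 * Real.pi)]
      gcongr
      exact (norm_inner_le_norm x ξ).trans (by gcongr)

end mollifier

section tubes
variable {d : ℕ}

/-- The box with half-side `c i` in the direction `b i`. -/
def box (b : OrthonormalBasis (Fin d) ℝ (EuclideanSpace ℝ (Fin d))) (c : Fin d → ℝ) :
    Set (EuclideanSpace ℝ (Fin d)) := {x | ∀ i, |b.repr x i| ≤ c i}

variable {b : OrthonormalBasis (Fin d) ℝ (EuclideanSpace ℝ (Fin d))} {c c' : Fin d → ℝ}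

theorem measurableSet_box : MeasurableSet (box b c) := by
  have : box b c = ⋂ i, {x | |b.repr x i| ≤ c i} := by ext; simp [box]
  rw [this]
  refine MeasurableSet.iInter fun i => ?_
  have h : Continuous fun x => |b.repr x i| := by
    have h1 : Continuous fun x => b.repr x := b.repr.continuous
    fun_prop
  exact measurableSet_le h.measurable measurable_const

theorem volume_box (hc : ∀ i, 0 ≤ c i) :
    volume (box b c) = ENNReal.ofReal (∏ i, (2 * c i)) := by
  have h1 : box b c = b.repr ⁻¹' ((WithLp.ofLp : EuclideanSpace ℝ (Fin d) → Fin d → ℝ) ⁻¹'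
      (Set.univ.pi fun i => Set.Icc (-(c i)) (c i))) := by
    ext x
    simp [box, abs_le, Pi.le_def, forall_and]
  have hm : MeasurableSet (Set.univ.pi fun i => Set.Icc (-(c i)) (c i)) :=
    MeasurableSet.univ_pi fun i => measurableSet_Icc
  rw [h1, b.measurePreserving_repr.measure_preimage
      ((PiLp.volume_preserving_ofLp (Fin d)).measurable hm).nullMeasurableSet,
    (PiLp.volume_preserving_ofLp (Fin d)).measure_preimage hm.nullMeasurableSet, volume_pi_pi,
    ENNReal.ofReal_prod_of_nonneg fun i _ => by have := hc i; positivity]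
  refine Finset.prod_congr rfl fun i _ => ?_
  rw [Real.volume_Icc]
  congr 1
  ring

theorem add_mem_box {x y : EuclideanSpace ℝ (Fin d)} (hx : x ∈ box b c) (hy : y ∈ box b c') :
    x + y ∈ box b (c + c') := fun i => by
  rw [map_add, PiLp.add_apply]
  exact (abs_add_le _ _).trans (add_le_add (hx i) (hy i))

theorem neg_mem_box {x : EuclideanSpace ℝ (Fin d)} (hx : x ∈ box b c) : -x ∈ box b c := fun i => by
  rw [map_neg, PiLp.neg_apply, abs_neg]
  exact hx i

theorem box_mono (h : ∀ i, c i ≤ c' i) : box b c ⊆ box b c' := fun _ hx i => (hx i).trans (h i)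

theorem abs_repr_le (x : EuclideanSpace ℝ (Fin d)) (i : Fin d) : |b.repr x i| ≤ ‖x‖ := by
  rw [← b.repr.norm_map x]
  exact PiLp.norm_apply_le (b.repr x) i

theorem mem_box_of_norm_le {x : EuclideanSpace ℝ (Fin d)} (h : ∀ i, ‖x‖ ≤ c i) : x ∈ box b c :=
  fun i => (abs_repr_le x i).trans (h i)

theorem sq_sum_le_two_mul {ι : Type*} [LinearOrder ι] (S : Finset ι) (g : ι → ℝ≥0∞) :
    (∑ k ∈ S, g k) ^ 2 ≤ 2 * ∑ j ∈ S, ∑ i ∈ S with i ≤ j, g i * g j := by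
  calc (∑ k ∈ S, g k) ^ 2 = ∑ j ∈ S, ∑ i ∈ S, g i * g j := by
        rw [sq, Finset.sum_mul_sum, Finset.sum_comm]
    _ ≤ ∑ j ∈ S, ∑ i ∈ S, ((if i ≤ j then g i * g j else 0) + if j ≤ i then g j * g i else 0) := by
        refine Finset.sum_le_sum fun j _ => Finset.sum_le_sum fun i _ => ?_
        rcases le_total i j with h | h
        · rw [if_pos h]; exact le_self_add
        · rw [if_pos h, mul_comm (g j)]; exact le_add_self
    _ = _ := by
        simp_rw [Finset.sum_add_distrib]
        rw [Finset.sum_comm (f := fun j i => if j ≤ i then g j * g i else 0), ← two_mul]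
        simp_rw [Finset.sum_filter]

set_option maxHeartbeats 800000 in
theorem lintegral_tube_sum_sq_le {S : Finset ℤ} {v : ℤ → EuclideanSpace ℝ (Fin d) → ℝ≥0∞} {M : ℝ≥0∞}
    (hBm : ∀ k, Measurable (v k))
    (hmassv : ∀ S' ⊆ S, ∀ k, (∀ i ∈ S', i ≤ k) → ∀ φ φ' : EuclideanSpace ℝ (Fin d) → ℝ≥0∞,
      Measurable φ → Measurable φ' → (∀ x y, ‖x - y‖ ≤ d * 2 ^ k → φ x ≤ φ' y) →
      ∑ i ∈ S', ∫⁻ x, φ x * v i x ≤ M * ∫⁻ x, φ' x) (s : ℤ) (hc : ∀ i, 1 ≤ 2 ^ s * c i) :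
    ∫⁻ x, (∑ k ∈ S, (ENNReal.ofReal (((2 : ℝ) ^ (k + s)) ^ d))⁻¹ *
        ∫⁻ y, (box b (fun i => 2 ^ (k + s) * c i)).indicator 1 (x - y) * v k y) ^ 2 ≤
      2 * (2 + d) ^ d * ENNReal.ofReal (∏ i, (2 * c i)) ^ 2 * M *
        ∑ k ∈ S, ∫⁻ x, v k x := by
  have hc0 : ∀ i, 0 < c i := fun i => by
    have h1 : (0 : ℝ) < 2 ^ s := by positivity
    exact pos_of_mul_pos_right (lt_of_lt_of_le one_pos (hc i)) h1.le
  set P := ENNReal.ofReal (∏ i, (2 * c i)) with hP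
  set w : ℤ → ℝ≥0∞ := fun k => (ENNReal.ofReal (((2 : ℝ) ^ (k + s)) ^ d))⁻¹ with hw
  set β : ℤ → Set (EuclideanSpace ℝ (Fin d)) := fun k => box b (fun i => 2 ^ (k + s) * c i) with hβ
  set χ : ℤ → EuclideanSpace ℝ (Fin d) → ℝ≥0∞ := fun k => (β k).indicator 1 with hχ
  set g : ℤ → EuclideanSpace ℝ (Fin d) → ℝ≥0∞ := fun k x =>
    w k * ∫⁻ y, χ k (x - y) * v k y with hg
  have hχm : ∀ k, Measurable (χ k) := fun k => measurable_one.indicator measurableSet_box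
  have hw0 : ∀ k, ENNReal.ofReal (((2 : ℝ) ^ (k + s)) ^ d) ≠ 0 := fun k => by
    rw [Ne, ENNReal.ofReal_eq_zero, not_le]; positivity
  have hvolL : ∀ (k : ℤ) (a : ℝ), 0 ≤ a → w k * volume (box b (fun i => a * (2 ^ (k + s) * c i))) =
      ENNReal.ofReal (a ^ d) * P := fun k a ha => by
    have h0 : (0 : ℝ) < 2 ^ (k + s) := by positivity
    rw [volume_box fun i => by have := hc0 i; positivity]
    have : ∏ i, (2 * (a * (2 ^ (k + s) * c i))) =
        ((2 : ℝ) ^ (k + s)) ^ d * (a ^ d * ∏ i, (2 * c i)) := by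
      have h1 : ∀ i, 2 * (a * (2 ^ (k + s) * c i)) = (2 ^ (k + s) * a) * (2 * c i) := fun i => by
        ring
      simp_rw [h1, Finset.prod_mul_distrib, Finset.prod_const, Finset.card_univ, Fintype.card_fin]
      ring
    rw [this, ENNReal.ofReal_mul (by positivity), ← mul_assoc,
      ENNReal.inv_mul_cancel (hw0 k) ofReal_ne_top, one_mul, ENNReal.ofReal_mul (by positivity)]
  have hvol : ∀ k, w k * volume (β k) = P := fun k => by
    simpa using hvolL k 1 zero_le_one
  have hgm : ∀ k, Measurable (g k) := fun k => by
    refine Measurable.const_mul ?_ _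
    refine Measurable.lintegral_prod_right' (f := fun p : EuclideanSpace ℝ (Fin d) ×
      EuclideanSpace ℝ (Fin d) => χ k (p.1 - p.2) * v k p.2) ?_
    have := hχm k
    have := hBm k
    fun_prop
  have hinner : ∀ j ∈ S, ∀ y, ∫⁻ x, χ j (x - y) * ∑ i ∈ S with i ≤ j, g i x ≤
      P * (M * ((2 + d) ^ d * volume (β j))) := fun j hj y => by
    have hpos : (0 : ℝ) < 2 ^ (j + s) := by positivity
    set φ : EuclideanSpace ℝ (Fin d) → ℝ≥0∞ := fun z =>
      (box b (fun i => 2 * (2 ^ (j + s) * c i))).indicator 1 (z - y) with hφ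
    set φ' : EuclideanSpace ℝ (Fin d) → ℝ≥0∞ := fun z =>
      (box b (fun i => (2 + d) * (2 ^ (j + s) * c i))).indicator 1 (z - y) with hφ'
    have hφm : Measurable φ :=
      (measurable_one.indicator measurableSet_box).comp (measurable_id.sub_const y)
    have hφm' : Measurable φ' :=
      (measurable_one.indicator measurableSet_box).comp (measurable_id.sub_const y)
    have hmass := hmassv (S.filter (· ≤ j)) (Finset.filter_subset _ _) j
      (fun i hi => (Finset.mem_filter.1 hi).2) φ φ' hφm hφm' (fun x z hxz => by
        by_cases hx : x - y ∈ box b (fun i => 2 * (2 ^ (j + s) * c i))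
        · have h2 : z - x ∈ box b (fun i => (d : ℝ) * (2 ^ (j + s) * c i)) := by
            refine mem_box_of_norm_le fun i => ?_
            rw [norm_sub_rev]
            refine hxz.trans (mul_le_mul_of_nonneg_left ?_ (Nat.cast_nonneg d))
            rw [zpow_add₀ two_ne_zero, mul_assoc]
            exact le_mul_of_one_le_right (by positivity) (hc i)
          have h3 := add_mem_box hx h2
          rw [sub_add_sub_comm, add_comm x z, add_sub_add_right_eq_sub] at h3
          have h4 : (z - y) ∈ box b (fun i => (2 + d) * (2 ^ (j + s) * c i)) := by
            refine box_mono (fun i => ?_) h3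
            rw [Pi.add_apply, ← add_mul]
          simp [φ, φ', hx, h4]
        · simp [φ, hx])
    have hφint : ∫⁻ z, φ' z = (2 + d) ^ d * volume (β j) := by
      rw [hφ', lintegral_sub_right_eq_self (fun z =>
        (box b (fun i => (2 + d) * (2 ^ (j + s) * c i))).indicator 1 z) y,
        lintegral_indicator_one measurableSet_box]
      have h1 := hvolL j (2 + d) (by positivity)
      rw [← hvol j, ← mul_assoc, mul_comm (ENNReal.ofReal _), mul_assoc] at h1
      have h2 : w j ≠ 0 := ENNReal.inv_ne_zero.2 ofReal_ne_top
      have h3 : w j ≠ ∞ := ENNReal.inv_ne_top.2 (hw0 j)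
      rw [(ENNReal.mul_right_inj h2 h3).1 h1, ENNReal.ofReal_pow (by positivity),
        ENNReal.ofReal_add (by positivity) (by positivity)]
      simp
    have hterm : ∀ i, i ≤ j → ∫⁻ x, χ j (x - y) * g i x ≤ P * ∫⁻ z, φ z * v i z := fun i hi => by
      have hsub : β i ⊆ β j := box_mono fun l => by
        have := hc0 l
        gcongr
        exact one_le_two
      have hmj := hχm j
      have hmi := hχm i
      have hmB := hBm i
      calc ∫⁻ x, χ j (x - y) * g i x
          = w i * ∫⁻ x, ∫⁻ z, χ j (x - y) * (χ i (x - z) * v i z) := by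
            rw [← lintegral_const_mul']
            · refine lintegral_congr fun x => ?_
              rw [lintegral_const_mul _ (by fun_prop), hg]
              ring
            · exact ENNReal.inv_ne_top.2 (hw0 i)
        _ = w i * ∫⁻ z, ∫⁻ x, χ j (x - y) * (χ i (x - z) * v i z) := by
            rw [lintegral_lintegral_swap (by fun_prop)]
        _ ≤ w i * ∫⁻ z, volume (β i) * (φ z * v i z) := by
            refine mul_le_mul_right (lintegral_mono fun z => ?_) _
            calc ∫⁻ x, χ j (x - y) * (χ i (x - z) * v i z)
                ≤ ∫⁻ x, χ i (x - z) * (φ z * v i z) := by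
                  refine lintegral_mono fun x => ?_
                  by_cases h1 : x - y ∈ β j
                  · by_cases h2 : x - z ∈ β i
                    · have h3 : z - y ∈ box b (fun i => 2 * (2 ^ (j + s) * c i)) := by
                        have h4 := add_mem_box h1 (neg_mem_box (hsub h2))
                        rw [neg_sub, sub_add_sub_comm, add_comm x z,
                          add_sub_add_right_eq_sub] at h4
                        refine box_mono (fun i => ?_) h4
                        rw [Pi.add_apply, two_mul]
                      simp [χ, φ, h1, h2, h3]
                    · simp [χ, h2]
                  · simp [χ, h1]
              _ = _ := by
                  rw [lintegral_mul_const _ (by fun_prop),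
                    lintegral_sub_right_eq_self (fun x => χ i x) z,
                    lintegral_indicator_one measurableSet_box]
        _ = _ := by
            rw [lintegral_const_mul _ (by fun_prop), ← mul_assoc, hvol]
    calc ∫⁻ x, χ j (x - y) * ∑ i ∈ S with i ≤ j, g i x
        = ∑ i ∈ S with i ≤ j, ∫⁻ x, χ j (x - y) * g i x := by
          simp_rw [Finset.mul_sum]
          rw [lintegral_finsetSum]
          intro i _
          exact ((hχm j).comp (measurable_id.sub_const y)).mul (hgm i)
      _ ≤ ∑ i ∈ S with i ≤ j, P * ∫⁻ z, φ z * v i z :=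
          Finset.sum_le_sum fun i hi => hterm i (Finset.mem_filter.1 hi).2
      _ = P * ∑ i ∈ S with i ≤ j, ∫⁻ z, φ z * v i z := by rw [Finset.mul_sum]
      _ ≤ P * (M * ∫⁻ z, φ' z) := mul_le_mul_right hmass _
      _ = _ := by rw [hφint]
  calc ∫⁻ x, (∑ k ∈ S, g k x) ^ 2
      ≤ ∫⁻ x, 2 * ∑ j ∈ S, ∑ i ∈ S with i ≤ j, g i x * g j x :=
        lintegral_mono fun x => sq_sum_le_two_mul S fun k => g k x
    _ = 2 * ∑ j ∈ S, ∫⁻ x, (∑ i ∈ S with i ≤ j, g i x) * g j x := by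
        rw [lintegral_const_mul, lintegral_finsetSum]
        · simp_rw [Finset.sum_mul]
        · intro j _
          exact Finset.measurable_fun_sum _ fun i _ => (hgm i).mul (hgm j)
        · exact Finset.measurable_fun_sum _ fun j _ =>
            Finset.measurable_fun_sum _ fun i _ => (hgm i).mul (hgm j)
    _ ≤ 2 * ∑ j ∈ S, ((2 + d) ^ d * P ^ 2 * M) * ∫⁻ x, v j x := by
        gcongr with j hj
        have hQ : Measurable fun x => ∑ i ∈ S with i ≤ j, g i x :=
          Finset.measurable_fun_sum _ fun i _ => hgm i
        have hmj := hχm j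
        have hmB := hBm j
        have hin := hinner j hj
        obtain ⟨Q, hQe⟩ : ∃ Q : EuclideanSpace ℝ (Fin d) → ℝ≥0∞,
            ∀ x, ∑ i ∈ S with i ≤ j, g i x = Q x := ⟨_, fun _ => rfl⟩
        simp_rw [hQe] at hQ hin ⊢
        calc ∫⁻ x, Q x * g j x
            = w j * ∫⁻ x, ∫⁻ y, (χ j (x - y) * Q x) * v j y := by
              rw [← lintegral_const_mul']
              · refine lintegral_congr fun x => ?_
                simp_rw [mul_right_comm _ (Q _)]
                rw [lintegral_mul_const _ (by fun_prop)]
                simp only [hg]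
                ring
              · exact ENNReal.inv_ne_top.2 (hw0 j)
          _ = w j * ∫⁻ y, ∫⁻ x, (χ j (x - y) * Q x) * v j y := by
              rw [lintegral_lintegral_swap]
              fun_prop
          _ ≤ w j * ∫⁻ y, P * (M * ((2 + d) ^ d * volume (β j))) * v j y := by
              refine mul_le_mul_right (lintegral_mono fun y => ?_) _
              rw [lintegral_mul_const _ (by fun_prop)]
              exact mul_le_mul_left (hin y) _
          _ = _ := by
              rw [lintegral_const_mul _ hmB, ← mul_assoc]
              congr 1
              calc w j * (P * (M * ((2 + d) ^ d * volume (β j))))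
                  = (2 + d) ^ d * P * M * (w j * volume (β j)) := by ring
                _ = _ := by rw [hvol]; ring
    _ = _ := by rw [← Finset.mul_sum]; ring

end tubes

section cones
open scoped RealInnerProductSpace Pointwise
variable {d : ℕ}

theorem exists_orthonormalBasis_apply_eq (i₀ : Fin d) {ω : EuclideanSpace ℝ (Fin d)}
    (hω : ‖ω‖ = 1) :
    ∃ b : OrthonormalBasis (Fin d) ℝ (EuclideanSpace ℝ (Fin d)), b i₀ = ω := by
  obtain ⟨b, hb⟩ := Orthonormal.exists_orthonormalBasis_extension_of_card_eq
    (𝕜 := ℝ) (E := EuclideanSpace ℝ (Fin d)) (ι := Fin d) (by simp) (v := fun _ => ω) (s := {i₀}) (by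
      refine ⟨fun i => hω, fun i j hij => ?_⟩
      exact absurd (Subsingleton.elim i j) hij)
  exact ⟨b, hb i₀ rfl⟩

theorem volume_cone_inter_annulus_le {K : Set (EuclideanSpace ℝ (Fin d))} (hK : MeasurableSet K)
    (hcone : ∀ t : ℝ, 0 < t → ∀ x ∈ K, t • x ∈ K) {ρ : ℝ} (hρ : 0 < ρ) (hρ' : ρ ≤ 1 / 2) :
    volume (K ∩ {e | 1 - ρ < ‖e‖ ∧ ‖e‖ < 1 + ρ}) ≤
      ENNReal.ofReal (d * 2 ^ d * 2 * ρ) * volume (K ∩ closedBall 0 1) := by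
  have hball : ∀ R : ℝ, 0 < R →
      volume (K ∩ closedBall 0 R) = ENNReal.ofReal (R ^ d) * volume (K ∩ closedBall 0 1) := by
    intro R hR
    have : K ∩ closedBall 0 R = R • (K ∩ closedBall 0 1) := by
      ext x
      rw [Set.mem_smul_set_iff_inv_smul_mem₀ hR.ne', Set.mem_inter_iff, Set.mem_inter_iff,
        mem_closedBall_zero_iff, mem_closedBall_zero_iff, norm_smul, norm_inv,
        Real.norm_of_nonneg hR.le, inv_mul_le_iff₀ hR, mul_one]
      refine and_congr_left fun _ => ⟨fun h => hcone _ (inv_pos.2 hR) x h, fun h => ?_⟩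
      have := hcone R hR _ h
      rwa [smul_inv_smul₀ hR.ne'] at this
    rw [this, Measure.addHaar_smul_of_nonneg _ hR.le, finrank_euclideanSpace_fin]
  have hV : volume (K ∩ closedBall 0 1) ≠ ∞ :=
    ((measure_mono Set.inter_subset_right).trans_lt measure_closedBall_lt_top).ne
  have h1 : 0 < 1 - ρ := by linarith
  calc volume (K ∩ {e | 1 - ρ < ‖e‖ ∧ ‖e‖ < 1 + ρ})
      ≤ volume ((K ∩ closedBall 0 (1 + ρ)) \ (K ∩ closedBall 0 (1 - ρ))) := by
        refine measure_mono fun x hx => ⟨⟨hx.1, ?_⟩, fun h => ?_⟩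
        · rw [mem_closedBall_zero_iff]; exact hx.2.2.le
        · exact absurd (mem_closedBall_zero_iff.1 h.2) (not_le.2 hx.2.1)
    _ = ENNReal.ofReal ((1 + ρ) ^ d - (1 - ρ) ^ d) * volume (K ∩ closedBall 0 1) := by
        rw [measure_sdiff (Set.inter_subset_inter_right _ (closedBall_subset_closedBall (by linarith)))
          (hK.inter measurableSet_closedBall).nullMeasurableSet
          ((measure_mono Set.inter_subset_right).trans_lt measure_closedBall_lt_top).ne,
          hball _ (by linarith), hball _ h1, ENNReal.ofReal_sub _ (by positivity),
          ENNReal.sub_mul fun _ _ => hV]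
    _ ≤ _ := by
        gcongr
        refine (le_abs_self _).trans ((abs_pow_sub_pow_le _ _ _).trans ?_)
        rw [abs_of_pos (by linarith : 0 < 1 + ρ), abs_of_pos h1, max_eq_left (by linarith),
          abs_of_pos (by linarith)]
        have h2 : (1 + ρ) ^ (d - 1) ≤ 2 ^ d :=
          (pow_le_pow_left₀ (by linarith) (by linarith) _).trans
            (pow_le_pow_right₀ one_le_two (Nat.sub_le d 1))
        calc (1 + ρ - (1 - ρ)) * d * (1 + ρ) ^ (d - 1) ≤ (1 + ρ - (1 - ρ)) * d * 2 ^ d := by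
              gcongr
              nlinarith
          _ = _ := by ring

theorem exists_volume_annulus_le (hd : 1 ≤ d) : ∃ C : ℝ≥0∞, C ≠ ∞ ∧ ∀ ρ : ℝ, 0 < ρ → ρ ≤ 1 →
    volume {e : EuclideanSpace ℝ (Fin d) | 1 - ρ < ‖e‖ ∧ ‖e‖ < 1 + ρ} ≤ C * ENNReal.ofReal ρ ∧
    ∀ ω : EuclideanSpace ℝ (Fin d), ‖ω‖ = 1 →
      volume ({e | |⟪e, ω⟫| ≤ 2 * ρ} ∩ {e : EuclideanSpace ℝ (Fin d) | 1 - ρ < ‖e‖ ∧ ‖e‖ < 1 + ρ})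
        ≤ C * ENNReal.ofReal ρ ^ 2 := by
  set V := volume (closedBall (0 : EuclideanSpace ℝ (Fin d)) 1) with hV
  set W := volume (closedBall (0 : EuclideanSpace ℝ (Fin d)) 2) with hW
  have hVt : V ≠ ∞ := measure_closedBall_lt_top.ne
  have hWt : W ≠ ∞ := measure_closedBall_lt_top.ne
  set D := ENNReal.ofReal (d * 2 ^ d * 2) with hD
  refine ⟨4 * W + D * V + D * ENNReal.ofReal (2 ^ d * 4), by finiteness, fun ρ hρ hρ1 => ?_⟩
  have hDρ : ENNReal.ofReal (d * 2 ^ d * 2 * ρ) = D * ENNReal.ofReal ρ :=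
    ENNReal.ofReal_mul (by positivity)
  rcases le_or_gt ρ (1 / 2) with h | h
  · refine ⟨?_, fun ω hω => ?_⟩
    · have h1 := volume_cone_inter_annulus_le (d := d) MeasurableSet.univ (by simp) hρ h
      rw [Set.univ_inter, Set.univ_inter, hDρ] at h1
      refine h1.trans ?_
      rw [mul_right_comm]
      gcongr
      exact le_add_right le_add_self
    · obtain ⟨b, hb⟩ := exists_orthonormalBasis_apply_eq ⟨0, hd⟩ hω
      set K := {e : EuclideanSpace ℝ (Fin d) | |⟪e, ω⟫| ≤ 4 * ρ * ‖e‖} with hK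
      have hKm : MeasurableSet K := measurableSet_le
        (by fun_prop : Continuous fun e : EuclideanSpace ℝ (Fin d) => |⟪e, ω⟫|).measurable
        (by fun_prop)
      have h1 := volume_cone_inter_annulus_le hKm (fun t ht x hx => by
        rw [hK, Set.mem_ofPred_eq] at hx ⊢
        rw [real_inner_smul_left, abs_mul, norm_smul, Real.norm_eq_abs, mul_left_comm]
        gcongr) hρ h
      refine (measure_mono ?_).trans (h1.trans ?_)
      · rintro x ⟨hx, hx'⟩
        refine ⟨?_, hx'⟩
        rw [hK, Set.mem_ofPred_eq]
        rw [Set.mem_ofPred_eq] at hx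
        refine hx.trans ?_
        nlinarith [hx'.1]
      · have h2 : volume (K ∩ closedBall 0 1) ≤ ENNReal.ofReal (2 ^ d * 4) * ENNReal.ofReal ρ := by
          have h3 : K ∩ closedBall 0 1 ⊆ box b (Function.update (fun _ => 1) ⟨0, hd⟩ (4 * ρ)) := by
            rintro x ⟨hx, hx'⟩ i
            rw [mem_closedBall_zero_iff] at hx'
            by_cases hi : i = ⟨0, hd⟩
            · subst hi
              rw [Function.update_self, OrthonormalBasis.repr_apply_apply, hb, real_inner_comm]
              rw [hK, Set.mem_ofPred_eq] at hx
              refine hx.trans ?_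
              exact mul_le_of_le_one_right (by positivity) hx'
            · rw [Function.update_of_ne hi]
              exact (abs_repr_le x i).trans hx'
          refine (measure_mono h3).trans ?_
          rw [volume_box, Finset.prod_mul_distrib, Finset.prod_update_of_mem (Finset.mem_univ _),
            ← ENNReal.ofReal_mul (by positivity)]
          · simp [mul_assoc]
          · intro i
            by_cases hi : i = ⟨0, hd⟩
            · subst hi; rw [Function.update_self]; positivity
            · rw [Function.update_of_ne hi]; exact zero_le_one
        rw [hDρ]
        calc D * ENNReal.ofReal ρ * volume (K ∩ closedBall 0 1)
            ≤ D * ENNReal.ofReal ρ * (ENNReal.ofReal (2 ^ d * 4) * ENNReal.ofReal ρ) := by gcongr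
          _ = D * ENNReal.ofReal (2 ^ d * 4) * ENNReal.ofReal ρ ^ 2 := by ring
          _ ≤ _ := by
            gcongr
            exact le_add_self
  · have hsub : {e : EuclideanSpace ℝ (Fin d) | 1 - ρ < ‖e‖ ∧ ‖e‖ < 1 + ρ} ⊆ closedBall 0 2 :=
      fun x hx => by
        rw [mem_closedBall_zero_iff]; linarith [hx.2]
    have h2 : W ≤ 4 * W * ENNReal.ofReal ρ ^ 2 := by
      rw [mul_right_comm]
      refine le_mul_of_one_le_left zero_le ?_
      rw [← ENNReal.ofReal_pow hρ.le, ← ENNReal.ofReal_ofNat 4,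
        ← ENNReal.ofReal_mul (by norm_num), ENNReal.one_le_ofReal]
      nlinarith
    have h3 : W ≤ (4 * W + D * V + D * ENNReal.ofReal (2 ^ d * 4)) * ENNReal.ofReal ρ ^ 2 := by
      refine h2.trans ?_
      gcongr
      rw [add_assoc]
      exact le_self_add
    refine ⟨(measure_mono hsub).trans (h3.trans ?_), fun ω _ =>
      (measure_mono (Set.inter_subset_right.trans hsub)).trans h3⟩
    gcongr
    refine pow_le_of_le_one zero_le ?_ two_ne_zero
    rw [← ENNReal.ofReal_one]
    exact ENNReal.ofReal_le_ofReal hρ1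

end cones

section profile
open scoped FourierTransform ContDiff

/-- A smooth cutoff equal to `1` on `(-∞, 1]` and to `0` on `[L, ∞)`. -/
structure IsCutoff (L : ℝ) (Ξ : ℝ → ℝ) : Prop where
  smooth : ContDiff ℝ ∞ Ξ
  one_le : 1 ≤ L
  eq_one : ∀ t ≤ 1, Ξ t = 1
  eq_zero : ∀ t, L ≤ t → Ξ t = 0
  nonneg : ∀ t, 0 ≤ Ξ t
  le_one : ∀ t, Ξ t ≤ 1

/-- The dyadic annular profile attached to a cutoff. -/
def bump (Ξ : ℝ → ℝ) (t : ℝ) : ℝ := Ξ t - Ξ (2 * t)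

/-- The radial profile `ψ(t) t^{-1-ir}`. -/
def hprof (r : ℝ) (ψ : ℝ → ℝ) (t : ℝ) : ℂ :=
  ((ψ t / t : ℝ) : ℂ) * Complex.exp (-(Complex.I * r * Real.log t))

variable {L : ℝ} {Ξ : ℝ → ℝ}

theorem norm_cexp_neg_I_mul (r s : ℝ) : ‖Complex.exp (-(Complex.I * r * s))‖ = 1 := by
  rw [Complex.norm_exp]
  simp

theorem IsCutoff.abs_bump_le (h : IsCutoff L Ξ) (t : ℝ) : |bump Ξ t| ≤ 1 := by
  have := h.nonneg t
  have := h.le_one t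
  have := h.nonneg (2 * t)
  have := h.le_one (2 * t)
  rw [bump, abs_le]
  constructor <;> linarith

theorem IsCutoff.bump_eq_zero_of_le (h : IsCutoff L Ξ) {t : ℝ} (ht : t ≤ 1 / 2) :
    bump Ξ t = 0 := by
  rw [bump, h.eq_one t (by linarith), h.eq_one _ (by linarith), sub_self]

theorem IsCutoff.bump_eq_zero_of_ge (h : IsCutoff L Ξ) {t : ℝ} (ht : L ≤ t) : bump Ξ t = 0 := by
  have := h.one_le
  rw [bump, h.eq_zero t ht, h.eq_zero _ (by linarith), sub_self]

theorem IsCutoff.contDiff_bump (h : IsCutoff L Ξ) : ContDiff ℝ ∞ (bump Ξ) :=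
  h.smooth.sub (h.smooth.comp (by fun_prop))

theorem IsCutoff.contDiff_hprof (h : IsCutoff L Ξ) (r : ℝ) :
    ContDiff ℝ ∞ (hprof r (bump Ξ)) := by
  rw [contDiff_iff_contDiffAt]
  intro t
  by_cases ht : t < 1 / 2
  · refine (contDiffAt_const (c := (0 : ℂ))).congr_of_eventuallyEq ?_
    filter_upwards [eventually_lt_nhds ht] with s hs
    simp [hprof, h.bump_eq_zero_of_le hs.le]
  · have ht0 : t ≠ 0 := by rintro rfl; norm_num at ht
    have h1 : ContDiffAt ℝ ∞ (fun t => bump Ξ t / t) t :=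
      h.contDiff_bump.contDiffAt.div contDiffAt_id ht0
    have h2 : ContDiffAt ℝ ∞ Real.log t := Real.contDiffAt_log.2 ht0
    have h3 : ContDiffAt ℝ ∞ (fun t => ((bump Ξ t / t : ℝ) : ℂ)) t :=
      Complex.ofRealCLM.contDiff.contDiffAt.comp t h1
    have h4 : ContDiffAt ℝ ∞ (fun t => ((Real.log t : ℝ) : ℂ)) t :=
      Complex.ofRealCLM.contDiff.contDiffAt.comp t h2
    exact h3.mul ((contDiffAt_const.mul h4).neg.cexp)

theorem IsCutoff.hprof_eq_zero (h : IsCutoff L Ξ) (r : ℝ) {t : ℝ} (ht : t ≤ 1 / 2 ∨ L ≤ t) :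
    hprof r (bump Ξ) t = 0 := by
  rcases ht with ht | ht
  · simp [hprof, h.bump_eq_zero_of_le ht]
  · simp [hprof, h.bump_eq_zero_of_ge ht]

theorem IsCutoff.hasCompactSupport_hprof (h : IsCutoff L Ξ) (r : ℝ) :
    HasCompactSupport (hprof r (bump Ξ)) := by
  refine HasCompactSupport.intro (isCompact_Icc (a := 0) (b := L)) fun t ht => ?_
  refine h.hprof_eq_zero r ?_
  rw [Set.mem_Icc, not_and_or, not_le, not_le] at ht
  rcases ht with ht | ht
  · left; linarith
  · right; exact ht.le

theorem IsCutoff.integrable_hprof (h : IsCutoff L Ξ) (r : ℝ) : Integrable (hprof r (bump Ξ)) :=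
  (h.contDiff_hprof r).continuous.integrable_of_hasCompactSupport (h.hasCompactSupport_hprof r)

theorem isCutoff_smoothTransition : IsCutoff 2 fun t => Real.smoothTransition (2 - t) where
  smooth := Real.smoothTransition.contDiff.comp (by fun_prop)
  one_le := one_le_two
  eq_one t ht := Real.smoothTransition.one_of_one_le (by linarith)
  eq_zero t ht := Real.smoothTransition.zero_of_nonpos (by linarith)
  nonneg t := Real.smoothTransition.nonneg _
  le_one t := Real.smoothTransition.le_one _

theorem exists_isCutoff {r : ℝ} (hr : r ≠ 0) :
    ∃ L Ξ, IsCutoff L Ξ ∧ ∫ t, hprof r (bump Ξ) t = 0 := by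
  set a := Real.exp (Real.pi / |r|) with ha
  have hr' : 0 < |r| := abs_pos.2 hr
  have ha1 : 1 ≤ a := Real.one_le_exp (by positivity)
  have ha0 : 0 < a := by positivity
  set χ : ℝ → ℝ := fun t => Real.smoothTransition (2 - t) with hχ
  have hc : IsCutoff 2 χ := isCutoff_smoothTransition
  have hphase : Complex.exp (-(Complex.I * r * (Real.pi / |r| : ℝ))) = -1 := by
    rcases lt_or_gt_of_ne hr with h | h
    · rw [abs_of_neg h]
      have : -(Complex.I * r * (Real.pi / -r : ℝ)) = Real.pi * Complex.I := by
        have : (r : ℂ) ≠ 0 := by exact_mod_cast hr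
        push_cast
        field_simp
      rw [this, Complex.exp_pi_mul_I]
    · rw [abs_of_pos h]
      have : -(Complex.I * r * (Real.pi / r : ℝ)) = -(Real.pi * Complex.I) := by
        have : (r : ℂ) ≠ 0 := by exact_mod_cast hr
        push_cast
        field_simp
      rw [this, Complex.exp_neg, Complex.exp_pi_mul_I]
      norm_num
  set Ξ : ℝ → ℝ := fun t => (χ t + χ (t / a)) / 2 with hΞ
  refine ⟨2 * a, Ξ, ⟨?_, by linarith, fun t ht => ?_, fun t ht => ?_, fun t => ?_, fun t => ?_⟩, ?_⟩
  · exact (hc.smooth.add (hc.smooth.comp (by fun_prop))).div_const 2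
  · have : t / a ≤ 1 := by rw [div_le_one ha0]; linarith
    simp [hΞ, hc.eq_one t ht, hc.eq_one _ this]
  · have h1 : 2 ≤ t / a := by rwa [le_div_iff₀ ha0]
    have h2 : 2 ≤ t := by nlinarith
    simp [hΞ, hc.eq_zero t h2, hc.eq_zero _ h1]
  · have := hc.nonneg t
    have := hc.nonneg (t / a)
    positivity
  · have := hc.le_one t
    have := hc.le_one (t / a)
    simp only [hΞ]
    linarith
  · have h1 : ∀ t, hprof r (bump Ξ) t =
        (1 / 2) * (hprof r (bump χ) t - (a : ℂ)⁻¹ * hprof r (bump χ) (t / a)) := fun t => by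
      rcases le_or_gt t (1 / 2) with ht | ht
      · have h2 : t / a ≤ 1 / 2 := by rw [div_le_iff₀ ha0]; linarith
        have h3 : bump Ξ t = 0 := by
          have h4 : 2 * t / a ≤ 1 := by rw [div_le_one ha0]; linarith
          have h5 : t / a ≤ 1 := by linarith
          simp [bump, hΞ, hc.eq_one t (by linarith), hc.eq_one (2 * t) (by linarith),
            hc.eq_one _ h4, hc.eq_one _ h5]
        rw [hc.hprof_eq_zero r (Or.inl ht), hc.hprof_eq_zero r (Or.inl h2), hprof, h3]
        simp
      · have ht0 : 0 < t := by linarith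
        have hb : bump Ξ t = (bump χ t + bump χ (t / a)) / 2 := by
          simp only [bump, hΞ]
          rw [mul_div_assoc]
          ring
        have hl : Real.log t = Real.log (t / a) + Real.pi / |r| := by
          rw [Real.log_div ht0.ne' ha0.ne', ha, Real.log_exp]
          ring
        have he : Complex.exp (-(Complex.I * r * Real.log t)) =
            -Complex.exp (-(Complex.I * r * Real.log (t / a))) := by
          rw [hl, Complex.ofReal_add, mul_add, neg_add, Complex.exp_add, hphase]
          ring
        have hac : (a : ℂ) ≠ 0 := by exact_mod_cast ha0.ne'
        have htc : (t : ℂ) ≠ 0 := by exact_mod_cast ht0.ne'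
        simp only [hprof]
        rw [hb, he]
        push_cast
        field_simp
        ring
    simp_rw [h1]
    have hi := hc.integrable_hprof r
    have hi2 : Integrable fun t => (a : ℂ)⁻¹ * hprof r (bump χ) (t / a) :=
      (hi.comp_div ha0.ne').const_mul _
    rw [integral_const_mul, integral_sub hi hi2, integral_const_mul,
      Measure.integral_comp_div, abs_of_pos ha0, Complex.real_smul, ← mul_assoc,
      inv_mul_cancel₀ (by exact_mod_cast ha0.ne'), one_mul, sub_self, mul_zero]

theorem IsCutoff.exists_fourier_le (h : IsCutoff L Ξ) (r : ℝ) (N : ℕ) :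
    ∃ C : ℝ, 0 ≤ C ∧ ∀ u, ‖𝓕 (hprof r (bump Ξ)) u‖ ≤ C * ((1 + |u|) ^ N)⁻¹ := by
  set f := (h.hasCompactSupport_hprof r).toSchwartzMap (h.contDiff_hprof r) with hf
  have hF : ∀ u, 𝓕 (hprof r (bump Ξ)) u = (𝓕 f) u := fun u => by
    rw [SchwartzMap.fourier_coe]
    rfl
  obtain ⟨C, hC⟩ := (𝓕 f).decay N 0
  obtain ⟨C', hC'⟩ := (𝓕 f).decay 0 0
  refine ⟨2 ^ N * (C' + C), by have := hC.1; have := hC'.1; positivity, fun u => ?_⟩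
  rw [hF, ← div_eq_mul_inv, le_div_iff₀ (by positivity), mul_comm]
  have h1 := hC.2 u
  have h2 := hC'.2 u
  rw [norm_iteratedFDeriv_zero] at h1 h2
  rw [pow_zero, one_mul] at h2
  rw [Real.norm_eq_abs] at h1
  have h3 : (1 + |u|) ^ N ≤ 2 ^ N * (1 + |u| ^ N) := by
    have := add_pow_le (zero_le_one (α := ℝ)) (abs_nonneg u) N
    rw [one_pow] at this
    refine this.trans ?_
    gcongr
    · exact one_le_two
    · exact Nat.sub_le _ _
  calc (1 + |u|) ^ N * ‖(𝓕 f) u‖ ≤ 2 ^ N * (1 + |u| ^ N) * ‖(𝓕 f) u‖ := by gcongr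
    _ = 2 ^ N * (‖(𝓕 f) u‖ + |u| ^ N * ‖(𝓕 f) u‖) := by ring
    _ ≤ _ := by gcongr

theorem IsCutoff.exists_fourier_le_abs (h : IsCutoff L Ξ) {r : ℝ}
    (h0 : ∫ t, hprof r (bump Ξ) t = 0) :
    ∃ C : ℝ, 0 ≤ C ∧ ∀ u, ‖𝓕 (hprof r (bump Ξ)) u‖ ≤ C * |u| := by
  set f := hprof r (bump Ξ) with hf
  have hfi : Integrable f := h.integrable_hprof r
  have hL := h.one_le
  refine ⟨2 * Real.pi * L * ∫ t, ‖f t‖, by positivity, fun u => ?_⟩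
  have h1 : 𝓕 f u = ∫ t, ((Real.fourierChar (-(t * u)) : ℂ) - 1) * f t := by
    have h2 : ∀ t, ((Real.fourierChar (-(t * u)) : ℂ) - 1) * f t =
        Real.fourierChar (-(t * u)) • f t - f t := fun t => by
      rw [sub_mul, one_mul, Circle.smul_def, smul_eq_mul]
    simp_rw [h2]
    have h3 : Integrable fun t => Real.fourierChar (-(t * u)) • f t := by
      have := (Real.fourierIntegral_convergent_iff u).2 hfi
      simpa [mul_comm] using this
    rw [integral_sub h3 hfi, h0, sub_zero, Real.fourier_real_eq]
  rw [h1, mul_right_comm, ← integral_const_mul]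
  refine norm_integral_le_of_norm_le (hfi.norm.const_mul _) (Eventually.of_forall fun t => ?_)
  rw [norm_mul]
  by_cases ht : t ≤ 1 / 2 ∨ L ≤ t
  · simp [hf, h.hprof_eq_zero r ht]
  · push Not at ht
    gcongr
    rw [Real.fourierChar_apply]
    have h1 := Real.norm_exp_I_mul_ofReal_sub_one_le (x := 2 * Real.pi * -(t * u))
    rw [mul_comm] at h1
    refine h1.trans ?_
    rw [norm_mul, norm_neg, Real.norm_of_nonneg (by positivity), norm_mul, Real.norm_eq_abs,
      Real.norm_eq_abs, abs_of_pos (by linarith [ht.1]), mul_assoc (2 * Real.pi)]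
    gcongr
    exact ht.2.le

theorem exists_sum_min_zpow_le : ∃ C : ℝ, 0 ≤ C ∧ ∀ (F : Finset ℤ) (u : ℝ), 0 ≤ u →
    ∑ j ∈ F, min (2 ^ j * u) ((2 ^ j * u)⁻¹) ≤ C := by
  have hs : Summable fun n : ℤ => 2 * (1 / 2 : ℝ) ^ n.natAbs := by
    refine Summable.mul_left 2 (Summable.of_nat_of_neg ?_ ?_)
    · simpa using summable_geometric_two
    · simpa using summable_geometric_two
  refine ⟨∑' n : ℤ, 2 * (1 / 2 : ℝ) ^ n.natAbs, tsum_nonneg fun n => by positivity,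
    fun F u hu => ?_⟩
  rcases hu.eq_or_lt with rfl | hu
  · exact (Finset.sum_nonpos fun j _ => by simp).trans (tsum_nonneg fun n => by positivity)
  set m := Int.log 2 u with hm
  have h1 : (2 : ℝ) ^ m ≤ u := by simpa using Int.zpow_log_le_self (b := 2) one_lt_two hu
  have h2 : u < (2 : ℝ) ^ (m + 1) := by simpa using Int.lt_zpow_succ_log_self (b := 2) one_lt_two u
  have hterm : ∀ j : ℤ, min ((2 : ℝ) ^ j * u) ((2 ^ j * u)⁻¹) ≤ 2 * (1 / 2 : ℝ) ^ (j + m).natAbs := by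
    intro j
    have hj : (0 : ℝ) < 2 ^ j := by positivity
    rcases le_total 0 (j + m) with h | h
    · refine (min_le_right _ _).trans ?_
      have h3 : (1 / 2 : ℝ) ^ (j + m).natAbs = ((2 : ℝ) ^ (j + m))⁻¹ := by
        rw [one_div, inv_pow, ← zpow_natCast, Int.natAbs_of_nonneg h]
      rw [h3]
      have h4 : (2 ^ j * u)⁻¹ ≤ ((2 : ℝ) ^ (j + m))⁻¹ := by
        rw [zpow_add₀ two_ne_zero]
        gcongr
      have : (0 : ℝ) < ((2 : ℝ) ^ (j + m))⁻¹ := by positivity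
      linarith
    · refine (min_le_left _ _).trans ?_
      have h3 : (1 / 2 : ℝ) ^ (j + m).natAbs = (2 : ℝ) ^ (j + m) := by
        rw [one_div, inv_pow, ← zpow_natCast, Int.ofNat_natAbs_of_nonpos h, zpow_neg, inv_inv]
      rw [h3, zpow_add₀ two_ne_zero, mul_left_comm]
      rw [zpow_add_one₀ two_ne_zero] at h2
      gcongr
      linarith
  calc _ ≤ ∑ j ∈ F, 2 * (1 / 2 : ℝ) ^ (j + m).natAbs := Finset.sum_le_sum fun j _ => hterm j
    _ = ∑ n ∈ F.map (addRightEmbedding m), 2 * (1 / 2 : ℝ) ^ n.natAbs := by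
        rw [Finset.sum_map]; rfl
    _ ≤ _ := hs.sum_le_tsum _ fun n _ => by positivity

end profile

section polar
open scoped FourierTransform RealInnerProductSpace
variable {d : ℕ}

instance : IsFiniteMeasure (sphereMeasure d) := by
  unfold sphereMeasure; infer_instance

theorem lintegral_polar (hd : 1 ≤ d) {f : EuclideanSpace ℝ (Fin d) → ℝ≥0∞} (hf : Measurable f) :
    ∫⁻ x, f x = ∫⁻ θ : sphere (0 : EuclideanSpace ℝ (Fin d)) 1, (∫⁻ t in Set.Ioi (0 : ℝ),
      ENNReal.ofReal (t ^ (d - 1)) * f (t • (θ : EuclideanSpace ℝ (Fin d)))) ∂(sphereMeasure d) := by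
  have : Nonempty (Fin d) := ⟨⟨0, hd⟩⟩
  have hg : Measurable fun p : sphere (0 : EuclideanSpace ℝ (Fin d)) 1 × Set.Ioi (0 : ℝ) =>
      f ((p.2 : ℝ) • (p.1 : EuclideanSpace ℝ (Fin d))) := by fun_prop
  have hmp := (volume : Measure (EuclideanSpace ℝ (Fin d))).measurePreserving_homeomorphUnitSphereProd
  rw [finrank_euclideanSpace_fin] at hmp
  calc ∫⁻ x, f x = ∫⁻ x in {0}ᶜ, f x := by rw [restrict_compl_singleton]
    _ = ∫⁻ x : ({0}ᶜ : Set (EuclideanSpace ℝ (Fin d))), f x ∂(Measure.comap Subtype.val volume) :=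
        (lintegral_subtype_comap (measurableSet_singleton _).compl f).symm
    _ = ∫⁻ p, f ((p.2 : ℝ) • (p.1 : EuclideanSpace ℝ (Fin d)))
          ∂((sphereMeasure d).prod (.volumeIoiPow (d - 1))) := by
        rw [sphereMeasure, ← hmp.lintegral_comp hg]
        refine lintegral_congr fun x => ?_
        rw [← homeomorphUnitSphereProd_symm_apply_coe, Homeomorph.symm_apply_apply]
    _ = ∫⁻ θ, ∫⁻ t, f ((t : ℝ) • (θ : EuclideanSpace ℝ (Fin d)))
          ∂(Measure.volumeIoiPow (d - 1)) ∂(sphereMeasure d) := lintegral_prod _ hg.aemeasurable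
    _ = _ := by
        refine lintegral_congr fun θ => ?_
        rw [Measure.volumeIoiPow, lintegral_withDensity_eq_lintegral_mul _ (by fun_prop)
          (by fun_prop)]
        exact lintegral_subtype_comap measurableSet_Ioi
          fun t => ENNReal.ofReal (t ^ (d - 1)) * f (t • (θ : EuclideanSpace ℝ (Fin d)))

theorem integral_polar (hd : 1 ≤ d) {f : EuclideanSpace ℝ (Fin d) → ℂ} (hf : Integrable f) :
    ∫ x, f x = ∫ θ : sphere (0 : EuclideanSpace ℝ (Fin d)) 1, (∫ t in Set.Ioi (0 : ℝ),
      t ^ (d - 1) • f (t • (θ : EuclideanSpace ℝ (Fin d)))) ∂(sphereMeasure d) := by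
  have : Nonempty (Fin d) := ⟨⟨0, hd⟩⟩
  have hmp := (volume : Measure (EuclideanSpace ℝ (Fin d))).measurePreserving_homeomorphUnitSphereProd
  rw [finrank_euclideanSpace_fin] at hmp
  set g : sphere (0 : EuclideanSpace ℝ (Fin d)) 1 × Set.Ioi (0 : ℝ) → ℂ := fun p =>
      f ((p.2 : ℝ) • (p.1 : EuclideanSpace ℝ (Fin d))) with hg
  have hcomp : g ∘ (homeomorphUnitSphereProd (EuclideanSpace ℝ (Fin d))) = f ∘ (↑) := by
    ext x
    rw [Function.comp_apply, hg]
    dsimp only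
    rw [← homeomorphUnitSphereProd_symm_apply_coe, Homeomorph.symm_apply_apply]
    rfl
  have hgi : Integrable g ((sphereMeasure d).prod (.volumeIoiPow (d - 1))) := by
    rw [sphereMeasure, ← hmp.integrable_comp_emb (Homeomorph.measurableEmbedding _), hcomp,
      ← integrableOn_iff_comap_subtypeVal (measurableSet_singleton _).compl]
    exact hf.integrableOn
  calc ∫ x, f x = ∫ x in {0}ᶜ, f x := by rw [restrict_compl_singleton]
    _ = ∫ x : ({0}ᶜ : Set (EuclideanSpace ℝ (Fin d))), f x ∂(Measure.comap Subtype.val volume) :=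
        (integral_subtype_comap (measurableSet_singleton _).compl f).symm
    _ = ∫ p, g p ∂((sphereMeasure d).prod (.volumeIoiPow (d - 1))) := by
        rw [sphereMeasure, ← hmp.integral_comp (Homeomorph.measurableEmbedding _)]
        exact integral_congr_ae (Eventually.of_forall fun x => (congrFun hcomp x).symm)
    _ = ∫ θ, ∫ t, g (θ, t) ∂(Measure.volumeIoiPow (d - 1)) ∂(sphereMeasure d) :=
        integral_prod _ hgi
    _ = _ := by
        refine integral_congr_ae (Eventually.of_forall fun θ => ?_)
        simp only [Measure.volumeIoiPow, ENNReal.ofReal]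
        rw [integral_withDensity_eq_integral_smul (by fun_prop)]
        rw [integral_subtype_comap measurableSet_Ioi
          fun t => Real.toNNReal (t ^ (d - 1)) • f (t • (θ : EuclideanSpace ℝ (Fin d)))]
        refine setIntegral_congr_fun measurableSet_Ioi fun t ht => ?_
        rw [NNReal.smul_def, Real.coe_toNNReal _ (pow_nonneg (Set.mem_Ioi.1 ht).le _)]

/-- Homogeneity of degree zero. -/
def IsHomogZero (Ω : EuclideanSpace ℝ (Fin d) → ℝ) : Prop :=
  ∀ ρ : ℝ, 0 < ρ → ∀ x : EuclideanSpace ℝ (Fin d), x ≠ 0 → Ω (ρ • x) = Ω x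

/-- The kernel `Ω(x)|x|^{-d-ir}` cut off by the radial factor `m(|x|)`. -/
def radKern (r : ℝ) (m : ℝ → ℝ) (Ω : EuclideanSpace ℝ (Fin d) → ℝ) (x : EuclideanSpace ℝ (Fin d)) :
    ℂ := ((Ω x * m ‖x‖ / ‖x‖ ^ d : ℝ) : ℂ) * Complex.exp (-(Complex.I * r * Real.log ‖x‖))

/-- The dyadic piece of the kernel at scale `2 ^ j`. -/
def kern (r : ℝ) (ψ : ℝ → ℝ) (Ω : EuclideanSpace ℝ (Fin d) → ℝ) (j : ℤ) :
    EuclideanSpace ℝ (Fin d) → ℂ := radKern r (fun t => ψ ((2 ^ j)⁻¹ * t)) Ω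

variable {r L : ℝ} {m ψ Ξ : ℝ → ℝ} {Ω : EuclideanSpace ℝ (Fin d) → ℝ}

theorem measurable_radKern (hm : Measurable m) (hΩ : Measurable Ω) :
    Measurable (radKern r m Ω) := by
  unfold radKern; fun_prop

theorem norm_radKern (x : EuclideanSpace ℝ (Fin d)) :
    ‖radKern r m Ω x‖ = |Ω x| * |m ‖x‖| / ‖x‖ ^ d := by
  rw [radKern, norm_mul, norm_cexp_neg_I_mul, mul_one, Complex.norm_real, Real.norm_eq_abs, abs_div,
    abs_mul, abs_pow, abs_norm]

theorem sphere_ne_zero (θ : sphere (0 : EuclideanSpace ℝ (Fin d)) 1) :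
    (θ : EuclideanSpace ℝ (Fin d)) ≠ 0 := by
  have := norm_eq_of_mem_sphere θ
  intro h
  rw [h, norm_zero] at this
  exact zero_ne_one this

theorem pow_pred_div_pow (hd : 1 ≤ d) {t : ℝ} (ht : 0 < t) : t ^ (d - 1) / t ^ d = t⁻¹ := by
  obtain ⟨n, rfl⟩ := Nat.exists_eq_add_of_le' hd
  rw [Nat.add_sub_cancel, pow_succ]
  field_simp

theorem smul_radKern (hd : 1 ≤ d) (hom : IsHomogZero Ω)
    (θ : sphere (0 : EuclideanSpace ℝ (Fin d)) 1) {t : ℝ} (ht : 0 < t) :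
    t ^ (d - 1) • radKern r m Ω (t • (θ : EuclideanSpace ℝ (Fin d))) = (Ω θ : ℂ) * hprof r m t := by
  rw [radKern, hom t ht _ (sphere_ne_zero θ), norm_smul, norm_eq_of_mem_sphere θ, mul_one,
    Real.norm_of_nonneg ht.le, hprof, Complex.real_smul, ← mul_assoc, ← mul_assoc,
    ← Complex.ofReal_mul, ← Complex.ofReal_mul]
  have : t ^ (d - 1) * (Ω θ * m t / t ^ d) = Ω θ * (m t / t) := by
    rw [div_eq_mul_inv (m t), ← pow_pred_div_pow hd ht]
    ring
  rw [this]

theorem lintegral_radKern (hd : 1 ≤ d) (hm : Measurable m) (hΩ : Measurable Ω)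
    (hom : IsHomogZero Ω) :
    ∫⁻ x, ‖radKern r m Ω x‖ₑ = (∫⁻ θ : sphere (0 : EuclideanSpace ℝ (Fin d)) 1, ‖Ω θ‖ₑ
      ∂(sphereMeasure d)) * ∫⁻ t in Set.Ioi (0 : ℝ), ‖hprof r m t‖ₑ := by
  rw [lintegral_polar hd (measurable_radKern hm hΩ).enorm, ← lintegral_mul_const _ (by fun_prop)]
  refine lintegral_congr fun θ => ?_
  rw [← lintegral_const_mul _ (by unfold hprof; fun_prop)]
  refine setLIntegral_congr_fun measurableSet_Ioi fun t ht => ?_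
  have ht' : 0 < t := ht
  have h := congrArg enorm (smul_radKern (r := r) (m := m) hd hom θ ht')
  rw [enorm_smul, enorm_mul, Real.enorm_of_nonneg (by positivity)] at h
  rw [h]
  congr 1
  rw [← ofReal_norm, ← ofReal_norm, Complex.norm_real]

theorem hprof_smul_scale (j : ℤ) {t : ℝ} (ht : 0 < t) :
    hprof r (fun t => ψ ((2 ^ j)⁻¹ * t)) t = ((2 : ℝ) ^ j)⁻¹ •
      (Complex.exp (-(Complex.I * r * Real.log (2 ^ j))) * hprof r ψ ((2 ^ j)⁻¹ * t)) := by
  have h2 : (0 : ℝ) < 2 ^ j := by positivity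
  have hl : Real.log t = Real.log (2 ^ j) + Real.log ((2 ^ j)⁻¹ * t) := by
    rw [← Real.log_mul h2.ne' (by positivity), mul_inv_cancel_left₀ h2.ne']
  rw [hprof, hprof, hl, Complex.ofReal_add, mul_add, neg_add, Complex.exp_add, Complex.real_smul]
  have : ψ ((2 ^ j)⁻¹ * t) / t = (2 ^ j)⁻¹ * (ψ ((2 ^ j)⁻¹ * t) / ((2 ^ j)⁻¹ * t)) := by
    field_simp
  rw [this]
  push_cast
  ring

theorem IsCutoff.norm_hprof_le (h : IsCutoff L Ξ) (t : ℝ) : ‖hprof r (bump Ξ) t‖ ≤ 2 := by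
  by_cases ht : t ≤ 1 / 2 ∨ L ≤ t
  · simp [h.hprof_eq_zero r ht]
  · push Not at ht
    rw [hprof, norm_mul, norm_cexp_neg_I_mul, mul_one, Complex.norm_real, Real.norm_eq_abs, abs_div,
      div_le_iff₀ (abs_pos.2 (by linarith [ht.1])), abs_of_pos (a := t) (by linarith [ht.1])]
    linarith [h.abs_bump_le t]

theorem IsCutoff.measurable_scale (h : IsCutoff L Ξ) (j : ℤ) :
    Measurable fun t => bump Ξ ((2 ^ j)⁻¹ * t) := by
  have := h.contDiff_bump.continuous
  fun_prop

theorem IsCutoff.measurable_kern (h : IsCutoff L Ξ) (hΩ : Measurable Ω) (j : ℤ) :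
    Measurable (kern r (bump Ξ) Ω j) := measurable_radKern (h.measurable_scale j) hΩ

theorem IsCutoff.lintegral_kern_le (h : IsCutoff L Ξ) (hd : 1 ≤ d) (hΩ : Measurable Ω)
    (hom : IsHomogZero Ω) (j : ℤ) :
    ∫⁻ x, ‖kern r (bump Ξ) Ω j x‖ₑ ≤ ENNReal.ofReal (2 * L) *
      ∫⁻ θ : sphere (0 : EuclideanSpace ℝ (Fin d)) 1, ‖Ω θ‖ₑ ∂(sphereMeasure d) := by
  have h2 : (0 : ℝ) < 2 ^ j := by positivity
  have hL := h.one_le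
  rw [kern, lintegral_radKern hd (h.measurable_scale j) hΩ hom, mul_comm]
  gcongr
  calc ∫⁻ t in Set.Ioi (0 : ℝ), ‖hprof r (fun t => bump Ξ ((2 ^ j)⁻¹ * t)) t‖ₑ
      ≤ ∫⁻ t in Set.Ioi (0 : ℝ), (Set.Icc 0 (L * 2 ^ j)).indicator
          (fun _ => ENNReal.ofReal (2 * (2 ^ j)⁻¹)) t := by
        refine setLIntegral_mono' measurableSet_Ioi fun t ht => ?_
        have ht' : 0 < t := ht
        rw [hprof_smul_scale j ht']
        by_cases htL : t ≤ L * 2 ^ j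
        · rw [Set.indicator_of_mem (show t ∈ Set.Icc 0 (L * 2 ^ j) from ⟨ht'.le, htL⟩), ← ofReal_norm]
          apply ENNReal.ofReal_le_ofReal
          rw [norm_smul, norm_mul, norm_cexp_neg_I_mul, one_mul, Real.norm_of_nonneg (by positivity),
            mul_comm]
          gcongr
          exact h.norm_hprof_le _
        · rw [h.hprof_eq_zero r (Or.inr ?_)]
          · simp
          · rw [← div_eq_inv_mul, le_div_iff₀ h2]
            exact (not_le.1 htL).le
    _ ≤ ∫⁻ t, (Set.Icc 0 (L * 2 ^ j)).indicator
          (fun _ => ENNReal.ofReal (2 * (2 ^ j)⁻¹)) t := setLIntegral_le_lintegral _ _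
    _ = _ := by
        rw [lintegral_indicator_const measurableSet_Icc, Real.volume_Icc,
          ← ENNReal.ofReal_mul (by positivity)]
        congr 1
        field_simp
        ring

theorem IsCutoff.kern_eq_zero (h : IsCutoff L Ξ) {j : ℤ} {x : EuclideanSpace ℝ (Fin d)}
    (hx : ‖x‖ ≤ 2 ^ j / 2 ∨ L * 2 ^ j ≤ ‖x‖) : kern r (bump Ξ) Ω j x = 0 := by
  have h2 : (0 : ℝ) < 2 ^ j := by positivity
  have : bump Ξ ((2 ^ j)⁻¹ * ‖x‖) = 0 := by
    rcases hx with hx | hx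
    · apply h.bump_eq_zero_of_le
      rw [← div_eq_inv_mul, div_le_iff₀ h2]
      linarith
    · apply h.bump_eq_zero_of_ge
      rwa [← div_eq_inv_mul, le_div_iff₀ h2]
  simp [kern, radKern, this]

theorem IsCutoff.norm_kern_le (h : IsCutoff L Ξ) (j : ℤ) (x : EuclideanSpace ℝ (Fin d)) :
    ‖kern r (bump Ξ) Ω j x‖ ≤ |Ω x| * (2 ^ d * ((2 ^ j) ^ d)⁻¹) := by
  by_cases hx : ‖x‖ ≤ 2 ^ j / 2 ∨ L * 2 ^ j ≤ ‖x‖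
  · rw [h.kern_eq_zero hx, norm_zero]
    positivity
  · push Not at hx
    have h2 : (0 : ℝ) < 2 ^ j := by positivity
    rw [kern, norm_radKern, mul_div_assoc]
    gcongr
    calc _ ≤ (1 : ℝ) / ((2 : ℝ) ^ j / 2) ^ d := by
          gcongr
          · exact h.abs_bump_le _
          · exact hx.1.le
      _ = _ := by
          rw [div_pow]
          field_simp

theorem IsCutoff.fourier_kern (h : IsCutoff L Ξ) (hd : 1 ≤ d) (hom : IsHomogZero Ω) (j : ℤ)
    (hi : Integrable (kern r (bump Ξ) Ω j)) (ξ : EuclideanSpace ℝ (Fin d)) :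
    𝓕 (kern r (bump Ξ) Ω j) ξ = ∫ θ : sphere (0 : EuclideanSpace ℝ (Fin d)) 1, (Ω θ : ℂ) *
      (Complex.exp (-(Complex.I * r * Real.log (2 ^ j))) *
        𝓕 (hprof r (bump Ξ)) (2 ^ j * ⟪(θ : EuclideanSpace ℝ (Fin d)), ξ⟫)) ∂(sphereMeasure d) := by
  have h2 : (0 : ℝ) < 2 ^ j := by positivity
  rw [Real.fourier_eq, integral_polar hd ((Real.fourierIntegral_convergent_iff ξ).2 hi)]
  refine integral_congr_ae (Eventually.of_forall fun θ => ?_)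
  dsimp only
  set u := ⟪(θ : EuclideanSpace ℝ (Fin d)), ξ⟫ with hu
  set G : ℝ → ℂ := fun s => Real.fourierChar (-(s * (2 ^ j * u))) • hprof r (bump Ξ) s with hG
  calc ∫ t in Set.Ioi (0 : ℝ), t ^ (d - 1) •
        Real.fourierChar (-⟪t • (θ : EuclideanSpace ℝ (Fin d)), ξ⟫) •
          kern r (bump Ξ) Ω j (t • (θ : EuclideanSpace ℝ (Fin d)))
      = ∫ t in Set.Ioi (0 : ℝ), (Ω θ : ℂ) *
          (Complex.exp (-(Complex.I * r * Real.log (2 ^ j))) * (((2 : ℝ) ^ j)⁻¹ •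
            G ((2 ^ j)⁻¹ * t))) := by
        refine setIntegral_congr_fun measurableSet_Ioi fun t ht => ?_
        have ht' : 0 < t := ht
        rw [smul_comm, kern, smul_radKern hd hom θ ht', hprof_smul_scale j ht', hG,
          real_inner_smul_left, ← hu]
        dsimp only
        have : (2 ^ j)⁻¹ * t * (2 ^ j * u) = t * u := by field_simp
        rw [this, Circle.smul_def, Circle.smul_def, Complex.real_smul, Complex.real_smul,
          smul_eq_mul, smul_eq_mul]
        ring
    _ = (Ω θ : ℂ) * (Complex.exp (-(Complex.I * r * Real.log (2 ^ j))) *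
          ∫ t in Set.Ioi (0 : ℝ), G t) := by
        rw [integral_const_mul, integral_const_mul, integral_smul,
          integral_comp_mul_left_Ioi (fun s => G s) 0 (inv_pos.2 h2), mul_zero, inv_inv, smul_smul,
          inv_mul_cancel₀ h2.ne', one_smul]
    _ = _ := by
        rw [Real.fourier_real_eq, setIntegral_eq_integral_of_forall_compl_eq_zero]
        intro t ht
        rw [Set.mem_Ioi, not_lt] at ht
        simp [hG, h.hprof_eq_zero r (Or.inl (by linarith : t ≤ 1 / 2))]

end polar

section rough
open scoped FourierTransform RealInnerProductSpace
variable {d : ℕ}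

/-- The difference of a kernel and its mollification. -/
def rough (K η : EuclideanSpace ℝ (Fin d) → ℂ) : EuclideanSpace ℝ (Fin d) → ℂ :=
  fun x => K x - cv K η x

variable {K η : EuclideanSpace ℝ (Fin d) → ℂ} {C : ℝ≥0∞} {t : ℝ}

theorem IsMollifier.measurable_rough (h : IsMollifier C t η) (hK : Measurable K) :
    Measurable (rough K η) := hK.sub (measurable_cv hK h.measurable)

theorem IsMollifier.integrable_rough (h : IsMollifier C t η) (hK : Integrable K) :
    Integrable (rough K η) := hK.sub (integrable_cv hK h.integrable)

theorem fourier_sub_apply {f g : EuclideanSpace ℝ (Fin d) → ℂ} (hf : Integrable f)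
    (hg : Integrable g) (ξ : EuclideanSpace ℝ (Fin d)) :
    𝓕 (fun x => f x - g x) ξ = 𝓕 f ξ - 𝓕 g ξ := by
  rw [Real.fourier_eq, Real.fourier_eq, Real.fourier_eq, ← integral_sub
    ((Real.fourierIntegral_convergent_iff ξ).2 hf) ((Real.fourierIntegral_convergent_iff ξ).2 hg)]
  simp only [smul_sub]

theorem fourier_sum_apply {ι : Type*} (S : Finset ι) {f : ι → EuclideanSpace ℝ (Fin d) → ℂ}
    (hf : ∀ i ∈ S, Integrable (f i)) (ξ : EuclideanSpace ℝ (Fin d)) :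
    𝓕 (fun x => ∑ i ∈ S, f i x) ξ = ∑ i ∈ S, 𝓕 (f i) ξ := by
  simp only [Real.fourier_eq, Finset.smul_sum]
  exact integral_finsetSum _ fun i hi => (Real.fourierIntegral_convergent_iff ξ).2 (hf i hi)

theorem IsMollifier.fourier_rough (h : IsMollifier C t η) (hK : Integrable K)
    (ξ : EuclideanSpace ℝ (Fin d)) : 𝓕 (rough K η) ξ = 𝓕 K ξ * (1 - 𝓕 η ξ) := by
  unfold rough
  rw [fourier_sub_apply hK (integrable_cv hK h.integrable), fourier_cv hK h.integrable]
  ring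

theorem IsMollifier.norm_rough_le (h : IsMollifier C t η) {A : ℝ} (hA : ∀ x, ‖K x‖ ≤ A)
    (x : EuclideanSpace ℝ (Fin d)) : ‖rough K η x‖ ≤ 2 * A := by
  have h0 : 0 ≤ A := (norm_nonneg _).trans (hA 0)
  have h1 : ∫ y, ‖η y‖ ≤ 1 := by
    rw [integral_norm_eq_lintegral_enorm h.integrable.1]
    exact ENNReal.toReal_le_of_le_ofReal zero_le_one (by simpa using h.lintegral_le)
  calc ‖rough K η x‖ ≤ ‖K x‖ + ‖cv K η x‖ := norm_sub_le _ _
    _ ≤ A + A * 1 := add_le_add (hA x) ((norm_cv_le_left hA h.integrable x).trans (by gcongr))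
    _ = 2 * A := by ring

theorem IsMollifier.enorm_rough_le (h : IsMollifier C t η) {c : ℝ≥0∞}
    {b : OrthonormalBasis (Fin d) ℝ (EuclideanSpace ℝ (Fin d))} {w : Fin d → ℝ}
    (hK : ∀ x, ‖K x‖ₑ ≤ c * (box b w).indicator 1 x) (ht : ∀ i, t ≤ w i) (hw : ∀ i, 0 ≤ w i)
    (x : EuclideanSpace ℝ (Fin d)) :
    ‖rough K η x‖ₑ ≤ 2 * c * (box b (w + w)).indicator 1 x := by
  have hKc : ∀ x, ‖K x‖ₑ ≤ c := fun x => (hK x).trans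
    (mul_le_of_le_one_right zero_le (Set.indicator_apply_le' (fun _ => le_rfl) fun _ => zero_le))
  have hsub : ‖rough K η x‖ₑ ≤ ‖K x‖ₑ + ∫⁻ y, ‖K (x - y)‖ₑ * ‖η y‖ₑ :=
    enorm_sub_le.trans (by gcongr; exact enorm_cv_le _ _ _)
  refine hsub.trans ?_
  by_cases hx : x ∈ box b (w + w)
  · rw [Set.indicator_of_mem hx, Pi.one_apply, mul_one, two_mul]
    refine add_le_add (hKc x) ?_
    calc ∫⁻ y, ‖K (x - y)‖ₑ * ‖η y‖ₑ ≤ ∫⁻ y, c * ‖η y‖ₑ := lintegral_mono fun y => by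
          gcongr; exact hKc _
      _ = c * ∫⁻ y, ‖η y‖ₑ := lintegral_const_mul _ h.measurable.enorm
      _ ≤ c := mul_le_of_le_one_right zero_le h.lintegral_le
  · have hz : ∀ y, ‖y‖ ≤ t → ‖K (x - y)‖ₑ = 0 := fun y hy => by
      refine le_antisymm ((hK _).trans ?_) zero_le
      rw [Set.indicator_of_notMem, mul_zero]
      intro hxy
      refine hx ?_
      have := add_mem_box hxy (mem_box_of_norm_le (b := b) (c := w) fun i => hy.trans (ht i))
      rwa [_root_.sub_add_cancel] at this
    have hz' : ∀ y, ‖K (x - y)‖ₑ * ‖η y‖ₑ = 0 := fun y => by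
      by_cases hy : ‖y‖ ≤ t
      · rw [hz y hy, zero_mul]
      · rw [h.support y (not_le.1 hy), enorm_zero, mul_zero]
    have hx' : ‖K x‖ₑ = 0 := by
      refine le_antisymm ((hK _).trans ?_) zero_le
      rw [Set.indicator_of_notMem, mul_zero]
      exact fun h' => hx (box_mono (fun i => by simpa using hw i) h')
    simp [hz', hx']

end rough

section sector
open scoped FourierTransform RealInnerProductSpace
variable {d : ℕ} {r L : ℝ} {Ξ : ℝ → ℝ} {Ω : EuclideanSpace ℝ (Fin d) → ℝ}

/-- The restriction of a function to the directions at distance less than `ρ` from `e`. -/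
def sector (ρ : ℝ) (e : EuclideanSpace ℝ (Fin d)) (Ω : EuclideanSpace ℝ (Fin d) → ℝ) :
    EuclideanSpace ℝ (Fin d) → ℝ := {x | ‖‖x‖⁻¹ • x - e‖ < ρ}.indicator Ω

theorem measurable_sector (ρ : ℝ) (e : EuclideanSpace ℝ (Fin d)) (hΩ : Measurable Ω) :
    Measurable (sector ρ e Ω) :=
  hΩ.indicator (measurableSet_lt (by fun_prop) measurable_const)

theorem abs_sector_le {ρ A : ℝ} {e : EuclideanSpace ℝ (Fin d)} (hA : ∀ x, |Ω x| ≤ A)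
    (x : EuclideanSpace ℝ (Fin d)) : |sector ρ e Ω x| ≤ A := by
  by_cases hx : x ∈ {x | ‖‖x‖⁻¹ • x - e‖ < ρ}
  · rw [sector, Set.indicator_of_mem hx]
    exact hA x
  · rw [sector, Set.indicator_of_notMem hx, abs_zero]
    exact (abs_nonneg _).trans (hA x)

theorem IsHomogZero.sector (h : IsHomogZero Ω) (ρ : ℝ) (e : EuclideanSpace ℝ (Fin d)) :
    IsHomogZero (sector ρ e Ω) := by
  intro τ hτ x hx
  have : ‖τ • x‖⁻¹ • τ • x = ‖x‖⁻¹ • x := by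
    rw [norm_smul, Real.norm_of_nonneg hτ.le, smul_smul, mul_inv, mul_right_comm,
      inv_mul_cancel₀ hτ.ne', one_mul]
  simp only [_root_.sector, Set.indicator, Set.mem_ofPred_eq, this, h τ hτ x hx]

theorem sector_sphere (ρ : ℝ) (e : EuclideanSpace ℝ (Fin d))
    (θ : sphere (0 : EuclideanSpace ℝ (Fin d)) 1) :
    sector ρ e Ω θ = (ball (θ : EuclideanSpace ℝ (Fin d)) ρ).indicator (fun _ => Ω θ) e := by
  simp only [_root_.sector, Set.indicator, Set.mem_ofPred_eq, norm_eq_of_mem_sphere, inv_one,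
    one_smul, mem_ball, dist_eq_norm_sub', norm_sub_rev]

/-- The kernel of a sector lives in a box that is thin in all directions but one. -/
theorem IsCutoff.enorm_kern_sector_le (h : IsCutoff L Ξ) {A ρ : ℝ} (hA : ∀ x, |Ω x| ≤ A)
    {b : OrthonormalBasis (Fin d) ℝ (EuclideanSpace ℝ (Fin d))} {i₀ : Fin d}
    {e : EuclideanSpace ℝ (Fin d)} (he : ∀ i ≠ i₀, ⟪b i, e⟫ = 0) (j : ℤ)
    (x : EuclideanSpace ℝ (Fin d)) :
    ‖kern r (bump Ξ) (sector ρ e Ω) j x‖ₑ ≤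
      (ENNReal.ofReal A * 2 ^ d * (ENNReal.ofReal ((2 ^ j) ^ d))⁻¹) *
        (box b fun i => 2 ^ j * (if i = i₀ then L else L * ρ)).indicator 1 x := by
  have h2 : (0 : ℝ) < 2 ^ j := by positivity
  by_cases hk : kern r (bump Ξ) (sector ρ e Ω) j x = 0
  · rw [hk, enorm_zero]
    exact zero_le
  have hx2 : ‖x‖ < L * 2 ^ j := by
    by_contra! hx
    exact hk (h.kern_eq_zero (Or.inr hx))
  have hx1 : 0 < ‖x‖ := by
    by_contra! hx
    exact hk (h.kern_eq_zero (Or.inl (hx.trans (by positivity))))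
  have hs : ‖‖x‖⁻¹ • x - e‖ < ρ := by
    by_contra hs
    apply hk
    have : sector ρ e Ω x = 0 :=
      Set.indicator_of_notMem (s := {x | ‖‖x‖⁻¹ • x - e‖ < ρ}) hs _
    simp [kern, radKern, this]
  have hmem : x ∈ box b fun i => 2 ^ j * (if i = i₀ then L else L * ρ) := by
    intro i
    dsimp only
    split_ifs with hi
    · exact (abs_repr_le x i).trans (by linarith)
    · have hxe : b.repr x i = ‖x‖ * b.repr (‖x‖⁻¹ • x - e) i := by
        rw [b.repr_apply_apply, b.repr_apply_apply, inner_sub_right, he i hi, sub_zero,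
          real_inner_smul_right, mul_inv_cancel_left₀ hx1.ne']
      rw [hxe, abs_mul, abs_norm]
      calc ‖x‖ * |b.repr (‖x‖⁻¹ • x - e) i| ≤ (L * 2 ^ j) * ρ :=
            mul_le_mul hx2.le ((abs_repr_le _ i).trans hs.le) (abs_nonneg _)
              (hx1.le.trans hx2.le)
        _ = _ := by ring
  rw [Set.indicator_of_mem hmem, Pi.one_apply, mul_one, ← ofReal_norm]
  refine (ENNReal.ofReal_le_ofReal (h.norm_kern_le j x)).trans ?_
  rw [ENNReal.ofReal_mul (abs_nonneg _), ENNReal.ofReal_mul (by positivity),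
    ENNReal.ofReal_inv_of_pos (by positivity), ENNReal.ofReal_pow zero_le_two, ENNReal.ofReal_ofNat,
    ← mul_assoc]
  gcongr
  exact abs_sector_le hA x

theorem prod_ite_eq_mul_pow (hd : 1 ≤ d) (i₀ : Fin d) (p q : ℝ) :
    ∏ i, (if i = i₀ then p else p * q) = p ^ d * q ^ (d - 1) := by
  rw [← Finset.mul_prod_erase _ _ (Finset.mem_univ i₀), if_pos rfl,
    Finset.prod_congr rfl fun i hi => if_neg (Finset.ne_of_mem_erase hi), Finset.prod_const,
    Finset.card_erase_of_mem (Finset.mem_univ _), Finset.card_univ, Fintype.card_fin, mul_pow,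
    ← mul_assoc, ← pow_succ', Nat.sub_add_cancel hd]

theorem lintegral_sum_rough_sector_sq_le (hd : 1 ≤ d) (h : IsCutoff L Ξ) {A ρ : ℝ}
    (hA : ∀ x, |Ω x| ≤ A) {S : Finset ℤ} {B : ℤ → EuclideanSpace ℝ (Fin d) → ℂ} {M : ℝ≥0∞}
    (hB : IsBadFamily S B M) {s : ℤ} (hρ0 : 0 < ρ) (hρ1 : ρ ≤ 1) (hs : 1 ≤ 2 ^ s * ρ)
    {C : ℝ≥0∞} {η : ℤ → EuclideanSpace ℝ (Fin d) → ℂ} (hη : ∀ j, IsMollifier C (2 ^ j * ρ ^ 2) (η j))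
    {e : EuclideanSpace ℝ (Fin d)} (he : e ≠ 0) :
    ∫⁻ x, ‖∑ k ∈ S, cv (rough (kern r (bump Ξ) (sector ρ e Ω) (k + s)) (η (k + s))) (B k) x‖ₑ ^ 2 ≤
      8 * (2 ^ d) ^ 2 * (2 + d) ^ d * ENNReal.ofReal ((4 * L) ^ d) ^ 2 *
        (ENNReal.ofReal A ^ 2 * ENNReal.ofReal (ρ ^ (d - 1)) ^ 2 * M * ∑ k ∈ S, ∫⁻ x, ‖B k x‖ₑ) := by
  obtain ⟨b, hb⟩ := exists_orthonormalBasis_apply_eq (⟨0, hd⟩ : Fin d)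
    (show ‖‖e‖⁻¹ • e‖ = 1 by
      rw [norm_smul, norm_inv, norm_norm, inv_mul_cancel₀ (norm_ne_zero_iff.2 he)])
  set i₀ : Fin d := ⟨0, hd⟩
  have hL := h.one_le
  have hbe : ∀ i ≠ i₀, ⟪b i, e⟫ = 0 := fun i hi => by
    have h1 : ⟪b i, b i₀⟫ = 0 := b.orthonormal.2 hi
    rwa [hb, real_inner_smul_right, mul_eq_zero,
      or_iff_right (inv_ne_zero (norm_ne_zero_iff.2 he))] at h1
  set w : Fin d → ℝ := fun i => if i = i₀ then 2 * L else 2 * L * ρ with hw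
  have hw1 : ∀ i, 1 ≤ 2 ^ s * w i := by
    intro i
    simp only [hw]
    have h2s : (0 : ℝ) < 2 ^ s := by positivity
    have : (2 : ℝ) ^ s * ρ ≤ 2 ^ s := mul_le_of_le_one_right h2s.le hρ1
    split_ifs <;> nlinarith
  have hρL : ρ ^ 2 ≤ L * ρ := by nlinarith
  have hLρ : L * ρ ≤ L := mul_le_of_le_one_right (by linarith) hρ1
  have hprod : ∏ i, (2 * w i) = (4 * L) ^ d * ρ ^ (d - 1) := by
    rw [← prod_ite_eq_mul_pow hd i₀]
    refine Finset.prod_congr rfl fun i _ => ?_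
    simp only [hw]
    split_ifs <;> ring
  have hpt : ∀ x, ‖∑ k ∈ S, cv (rough (kern r (bump Ξ) (sector ρ e Ω) (k + s)) (η (k + s)))
      (B k) x‖ₑ ≤ 2 * (ENNReal.ofReal A * 2 ^ d) *
        ∑ k ∈ S, (ENNReal.ofReal (((2 : ℝ) ^ (k + s)) ^ d))⁻¹ *
          ∫⁻ y, (box b (fun i => 2 ^ (k + s) * w i)).indicator 1 (x - y) * ‖B k y‖ₑ := by
    intro x
    rw [Finset.mul_sum]
    refine (enorm_sum_le _ _).trans (Finset.sum_le_sum fun k _ => ?_)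
    refine (enorm_cv_le _ _ _).trans ?_
    have hfin : (ENNReal.ofReal (((2 : ℝ) ^ (k + s)) ^ d))⁻¹ ≠ ∞ := by
      rw [ENNReal.inv_ne_top, ne_eq, ENNReal.ofReal_eq_zero, not_le]
      positivity
    rw [← mul_assoc, ← lintegral_const_mul' _ _ (by finiteness)]
    refine lintegral_mono fun y => ?_
    rw [← mul_assoc]
    gcongr
    have hws : (fun i => (2 : ℝ) ^ (k + s) * (if i = i₀ then L else L * ρ)) +
        (fun i => (2 : ℝ) ^ (k + s) * (if i = i₀ then L else L * ρ)) =
        fun i => 2 ^ (k + s) * w i := by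
      funext i
      simp only [hw, Pi.add_apply]
      split_ifs <;> ring
    have := (hη (k + s)).enorm_rough_le (h.enorm_kern_sector_le (r := r) (ρ := ρ) hA hbe (k + s))
      (fun i => ?_) (fun i => ?_) (x - y)
    · rw [hws] at this
      refine this.trans_eq ?_
      ring
    · gcongr
      split_ifs <;> linarith
    · split_ifs <;> positivity
  calc _ ≤ ∫⁻ x, (2 * (ENNReal.ofReal A * 2 ^ d)) ^ 2 *
        (∑ k ∈ S, (ENNReal.ofReal (((2 : ℝ) ^ (k + s)) ^ d))⁻¹ *
          ∫⁻ y, (box b (fun i => 2 ^ (k + s) * w i)).indicator 1 (x - y) * ‖B k y‖ₑ) ^ 2 :=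
        lintegral_mono fun x => by
          rw [← mul_pow]
          exact pow_le_pow_left' (hpt x) 2
    _ ≤ (2 * (ENNReal.ofReal A * 2 ^ d)) ^ 2 * (2 * (2 + d) ^ d *
          ENNReal.ofReal (∏ i, (2 * w i)) ^ 2 * M * ∑ k ∈ S, ∫⁻ x, ‖B k x‖ₑ) := by
        rw [lintegral_const_mul' _ _ (by finiteness)]
        gcongr
        exact lintegral_tube_sum_sq_le (fun k => (hB.measurable k).enorm) hB.mass s hw1
    _ = _ := by
        rw [hprod, ENNReal.ofReal_mul (by positivity)]
        ring

end sector

section energy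
open scoped FourierTransform RealInnerProductSpace
variable {d : ℕ}

theorem sq_setLIntegral_le {α : Type*} [MeasurableSpace α] (μ : Measure α) {s : Set α}
    {u : α → ℝ≥0∞} (hu : AEMeasurable u (μ.restrict s)) :
    (∫⁻ x in s, u x ∂μ) ^ 2 ≤ μ s * ∫⁻ x in s, u x ^ 2 ∂μ := by
  have h := ENNReal.lintegral_mul_le_Lp_mul_Lq (μ.restrict s) Real.HolderConjugate.two_two
    (f := fun _ => 1) (g := u) aemeasurable_const hu
  simp only [Pi.mul_apply, one_mul, ENNReal.one_rpow, lintegral_const, Measure.restrict_apply_univ]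
    at h
  calc _ ≤ (μ s ^ (1 / (2 : ℝ)) * (∫⁻ x in s, u x ^ (2 : ℝ) ∂μ) ^ (1 / (2 : ℝ))) ^ 2 :=
        pow_le_pow_left' h 2
    _ = _ := by
        rw [mul_pow, ← ENNReal.rpow_natCast, ← ENNReal.rpow_mul, ← ENNReal.rpow_natCast,
          ← ENNReal.rpow_mul]
        norm_num

theorem lintegral_exp_neg_norm_sq {a : ℝ} (ha : 0 < a) (x : EuclideanSpace ℝ (Fin d)) :
    ∫⁻ y, ENNReal.ofReal (Real.exp (-(2 * a ^ 2)⁻¹ * ‖x - y‖ ^ 2)) =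
      ENNReal.ofReal (a ^ d) * ENNReal.ofReal ((2 * Real.pi) ^ ((d : ℝ) / 2)) := by
  have hb : 0 < (2 * a ^ 2)⁻¹ := by positivity
  rw [lintegral_sub_left_eq_self
    (f := fun y => ENNReal.ofReal (Real.exp (-(2 * a ^ 2)⁻¹ * ‖y‖ ^ 2))),
    ← ofReal_integral_eq_lintegral_ofReal (integrable_exp_neg_mul_norm_sq hb)
      (Eventually.of_forall fun _ => (Real.exp_pos _).le),
    GaussianFourier.integral_rexp_neg_mul_sq_norm hb, ← ENNReal.ofReal_mul (by positivity),
    finrank_euclideanSpace_fin]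
  congr 1
  rw [show Real.pi / (2 * a ^ 2)⁻¹ = a ^ 2 * (2 * Real.pi) by field_simp,
    Real.mul_rpow (by positivity) (by positivity), ← Real.rpow_natCast, ← Real.rpow_mul ha.le,
    ← Real.rpow_natCast a d]
  congr 2
  push_cast
  ring

theorem IsBadFamily.exists_energy_le (d : ℕ) : ∃ C : ℝ≥0∞, C ≠ ∞ ∧
    ∀ (S : Finset ℤ) (B : ℤ → EuclideanSpace ℝ (Fin d) → ℂ) (M : ℝ≥0∞), IsBadFamily S B M →
    ∀ k ∈ S, ∀ a : ℝ, 2 ^ k ≤ a →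
      ∫⁻ ξ, ENNReal.ofReal (((1 + a ^ 2 * ‖ξ‖ ^ 2) ^ (d + 1))⁻¹) * ‖𝓕 (B k) ξ‖ₑ ^ 2 ≤
        C * M * ∫⁻ x, ‖B k x‖ₑ := by
  obtain ⟨C, hC, hCE⟩ := weighted_energy (V := EuclideanSpace ℝ (Fin d))
  rw [finrank_euclideanSpace_fin] at hCE
  set D := ENNReal.ofReal (Real.exp (d ^ 2)) * ENNReal.ofReal ((2 * Real.pi) ^ ((d : ℝ) / 2))
    with hD
  refine ⟨C * D, by finiteness, fun S B M hB k hk a ha => ?_⟩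
  have ha0 : 0 < a := lt_of_lt_of_le (by positivity) ha
  refine (hCE (B k) (hB.integrable k) (hB.measurable k) a ha0 (M * D) fun x => ?_).trans_eq
    (by ring)
  have hm := hB.mass {k} (by simpa using hk) k (by simp)
    (fun y => ENNReal.ofReal (Real.exp (-(a ^ 2)⁻¹ * ‖x - y‖ ^ 2)))
    (fun y => ENNReal.ofReal (Real.exp (d ^ 2)) *
      ENNReal.ofReal (Real.exp (-(2 * a ^ 2)⁻¹ * ‖x - y‖ ^ 2))) (by fun_prop) (by fun_prop) ?_
  · rw [Finset.sum_singleton, lintegral_const_mul _ (by fun_prop),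
      lintegral_exp_neg_norm_sq ha0] at hm
    refine hm.trans_eq ?_
    rw [hD]
    ring
  · intro y z hyz
    rw [← ENNReal.ofReal_mul (Real.exp_pos _).le, ← Real.exp_add]
    apply ENNReal.ofReal_le_ofReal
    rw [Real.exp_le_exp]
    have h1 : ‖x - z‖ ≤ ‖x - y‖ + d * a := by
      refine (norm_sub_le_norm_sub_add_norm_sub x y z).trans ?_
      gcongr
      exact hyz.trans (by gcongr)
    have h2 : ‖x - z‖ ^ 2 ≤ 2 * ‖x - y‖ ^ 2 + 2 * (d * a) ^ 2 := by
      have : 0 ≤ d * a := by positivity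
      nlinarith [sq_nonneg (‖x - y‖ - d * a), norm_nonneg (x - z), norm_nonneg (x - y)]
    have h3 : (2 * a ^ 2)⁻¹ * ‖x - z‖ ^ 2 ≤ (2 * a ^ 2)⁻¹ * (2 * ‖x - y‖ ^ 2 + 2 * (d * a) ^ 2) := by
      gcongr
    have h4 : (2 * a ^ 2)⁻¹ * (2 * ‖x - y‖ ^ 2 + 2 * (d * a) ^ 2) =
        (a ^ 2)⁻¹ * ‖x - y‖ ^ 2 + d ^ 2 := by
      field_simp
    linarith

theorem exists_sq_sum_weight_le (d : ℕ) : ∃ C : ℝ, 0 ≤ C ∧ ∀ (S : Finset ℤ) (u : ℝ), 0 ≤ u →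
    ∀ b : ℤ → ℝ, (∑ k ∈ S, 2 ^ k * u * ((1 + 2 ^ k * u) ^ (d + 3))⁻¹ * b k) ^ 2 ≤
      C * ∑ k ∈ S, ((1 + (2 ^ k * u) ^ 2) ^ (d + 1))⁻¹ * b k ^ 2 := by
  obtain ⟨C, hC, hCS⟩ := exists_sum_min_zpow_le
  refine ⟨C, hC, fun S u hu b => ?_⟩
  refine (Finset.sum_sq_le_sum_mul_sum_of_sq_le_mul S
    (f := fun k => 2 ^ k * u * ((1 + 2 ^ k * u) ^ 2)⁻¹)
    (g := fun k => 2 ^ k * u * ((1 + 2 ^ k * u) ^ (2 * d + 4))⁻¹ * b k ^ 2) (fun k _ => by positivity)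
    (fun k _ => by positivity) fun k _ => ?_).trans ?_
  · have : (1 + 2 ^ k * u) ≠ 0 := by positivity
    refine le_of_eq ?_
    field_simp
    ring
  · refine mul_le_mul ((Finset.sum_le_sum fun k _ => ?_).trans (hCS S u hu))
      (Finset.sum_le_sum fun k _ => ?_) (Finset.sum_nonneg fun k _ => by positivity) hC
    · have hw : 0 ≤ 2 ^ k * u := by positivity
      generalize (2 : ℝ) ^ k * u = w at hw
      refine le_min ?_ ?_
      · exact mul_le_of_le_one_right hw (inv_le_one_of_one_le₀ (by nlinarith))
      · rcases hw.eq_or_lt with rfl | hw0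
        · simp
        · rw [← div_eq_mul_inv, div_le_iff₀ (by positivity), inv_mul_eq_div, le_div_iff₀ hw0]
          nlinarith
    · gcongr
      have hw : 0 ≤ 2 ^ k * u := by positivity
      generalize (2 : ℝ) ^ k * u = w at hw
      rw [← div_eq_mul_inv, div_le_iff₀ (by positivity), inv_mul_eq_div, le_div_iff₀ (by positivity)]
      calc w * (1 + w ^ 2) ^ (d + 1) ≤ (1 + w) ^ 2 * ((1 + w) ^ 2) ^ (d + 1) := by
            gcongr <;> nlinarith
        _ = _ := by rw [← pow_mul, ← pow_add]; congr 1; ring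

end energy

section average
variable {d : ℕ} {ρ : ℝ} {g : sphere (0 : EuclideanSpace ℝ (Fin d)) 1 → ℂ}

theorem measurable_ball_indicator {E : Type*} [Zero E] [MeasurableSpace E]
    {g : sphere (0 : EuclideanSpace ℝ (Fin d)) 1 → E} (hg : Measurable g) (ρ : ℝ) :
    Measurable fun p : EuclideanSpace ℝ (Fin d) × sphere (0 : EuclideanSpace ℝ (Fin d)) 1 =>
      (ball (p.2 : EuclideanSpace ℝ (Fin d)) ρ).indicator (fun _ => g p.2) p.1 := by
  have : (fun p : EuclideanSpace ℝ (Fin d) × sphere (0 : EuclideanSpace ℝ (Fin d)) 1 =>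
      (ball (p.2 : EuclideanSpace ℝ (Fin d)) ρ).indicator (fun _ => g p.2) p.1) =
      {p : EuclideanSpace ℝ (Fin d) × sphere (0 : EuclideanSpace ℝ (Fin d)) 1 |
        dist p.1 p.2 < ρ}.indicator fun p => g p.2 := rfl
  rw [this]
  exact (hg.comp measurable_snd).indicator (measurableSet_lt (by fun_prop) measurable_const)

theorem enorm_ball_indicator (e : EuclideanSpace ℝ (Fin d))
    (θ : sphere (0 : EuclideanSpace ℝ (Fin d)) 1) :
    ‖(ball (θ : EuclideanSpace ℝ (Fin d)) ρ).indicator (fun _ => g θ) e‖ₑ =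
      (ball (θ : EuclideanSpace ℝ (Fin d)) ρ).indicator (fun _ => ‖g θ‖ₑ) e :=
  enorm_indicator_eq_indicator_enorm _ _

theorem lintegral_ball_indicator (c : ℝ≥0∞) (x : EuclideanSpace ℝ (Fin d)) :
    ∫⁻ e, (ball x ρ).indicator (fun _ => c) e =
      volume (ball (0 : EuclideanSpace ℝ (Fin d)) ρ) * c := by
  rw [lintegral_indicator_const measurableSet_ball, Measure.addHaar_ball_center, mul_comm]

theorem integral_integral_ball_indicator (hgm : Measurable g)
    (hg : Integrable g (sphereMeasure d)) :
    ∫ e, (∫ θ, (ball (θ : EuclideanSpace ℝ (Fin d)) ρ).indicator (fun _ => g θ) e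
      ∂(sphereMeasure d)) =
      volume.real (ball (0 : EuclideanSpace ℝ (Fin d)) ρ) * ∫ θ, g θ ∂(sphereMeasure d) := by
  rw [integral_integral_swap]
  · rw [← integral_const_mul]
    refine integral_congr_ae (Eventually.of_forall fun θ => ?_)
    dsimp only
    rw [integral_indicator_const _ measurableSet_ball, measureReal_def,
      Measure.addHaar_ball_center, measureReal_def, Complex.real_smul]
  · refine ⟨(measurable_ball_indicator hgm ρ).aestronglyMeasurable, ?_⟩
    rw [HasFiniteIntegral]
    simp only [Function.uncurry_def]
    rw [lintegral_prod_symm _ (measurable_ball_indicator hgm ρ).enorm.aemeasurable]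
    simp only [enorm_ball_indicator, lintegral_ball_indicator]
    rw [lintegral_const_mul _ hgm.enorm]
    exact ENNReal.mul_lt_top measure_ball_lt_top hg.2

theorem setLIntegral_integral_ball_indicator_le {s : Set (EuclideanSpace ℝ (Fin d))} (hs : MeasurableSet s)
    {u : sphere (0 : EuclideanSpace ℝ (Fin d)) 1 → ℝ≥0∞} (hu : Measurable u)
    (h : ∀ e ∈ s, ∀ θ : sphere (0 : EuclideanSpace ℝ (Fin d)) 1,
      dist e (θ : EuclideanSpace ℝ (Fin d)) < ρ → ‖g θ‖ₑ ≤ u θ) :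
    ∫⁻ e in s, ‖∫ θ, (ball (θ : EuclideanSpace ℝ (Fin d)) ρ).indicator (fun _ => g θ) e
      ∂(sphereMeasure d)‖ₑ ≤
      volume (ball (0 : EuclideanSpace ℝ (Fin d)) ρ) * ∫⁻ θ, u θ ∂(sphereMeasure d) := by
  calc _ ≤ ∫⁻ e in s, ∫⁻ θ, (ball (θ : EuclideanSpace ℝ (Fin d)) ρ).indicator (fun _ => u θ) e
          ∂(sphereMeasure d) := by
        refine setLIntegral_mono' hs fun e he => ?_
        refine (enorm_integral_le_lintegral_enorm _).trans (lintegral_mono fun θ => ?_)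
        rw [enorm_ball_indicator]
        by_cases hd : e ∈ ball (θ : EuclideanSpace ℝ (Fin d)) ρ
        · rw [Set.indicator_of_mem hd, Set.indicator_of_mem hd]
          exact h e he θ hd
        · rw [Set.indicator_of_notMem hd, Set.indicator_of_notMem hd]
    _ ≤ ∫⁻ e, ∫⁻ θ, (ball (θ : EuclideanSpace ℝ (Fin d)) ρ).indicator (fun _ => u θ) e
          ∂(sphereMeasure d) := setLIntegral_le_lintegral _ _
    _ = _ := by
        rw [lintegral_lintegral_swap (measurable_ball_indicator hu ρ).aemeasurable]
        simp only [lintegral_ball_indicator]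
        exact lintegral_const_mul _ hu

end average

section roughSum
open scoped FourierTransform RealInnerProductSpace
variable {d : ℕ} {r L ρ A : ℝ} {Ξ : ℝ → ℝ} {Ω : EuclideanSpace ℝ (Fin d) → ℝ} {s : ℤ}
  {S : Finset ℤ} {η B : ℤ → EuclideanSpace ℝ (Fin d) → ℂ} {C M : ℝ≥0∞}

/-- The sum of the mollification errors of the kernels at scale `2 ^ (k + s)` applied to the bad
functions of scale `2 ^ k`. -/
def roughSum (r : ℝ) (ψ : ℝ → ℝ) (Ω : EuclideanSpace ℝ (Fin d) → ℝ) (S : Finset ℤ) (s : ℤ)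
    (η B : ℤ → EuclideanSpace ℝ (Fin d) → ℂ) (x : EuclideanSpace ℝ (Fin d)) : ℂ :=
  ∑ k ∈ S, cv (rough (kern r ψ Ω (k + s)) (η (k + s))) (B k) x

/-- The contribution of the direction `θ` to the Fourier transform of `roughSum`. -/
def symb (r : ℝ) (ψ : ℝ → ℝ) (S : Finset ℤ) (s : ℤ) (η B : ℤ → EuclideanSpace ℝ (Fin d) → ℂ)
    (θ ξ : EuclideanSpace ℝ (Fin d)) : ℂ :=
  ∑ k ∈ S, Complex.exp (-(Complex.I * r * Real.log (2 ^ (k + s)))) *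
    𝓕 (hprof r ψ) (2 ^ (k + s) * ⟪θ, ξ⟫) * ((1 - 𝓕 (η (k + s)) ξ) * 𝓕 (B k) ξ)

theorem integrable_mul_continuous {g : sphere (0 : EuclideanSpace ℝ (Fin d)) 1 → ℂ}
    {φ : sphere (0 : EuclideanSpace ℝ (Fin d)) 1 → ℂ} (hg : Integrable g (sphereMeasure d))
    (hφ : Continuous φ) : Integrable (fun θ => g θ * φ θ) (sphereMeasure d) := by
  obtain ⟨D, hD⟩ := isCompact_univ.exists_bound_of_continuousOn hφ.continuousOn
  exact hg.mul_bdd (c := D) hφ.aestronglyMeasurable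
    (Eventually.of_forall fun θ => hD θ (Set.mem_univ θ))

theorem IsCutoff.integrable_kern (h : IsCutoff L Ξ) (hd : 1 ≤ d) (hΩ : Measurable Ω)
    (hom : IsHomogZero Ω) (hi : Integrable (fun θ : sphere (0 : EuclideanSpace ℝ (Fin d)) 1 => Ω θ)
      (sphereMeasure d)) (j : ℤ) : Integrable (kern r (bump Ξ) Ω j) :=
  ⟨(h.measurable_kern hΩ j).aestronglyMeasurable, (h.lintegral_kern_le hd hΩ hom j).trans_lt
    (ENNReal.mul_lt_top ENNReal.ofReal_lt_top hi.2)⟩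

theorem integrable_sphere_of_bounded (hΩ : Measurable Ω) (hA : ∀ x, |Ω x| ≤ A) :
    Integrable (fun θ : sphere (0 : EuclideanSpace ℝ (Fin d)) 1 => Ω θ) (sphereMeasure d) :=
  Integrable.of_bound (hΩ.comp measurable_subtype_coe).aestronglyMeasurable A (Eventually.of_forall fun _ => hA _)

theorem continuous_symb (h : IsCutoff L Ξ) (r : ℝ) (s : ℤ) (hη : ∀ j, Integrable (η j))
    (hB : ∀ k, Integrable (B k)) :
    Continuous fun p : EuclideanSpace ℝ (Fin d) × EuclideanSpace ℝ (Fin d) =>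
      symb r (bump Ξ) S s η B p.1 p.2 := by
  unfold symb
  refine continuous_finsetSum _ fun k _ => ?_
  have h1 : Continuous (𝓕 (hprof r (bump Ξ))) := fourier_continuous (h.integrable_hprof r)
  have h2 := fourier_continuous (hη (k + s))
  have h3 := fourier_continuous (hB k)
  fun_prop

theorem integrable_roughSum (h : IsCutoff L Ξ) (hd : 1 ≤ d) (hΩ : Measurable Ω)
    (hom : IsHomogZero Ω) (hA : ∀ x, |Ω x| ≤ A) {t : ℤ → ℝ} (hη : ∀ j, IsMollifier C (t j) (η j))
    (hB : IsBadFamily S B M) : Integrable (roughSum r (bump Ξ) Ω S s η B) := by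
  refine integrable_finsetSum _ fun k _ => integrable_cv ((hη _).integrable_rough ?_)
    (hB.integrable k)
  exact h.integrable_kern hd hΩ hom (integrable_sphere_of_bounded hΩ hA) _

theorem exists_norm_roughSum_le (h : IsCutoff L Ξ) (hA : ∀ x, |Ω x| ≤ A) {t : ℤ → ℝ}
    (hη : ∀ j, IsMollifier C (t j) (η j)) (hB : IsBadFamily S B M) :
    ∃ D, ∀ x, ‖roughSum r (bump Ξ) Ω S s η B x‖ ≤ D := by
  refine ⟨∑ k ∈ S, 2 * (A * (2 ^ d * ((2 ^ (k + s)) ^ d)⁻¹)) * ∫ y, ‖B k y‖, fun x => ?_⟩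
  refine (norm_sum_le _ _).trans (Finset.sum_le_sum fun k _ => ?_)
  refine norm_cv_le_left (fun x => (hη _).norm_rough_le (fun x => ?_) x) (hB.integrable k) x
  refine (h.norm_kern_le _ x).trans ?_
  gcongr
  exact hA x

theorem fourier_roughSum (h : IsCutoff L Ξ) (hd : 1 ≤ d) (hΩ : Measurable Ω)
    (hom : IsHomogZero Ω) (hA : ∀ x, |Ω x| ≤ A) {t : ℤ → ℝ} (hη : ∀ j, IsMollifier C (t j) (η j))
    (hB : IsBadFamily S B M) (ξ : EuclideanSpace ℝ (Fin d)) :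
    𝓕 (roughSum r (bump Ξ) Ω S s η B) ξ =
      ∫ θ : sphere (0 : EuclideanSpace ℝ (Fin d)) 1, (Ω θ : ℂ) * symb r (bump Ξ) S s η B θ ξ
        ∂(sphereMeasure d) := by
  have hi := integrable_sphere_of_bounded hΩ hA
  have hk := fun j => h.integrable_kern (r := r) hd hΩ hom hi j
  have h1 : Continuous (𝓕 (hprof r (bump Ξ))) := fourier_continuous (h.integrable_hprof r)
  unfold roughSum symb
  rw [fourier_sum_apply _ fun k _ => integrable_cv ((hη _).integrable_rough (hk _))
    (hB.integrable k)]
  simp only [Finset.mul_sum]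
  refine Eq.trans (Finset.sum_congr rfl fun k _ => ?_) (integral_finsetSum S fun k _ =>
    integrable_mul_continuous hi.ofReal (φ := fun θ => Complex.exp (-(Complex.I * r *
      Real.log (2 ^ (k + s)))) * 𝓕 (hprof r (bump Ξ)) (2 ^ (k + s) * ⟪(θ : EuclideanSpace ℝ (Fin d)),
        ξ⟫) * ((1 - 𝓕 (η (k + s)) ξ) * 𝓕 (B k) ξ)) (by fun_prop)).symm
  rw [fourier_cv ((hη _).integrable_rough (hk _)) (hB.integrable k), (hη _).fourier_rough (hk _),
    h.fourier_kern hd hom _ (hk _), mul_assoc, ← integral_mul_const]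
  refine integral_congr_ae (Eventually.of_forall fun θ => ?_)
  dsimp only
  ring

theorem norm_symb_le {N : ℕ} {D : ℝ} (hD : 0 ≤ D)
    (hH : ∀ u, ‖𝓕 (hprof r (bump Ξ)) u‖ ≤ D * ((1 + |u|) ^ N)⁻¹)
    (hρ : 0 < ρ) (hη : ∀ j, IsMollifier C (2 ^ j * ρ ^ 2) (η j))
    {θ ξ : EuclideanSpace ℝ (Fin d)} (hθ : ρ * ‖ξ‖ ≤ |⟪θ, ξ⟫|) :
    ‖symb r (bump Ξ) S s η B θ ξ‖ ≤ D * (2 * Real.pi * ρ) * ∑ k ∈ S, 2 ^ k * (2 ^ s * ρ * ‖ξ‖) *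
      ((1 + 2 ^ k * (2 ^ s * ρ * ‖ξ‖)) ^ N)⁻¹ * ‖𝓕 (B k) ξ‖ := by
  rw [symb, Finset.mul_sum]
  refine (norm_sum_le _ _).trans (Finset.sum_le_sum fun k _ => ?_)
  have h2 : (2 : ℝ) ^ (k + s) = 2 ^ k * 2 ^ s := zpow_add₀ two_ne_zero _ _
  rw [norm_mul, norm_mul, norm_mul, norm_cexp_neg_I_mul, one_mul]
  have e1 : ‖𝓕 (hprof r (bump Ξ)) (2 ^ (k + s) * ⟪θ, ξ⟫)‖ ≤
      D * ((1 + 2 ^ k * (2 ^ s * ρ * ‖ξ‖)) ^ N)⁻¹ := by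
    refine (hH _).trans ?_
    gcongr
    rw [abs_mul, abs_of_pos (by positivity : (0 : ℝ) < 2 ^ (k + s)), h2]
    calc (2 : ℝ) ^ k * (2 ^ s * ρ * ‖ξ‖) = 2 ^ k * 2 ^ s * (ρ * ‖ξ‖) := by ring
      _ ≤ _ := by gcongr
  have e2 : ‖1 - 𝓕 (η (k + s)) ξ‖ ≤ 2 * Real.pi * ρ * (2 ^ k * (2 ^ s * ρ * ‖ξ‖)) := by
    refine ((hη (k + s)).fourier_le ξ).trans_eq ?_
    rw [h2]
    ring
  calc _ ≤ D * ((1 + 2 ^ k * (2 ^ s * ρ * ‖ξ‖)) ^ N)⁻¹ *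
        (2 * Real.pi * ρ * (2 ^ k * (2 ^ s * ρ * ‖ξ‖)) * ‖𝓕 (B k) ξ‖) := by gcongr
    _ = _ := by ring

theorem ofReal_sq_le (x : ℝ) : ENNReal.ofReal x ^ 2 ≤ ENNReal.ofReal (x ^ 2) := by
  rcases le_total 0 x with hx | hx
  · rw [ENNReal.ofReal_pow hx]
  · simp [ENNReal.ofReal_of_nonpos hx]

theorem exists_lintegral_weight_sq_le (d : ℕ) : ∃ C : ℝ≥0∞, C ≠ ∞ ∧
    ∀ (S : Finset ℤ) (B : ℤ → EuclideanSpace ℝ (Fin d) → ℂ) (M : ℝ≥0∞), IsBadFamily S B M →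
    ∀ (s : ℤ) (ρ : ℝ), 0 < ρ → 1 ≤ 2 ^ s * ρ → ∀ D : ℝ,
      ∫⁻ ξ, ENNReal.ofReal (D * ∑ k ∈ S, 2 ^ k * (2 ^ s * ρ * ‖ξ‖) *
        ((1 + 2 ^ k * (2 ^ s * ρ * ‖ξ‖)) ^ (d + 3))⁻¹ * ‖𝓕 (B k) ξ‖) ^ 2 ≤
      C * (ENNReal.ofReal (D ^ 2) * M * ∑ k ∈ S, ∫⁻ x, ‖B k x‖ₑ) := by
  obtain ⟨C₁, hC₁, h1⟩ := IsBadFamily.exists_energy_le d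
  obtain ⟨C₂, hC₂', h2⟩ := exists_sq_sum_weight_le d
  refine ⟨ENNReal.ofReal C₂ * C₁, by finiteness, fun S B M hB s ρ hρ hs D => ?_⟩
  have hF : ∀ k, Measurable fun ξ => ‖𝓕 (B k) ξ‖ₑ := fun k =>
    (fourier_continuous (hB.integrable k)).measurable.enorm
  calc _ ≤ ∫⁻ ξ, ENNReal.ofReal (D ^ 2) * (ENNReal.ofReal C₂ * ∑ k ∈ S,
        ENNReal.ofReal (((1 + (2 ^ k * (2 ^ s * ρ)) ^ 2 * ‖ξ‖ ^ 2) ^ (d + 1))⁻¹) *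
          ‖𝓕 (B k) ξ‖ₑ ^ 2) := by
        refine lintegral_mono fun ξ => ?_
        dsimp only
        simp only [← ofReal_norm]
        have hw : ∀ k : ℤ, (2 ^ k * (2 ^ s * ρ * ‖ξ‖)) ^ 2 = (2 ^ k * (2 ^ s * ρ)) ^ 2 * ‖ξ‖ ^ 2 :=
          fun k => by ring
        have h3 := h2 S (2 ^ s * ρ * ‖ξ‖) (by positivity) fun k => ‖𝓕 (B k) ξ‖
        simp only [hw] at h3
        refine (ofReal_sq_le _).trans ?_
        rw [mul_pow, ENNReal.ofReal_mul (sq_nonneg D)]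
        gcongr
        refine (ENNReal.ofReal_le_ofReal h3).trans_eq ?_
        rw [ENNReal.ofReal_mul hC₂', ENNReal.ofReal_sum_of_nonneg fun k _ => by positivity]
        congr 1
        refine Finset.sum_congr rfl fun k _ => ?_
        rw [ENNReal.ofReal_mul (by positivity), ENNReal.ofReal_pow (norm_nonneg _)]
    _ = ENNReal.ofReal (D ^ 2) * (ENNReal.ofReal C₂ * ∑ k ∈ S, ∫⁻ ξ,
        ENNReal.ofReal (((1 + (2 ^ k * (2 ^ s * ρ)) ^ 2 * ‖ξ‖ ^ 2) ^ (d + 1))⁻¹) *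
          ‖𝓕 (B k) ξ‖ₑ ^ 2) := by
        rw [lintegral_const_mul' _ _ (by finiteness), lintegral_const_mul' _ _ (by finiteness),
          lintegral_finsetSum]
        intro k _
        have := hF k
        fun_prop
    _ ≤ ENNReal.ofReal (D ^ 2) * (ENNReal.ofReal C₂ * ∑ k ∈ S, C₁ * M * ∫⁻ x, ‖B k x‖ₑ) := by
        gcongr with k hk
        refine h1 S B M hB k hk _ ?_
        exact le_mul_of_one_le_right (by positivity) hs
    _ = _ := by
        rw [← Finset.mul_sum]
        ring

end roughSum

section directional
open scoped FourierTransform RealInnerProductSpace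
variable {d : ℕ} {r L ρ A : ℝ} {Ξ : ℝ → ℝ} {Ω : EuclideanSpace ℝ (Fin d) → ℝ} {s : ℤ}
  {S : Finset ℤ} {η B : ℤ → EuclideanSpace ℝ (Fin d) → ℂ} {C M : ℝ≥0∞}

theorem ennreal_add_sq_le (a b : ℝ≥0∞) : (a + b) ^ 2 ≤ 2 * a ^ 2 + 2 * b ^ 2 := by
  have := ENNReal.rpow_add_le_mul_rpow_add_rpow a b (p := 2) (by norm_num)
  norm_num at this
  rwa [mul_add] at this

/-- The average of `g` against balls of radius `ρ`, split according to the directions that are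
nearly orthogonal to `ω`. -/
theorem sq_volume_ball_mul_le {g : sphere (0 : EuclideanSpace ℝ (Fin d)) 1 → ℂ}
    (hgm : Measurable g) (hg : Integrable g (sphereMeasure d)) {ω : EuclideanSpace ℝ (Fin d)}
    (hω : ‖ω‖ = 1) {u : sphere (0 : EuclideanSpace ℝ (Fin d)) 1 → ℝ≥0∞} (hu : Measurable u)
    (h : ∀ θ : sphere (0 : EuclideanSpace ℝ (Fin d)) 1,
      ρ ≤ |⟪(θ : EuclideanSpace ℝ (Fin d)), ω⟫| → ‖g θ‖ₑ ≤ u θ) {N : ℝ≥0∞}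
    (hN : volume ({e | |⟪e, ω⟫| ≤ 2 * ρ} ∩
      {e : EuclideanSpace ℝ (Fin d) | 1 - ρ < ‖e‖ ∧ ‖e‖ < 1 + ρ}) ≤ N) :
    (volume (ball (0 : EuclideanSpace ℝ (Fin d)) ρ) * ‖∫ θ, g θ ∂(sphereMeasure d)‖ₑ) ^ 2 ≤
      2 * (N * ∫⁻ e in {e : EuclideanSpace ℝ (Fin d) | 1 - ρ < ‖e‖ ∧ ‖e‖ < 1 + ρ},
        ‖∫ θ, (ball (θ : EuclideanSpace ℝ (Fin d)) ρ).indicator (fun _ => g θ) e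
          ∂(sphereMeasure d)‖ₑ ^ 2) +
      2 * (volume (ball (0 : EuclideanSpace ℝ (Fin d)) ρ) * ∫⁻ θ, u θ ∂(sphereMeasure d)) ^ 2 := by
  set G : EuclideanSpace ℝ (Fin d) → ℂ := fun e =>
    ∫ θ, (ball (θ : EuclideanSpace ℝ (Fin d)) ρ).indicator (fun _ => g θ) e ∂(sphereMeasure d)
  have hGm : Measurable fun e => ‖G e‖ₑ :=
    ((measurable_ball_indicator hgm ρ).stronglyMeasurable.integral_prod_right').measurable.enorm
  set T : Set (EuclideanSpace ℝ (Fin d)) := {e | |⟪e, ω⟫| ≤ 2 * ρ} with hT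
  set R : Set (EuclideanSpace ℝ (Fin d)) := {e | 1 - ρ < ‖e‖ ∧ ‖e‖ < 1 + ρ} with hR
  have hTm : MeasurableSet T := measurableSet_le (by fun_prop) measurable_const
  have hRm : MeasurableSet R :=
    (measurableSet_lt measurable_const measurable_norm).inter
      (measurableSet_lt measurable_norm measurable_const)
  have hG0 : ∀ e ∉ R, G e = 0 := fun e he => by
    refine (integral_congr_ae (Eventually.of_forall fun θ => ?_)).trans (integral_zero _ _)
    refine Set.indicator_of_notMem (fun hθ => he ?_) _
    rw [mem_ball, dist_eq_norm] at hθ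
    have h1 := abs_norm_sub_norm_le e (θ : EuclideanSpace ℝ (Fin d))
    rw [norm_eq_of_mem_sphere] at h1
    have := abs_lt.1 (h1.trans_lt hθ)
    exact ⟨by linarith, by linarith⟩
  have e1 : volume (ball (0 : EuclideanSpace ℝ (Fin d)) ρ) * ‖∫ θ, g θ ∂(sphereMeasure d)‖ₑ ≤
      (∫⁻ e in T, ‖G e‖ₑ) + ∫⁻ e in Tᶜ, ‖G e‖ₑ := by
    rw [lintegral_add_compl _ hTm]
    refine le_trans (le_of_eq ?_) (enorm_integral_le_lintegral_enorm _)
    rw [integral_integral_ball_indicator hgm hg, enorm_mul, measureReal_def]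
    congr 1
    rw [← ofReal_norm, Complex.norm_real, Real.norm_of_nonneg ENNReal.toReal_nonneg,
      ENNReal.ofReal_toReal measure_ball_lt_top.ne]
  have e2 : (∫⁻ e in T, ‖G e‖ₑ) ^ 2 ≤ N * ∫⁻ e in R, ‖G e‖ₑ ^ 2 := by
    have : ∫⁻ e in T, ‖G e‖ₑ = ∫⁻ e in T ∩ R, ‖G e‖ₑ := by
      rw [Set.inter_comm, ← Measure.restrict_restrict hRm, ← lintegral_indicator hRm]
      refine lintegral_congr fun e => ?_
      by_cases he : e ∈ R
      · rw [Set.indicator_of_mem he]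
      · rw [Set.indicator_of_notMem he, hG0 e he, enorm_zero]
    rw [this]
    refine (sq_setLIntegral_le _ hGm.aemeasurable).trans ?_
    gcongr
    exact Set.inter_subset_right
  have e3 : ∫⁻ e in Tᶜ, ‖G e‖ₑ ≤
      volume (ball (0 : EuclideanSpace ℝ (Fin d)) ρ) * ∫⁻ θ, u θ ∂(sphereMeasure d) := by
    refine setLIntegral_integral_ball_indicator_le hTm.compl hu fun e he θ hθ => h θ ?_
    rw [hT, Set.mem_compl_iff, Set.mem_ofPred_eq, not_le] at he
    have h1 : |⟪e - θ, ω⟫| ≤ ρ := by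
      refine (abs_real_inner_le_norm _ _).trans ?_
      rw [hω, mul_one, ← dist_eq_norm]
      exact hθ.le
    have h2 : ⟪e, ω⟫ = ⟪e - θ, ω⟫ + ⟪(θ : EuclideanSpace ℝ (Fin d)), ω⟫ := by
      rw [← inner_add_left, _root_.sub_add_cancel]
    have h3 := abs_add_le ⟪e - θ, ω⟫ ⟪(θ : EuclideanSpace ℝ (Fin d)), ω⟫
    rw [h2] at he
    linarith
  calc _ ≤ ((∫⁻ e in T, ‖G e‖ₑ) + ∫⁻ e in Tᶜ, ‖G e‖ₑ) ^ 2 := by gcongr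
    _ ≤ _ := ennreal_add_sq_le _ _
    _ ≤ _ := by gcongr

theorem measurable_norm_sq_integral_indicator (hΩ : Measurable Ω)
    {Φ : EuclideanSpace ℝ (Fin d) → EuclideanSpace ℝ (Fin d) → ℂ}
    (hΦ : Continuous fun p : EuclideanSpace ℝ (Fin d) × EuclideanSpace ℝ (Fin d) => Φ p.1 p.2) :
    Measurable fun p : EuclideanSpace ℝ (Fin d) × EuclideanSpace ℝ (Fin d) =>
      ‖∫ θ : sphere (0 : EuclideanSpace ℝ (Fin d)) 1,
        (ball (θ : EuclideanSpace ℝ (Fin d)) ρ).indicator (fun _ => (Ω θ : ℂ) * Φ θ p.2) p.1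
          ∂(sphereMeasure d)‖ₑ ^ 2 := by
  refine Measurable.pow_const (Measurable.enorm (StronglyMeasurable.measurable ?_)) 2
  refine StronglyMeasurable.integral_prod_right' (f := fun q :
    (EuclideanSpace ℝ (Fin d) × EuclideanSpace ℝ (Fin d)) ×
      sphere (0 : EuclideanSpace ℝ (Fin d)) 1 => (ball (q.2 : EuclideanSpace ℝ (Fin d)) ρ).indicator
        (fun _ => (Ω q.2 : ℂ) * Φ q.2 q.1.2) q.1.1) (Measurable.stronglyMeasurable ?_)
  have h1 : Measurable fun q : (EuclideanSpace ℝ (Fin d) × EuclideanSpace ℝ (Fin d)) ×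
      sphere (0 : EuclideanSpace ℝ (Fin d)) 1 => (Ω q.2 : ℂ) * Φ q.2 q.1.2 := by
    have h2 : Measurable fun q : (EuclideanSpace ℝ (Fin d) × EuclideanSpace ℝ (Fin d)) ×
        sphere (0 : EuclideanSpace ℝ (Fin d)) 1 => Φ q.2 q.1.2 := by
      have : Continuous fun q : (EuclideanSpace ℝ (Fin d) × EuclideanSpace ℝ (Fin d)) ×
        sphere (0 : EuclideanSpace ℝ (Fin d)) 1 => Φ q.2 q.1.2 :=
        hΦ.comp (f := fun q : (EuclideanSpace ℝ (Fin d) × EuclideanSpace ℝ (Fin d)) ×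
          sphere (0 : EuclideanSpace ℝ (Fin d)) 1 =>
            ((q.2 : EuclideanSpace ℝ (Fin d)), q.1.2)) (by fun_prop)
      exact this.measurable
    refine Measurable.mul (Complex.measurable_ofReal.comp (hΩ.comp ?_)) h2
    exact measurable_subtype_coe.comp measurable_snd
  exact h1.indicator (s := {q : (EuclideanSpace ℝ (Fin d) × EuclideanSpace ℝ (Fin d)) ×
      sphere (0 : EuclideanSpace ℝ (Fin d)) 1 | dist q.1.1 q.2 < ρ})
    (measurableSet_lt (by fun_prop) measurable_const)

theorem integral_indicator_eq_fourier_roughSum (h : IsCutoff L Ξ) (hd : 1 ≤ d) (hΩ : Measurable Ω)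
    (hom : IsHomogZero Ω) (hA : ∀ x, |Ω x| ≤ A) {t : ℤ → ℝ} (hη : ∀ j, IsMollifier C (t j) (η j))
    (hB : IsBadFamily S B M) (e ξ : EuclideanSpace ℝ (Fin d)) :
    ∫ θ : sphere (0 : EuclideanSpace ℝ (Fin d)) 1, (ball (θ : EuclideanSpace ℝ (Fin d)) ρ).indicator
      (fun _ => (Ω θ : ℂ) * symb r (bump Ξ) S s η B θ ξ) e ∂(sphereMeasure d) =
      𝓕 (roughSum r (bump Ξ) (sector ρ e Ω) S s η B) ξ := by
  rw [fourier_roughSum h hd (measurable_sector ρ e hΩ) (hom.sector ρ e) (abs_sector_le hA) hη hB]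
  refine integral_congr_ae (Eventually.of_forall fun θ => ?_)
  dsimp only
  rw [sector_sphere]
  by_cases hθ : e ∈ ball (θ : EuclideanSpace ℝ (Fin d)) ρ
  · simp only [Set.indicator_of_mem hθ]
  · simp only [Set.indicator_of_notMem hθ, Complex.ofReal_zero, zero_mul]

set_option maxHeartbeats 1000000 in
/-- The `L²` estimate for the rough part of the kernels acting on bad functions. -/
theorem IsCutoff.exists_roughSum_sq_le (h : IsCutoff L Ξ) (hd : 1 ≤ d) (r : ℝ) :
    ∃ C : ℝ≥0∞, C ≠ ∞ ∧ ∀ (Ω : EuclideanSpace ℝ (Fin d) → ℝ) (A : ℝ), Measurable Ω →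
      IsHomogZero Ω → (∀ x, |Ω x| ≤ A) → ∀ (S : Finset ℤ)
      (B : ℤ → EuclideanSpace ℝ (Fin d) → ℂ) (M : ℝ≥0∞), IsBadFamily S B M → ∀ (s : ℤ) (ρ : ℝ),
      0 < ρ → ρ ≤ 1 → 1 ≤ 2 ^ s * ρ → ∀ (C' : ℝ≥0∞) (η : ℤ → EuclideanSpace ℝ (Fin d) → ℂ),
      (∀ j, IsMollifier C' (2 ^ j * ρ ^ 2) (η j)) →
      ∫⁻ x, ‖roughSum r (bump Ξ) Ω S s η B x‖ₑ ^ 2 ≤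
        C * (ENNReal.ofReal A ^ 2 * ENNReal.ofReal ρ * M * ∑ k ∈ S, ∫⁻ x, ‖B k x‖ₑ) := by
  obtain ⟨Ca, hCa, hann⟩ := exists_volume_annulus_le hd
  obtain ⟨Cw, hCw, hw⟩ := exists_lintegral_weight_sq_le d
  obtain ⟨D, hD, hH⟩ := h.exists_fourier_le r (d + 3)
  set W := volume (ball (0 : EuclideanSpace ℝ (Fin d)) 1) with hW
  have hW0 : W ≠ 0 := (measure_ball_pos volume _ one_pos).ne'
  have hWt : W ≠ ∞ := measure_ball_lt_top.ne
  set σ := sphereMeasure d Set.univ with hσ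
  have hσt : σ ≠ ∞ := measure_ne_top _ _
  set Ct : ℝ≥0∞ := 8 * (2 ^ d) ^ 2 * (2 + d) ^ d * ENNReal.ofReal ((4 * L) ^ d) ^ 2 with hCt
  set Cq : ℝ≥0∞ := ENNReal.ofReal ((D * (2 * Real.pi)) ^ 2) * Cw
  refine ⟨2 * Ca ^ 2 * Ct * (W⁻¹) ^ 2 + 2 * σ ^ 2 * Cq, by finiteness, fun Ω A hΩ hom hA S B M hB s ρ
    hρ hρ1 hs C' η hη => ?_⟩
  set b := ∑ k ∈ S, ∫⁻ x, ‖B k x‖ₑ with hb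
  set R : Set (EuclideanSpace ℝ (Fin d)) := {e | 1 - ρ < ‖e‖ ∧ ‖e‖ < 1 + ρ} with hR
  have hRm : MeasurableSet R :=
    (measurableSet_lt measurable_const measurable_norm).inter
      (measurableSet_lt measurable_norm measurable_const)
  set G : EuclideanSpace ℝ (Fin d) → EuclideanSpace ℝ (Fin d) → ℝ≥0∞ := fun e ξ =>
    ‖∫ θ : sphere (0 : EuclideanSpace ℝ (Fin d)) 1,
      (ball (θ : EuclideanSpace ℝ (Fin d)) ρ).indicator
        (fun _ => (Ω θ : ℂ) * symb r (bump Ξ) S s η B θ ξ) e ∂(sphereMeasure d)‖ₑ ^ 2 with hG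
  set Q : EuclideanSpace ℝ (Fin d) → ℝ≥0∞ := fun ξ =>
    ENNReal.ofReal (D * (2 * Real.pi * ρ) * ∑ k ∈ S, 2 ^ k * (2 ^ s * ρ * ‖ξ‖) *
      ((1 + 2 ^ k * (2 ^ s * ρ * ‖ξ‖)) ^ (d + 3))⁻¹ * ‖𝓕 (B k) ξ‖) with hQ
  have hsymb := continuous_symb (S := S) h r s (fun j => (hη j).integrable) hB.integrable
  have hGm : Measurable fun p : EuclideanSpace ℝ (Fin d) × EuclideanSpace ℝ (Fin d) => G p.1 p.2 :=
    measurable_norm_sq_integral_indicator hΩ hsymb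
  have hi := integrable_sphere_of_bounded hΩ hA
  set V := volume (ball (0 : EuclideanSpace ℝ (Fin d)) ρ) with hV
  have hVeq : V = ENNReal.ofReal ρ ^ d * W := by
    rw [hV, hW, ← mul_one ρ, Measure.addHaar_ball_mul_of_pos _ _ hρ, finrank_euclideanSpace_fin,
      ENNReal.ofReal_pow hρ.le, mul_one]
  have hR0 : ENNReal.ofReal ρ ≠ 0 := (ENNReal.ofReal_pos.2 hρ).ne'
  have hV0 : V ≠ 0 := (measure_ball_pos volume _ hρ).ne'
  have hVt : V ≠ ∞ := measure_ball_lt_top.ne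
  have hpt : ∀ ξ ≠ 0, (V * ‖𝓕 (roughSum r (bump Ξ) Ω S s η B) ξ‖ₑ) ^ 2 ≤
      2 * (Ca * ENNReal.ofReal ρ ^ 2 * ∫⁻ e in R, G e ξ) +
        2 * (V * (ENNReal.ofReal A * σ)) ^ 2 * Q ξ ^ 2 := by
    intro ξ hξ
    have hξ' : 0 < ‖ξ‖ := norm_pos_iff.2 hξ
    have hω : ‖‖ξ‖⁻¹ • ξ‖ = 1 := by
      rw [norm_smul, norm_inv, norm_norm, inv_mul_cancel₀ hξ'.ne']
    have hφ : Continuous fun θ : sphere (0 : EuclideanSpace ℝ (Fin d)) 1 =>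
        symb r (bump Ξ) S s η B θ ξ :=
      hsymb.comp (f := fun θ : sphere (0 : EuclideanSpace ℝ (Fin d)) 1 =>
        ((θ : EuclideanSpace ℝ (Fin d)), ξ)) (by fun_prop)
    have hgm : Measurable fun θ : sphere (0 : EuclideanSpace ℝ (Fin d)) 1 =>
        (Ω θ : ℂ) * symb r (bump Ξ) S s η B θ ξ :=
      (Complex.measurable_ofReal.comp (hΩ.comp measurable_subtype_coe)).mul hφ.measurable
    have hgi := integrable_mul_continuous hi.ofReal hφ
    rw [fourier_roughSum h hd hΩ hom hA hη hB]
    refine (sq_volume_ball_mul_le (g := fun θ => (Ω θ : ℂ) *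
      symb r (bump Ξ) S s η B θ ξ) (u := fun θ => ENNReal.ofReal A * Q ξ)
      hgm hgi hω measurable_const (fun θ hθ => ?_) ((hann ρ hρ hρ1).2 _ hω)).trans_eq ?_
    · rw [enorm_mul]
      gcongr
      · rw [← ofReal_norm, Complex.norm_real]
        exact ENNReal.ofReal_le_ofReal (hA _)
      · rw [← ofReal_norm]
        refine ENNReal.ofReal_le_ofReal (norm_symb_le hD hH hρ hη ?_)
        rw [real_inner_smul_right, abs_mul, abs_of_pos (inv_pos.2 hξ')] at hθ
        calc ρ * ‖ξ‖ ≤ ‖ξ‖⁻¹ * |⟪(θ : EuclideanSpace ℝ (Fin d)), ξ⟫| * ‖ξ‖ := by gcongr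
          _ = _ := by field_simp
    · rw [lintegral_const]
      ring
  have hGint : ∫⁻ ξ, ∫⁻ e in R, G e ξ ≤ Ca * ENNReal.ofReal ρ *
      (Ct * (ENNReal.ofReal A ^ 2 * (ENNReal.ofReal ρ ^ (d - 1)) ^ 2 * M * b)) := by
    rw [lintegral_lintegral_swap (f := fun ξ e => G e ξ) (μ := volume) (ν := volume.restrict R)
      (hGm.comp measurable_swap).aemeasurable]
    refine le_trans (setLIntegral_mono_ae measurable_const.aemeasurable (g := fun _ =>
      (Ct * (ENNReal.ofReal A ^ 2 * (ENNReal.ofReal ρ ^ (d - 1)) ^ 2 * M * b)))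
      (Eventually.of_forall fun e he => ?_)) ?_
    · have he0 : e ≠ 0 := by
        rintro rfl
        have := he.1
        rw [norm_zero] at this
        linarith
      simp only [hG, integral_indicator_eq_fourier_roughSum h hd hΩ hom hA hη hB]
      obtain ⟨E, hE⟩ := exists_norm_roughSum_le (r := r) (s := s) h (abs_sector_le (ρ := ρ) (e := e) hA)
        hη hB
      rw [lintegral_fourier_sq (integrable_roughSum h hd (measurable_sector ρ e hΩ)
        (hom.sector ρ e) (abs_sector_le hA) hη hB) hE, ← ENNReal.ofReal_pow hρ.le]
      exact lintegral_sum_rough_sector_sq_le hd h hA hB hρ hρ1 hs hη he0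
    · rw [lintegral_const, Measure.restrict_apply_univ, mul_comm]
      gcongr
      exact (hann ρ hρ hρ1).1
  have hQint : ∫⁻ ξ, Q ξ ^ 2 ≤ Cq * (ENNReal.ofReal ρ ^ 2 * M * b) := by
    refine (hw S B M hB s ρ hρ hs _).trans_eq ?_
    rw [show (D * (2 * Real.pi * ρ)) ^ 2 = (D * (2 * Real.pi)) ^ 2 * ρ ^ 2 by ring,
      ENNReal.ofReal_mul (sq_nonneg _), ENNReal.ofReal_pow hρ.le]
    ring
  obtain ⟨E, hE⟩ := exists_norm_roughSum_le (r := r) (s := s) h hA hη hB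
  rw [← lintegral_fourier_sq (integrable_roughSum h hd hΩ hom hA hη hB) hE,
    ← ENNReal.mul_le_mul_iff_right (pow_ne_zero 2 hV0) (ENNReal.pow_ne_top hVt),
    ← lintegral_const_mul' _ _ (ENNReal.pow_ne_top hVt)]
  simp only [← mul_pow]
  have hae : ∀ᵐ ξ : EuclideanSpace ℝ (Fin d), ξ ≠ 0 := by
    have : Nonempty (Fin d) := ⟨⟨0, hd⟩⟩
    exact Measure.ae_ne volume 0
  calc _ ≤ ∫⁻ ξ, (2 * (Ca * ENNReal.ofReal ρ ^ 2 * ∫⁻ e in R, G e ξ) +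
        2 * (V * (ENNReal.ofReal A * σ)) ^ 2 * Q ξ ^ 2) :=
        lintegral_mono_ae (hae.mono fun ξ hξ => hpt ξ hξ)
    _ = 2 * (Ca * ENNReal.ofReal ρ ^ 2) * (∫⁻ ξ, ∫⁻ e in R, G e ξ) +
        2 * (V * (ENNReal.ofReal A * σ)) ^ 2 * ∫⁻ ξ, Q ξ ^ 2 := by
        simp only [← mul_assoc]
        rw [lintegral_add_left', lintegral_const_mul' _ _ (by finiteness),
          lintegral_const_mul' _ _ (by finiteness)]
        exact (((hGm.comp measurable_swap).lintegral_prod_right').const_mul _).aemeasurable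
    _ ≤ 2 * (Ca * ENNReal.ofReal ρ ^ 2) * (Ca * ENNReal.ofReal ρ *
      (Ct * (ENNReal.ofReal A ^ 2 * (ENNReal.ofReal ρ ^ (d - 1)) ^ 2 * M * b))) +
        2 * (V * (ENNReal.ofReal A * σ)) ^ 2 * (Cq * (ENNReal.ofReal ρ ^ 2 * M * b)) := by
        gcongr
    _ = V ^ 2 * ((2 * Ca ^ 2 * Ct * (W⁻¹) ^ 2) *
        (ENNReal.ofReal A ^ 2 * ENNReal.ofReal ρ * M * b)) +
        V ^ 2 * (2 * σ ^ 2 * Cq) * (ENNReal.ofReal A ^ 2 * ENNReal.ofReal ρ ^ 2 * M * b) := by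
        congr 1
        · rw [hVeq]
          obtain ⟨n, rfl⟩ : ∃ n, d = n + 1 := ⟨d - 1, by omega⟩
          rw [Nat.add_sub_cancel]
          have hWW : W * W⁻¹ = 1 := ENNReal.mul_inv_cancel hW0 hWt
          calc _ = 2 * Ca ^ 2 * Ct * (W * W⁻¹) ^ 2 * ((ENNReal.ofReal ρ ^ (n + 1)) ^ 2 *
                (ENNReal.ofReal A ^ 2 * ENNReal.ofReal ρ * M * b)) := by
                rw [hWW]
                ring
            _ = _ := by ring
        · ring
    _ ≤ V ^ 2 * ((2 * Ca ^ 2 * Ct * (W⁻¹) ^ 2) *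
        (ENNReal.ofReal A ^ 2 * ENNReal.ofReal ρ * M * b)) +
        V ^ 2 * (2 * σ ^ 2 * Cq) * (ENNReal.ofReal A ^ 2 * ENNReal.ofReal ρ * M * b) := by
        gcongr
        exact pow_le_of_le_one (zero_le) (ENNReal.ofReal_le_one.2 hρ1) two_ne_zero
    _ = _ := by ring

end directional

section multiplier
open scoped FourierTransform RealInnerProductSpace
variable {d : ℕ} {r L : ℝ} {Ξ : ℝ → ℝ} {Ω : EuclideanSpace ℝ (Fin d) → ℝ}

theorem IsCutoff.exists_sum_fourier_le (h : IsCutoff L Ξ) (h0 : ∫ t, hprof r (bump Ξ) t = 0) :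
    ∃ C : ℝ, 0 ≤ C ∧ ∀ (F : Finset ℤ) (u : ℝ),
      ∑ j ∈ F, ‖𝓕 (hprof r (bump Ξ)) (2 ^ j * u)‖ ≤ C := by
  obtain ⟨C₁, hC₁, h1⟩ := h.exists_fourier_le r 1
  obtain ⟨C₂, hC₂, h2⟩ := h.exists_fourier_le_abs h0
  obtain ⟨C₃, hC₃, h3⟩ := exists_sum_min_zpow_le
  refine ⟨(C₁ + C₂) * C₃, by positivity, fun F u => ?_⟩
  rcases eq_or_ne u 0 with rfl | hu
  · refine le_trans (Finset.sum_nonpos fun j _ => ?_) (by positivity : (0 : ℝ) ≤ (C₁ + C₂) * C₃)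
    simpa using h2 (2 ^ j * 0)
  · have hu' : 0 < |u| := abs_pos.2 hu
    calc _ ≤ ∑ j ∈ F, (C₁ + C₂) * min (2 ^ j * |u|) ((2 ^ j * |u|)⁻¹) := by
          refine Finset.sum_le_sum fun j _ => ?_
          have ha : |2 ^ j * u| = 2 ^ j * |u| := by
            rw [abs_mul, abs_of_pos (by positivity)]
          have h1' := h1 (2 ^ j * u)
          have h2' := h2 (2 ^ j * u)
          rw [ha] at h1' h2'
          have hp : 0 < 2 ^ j * |u| := by positivity
          rw [mul_min_of_nonneg _ _ (by positivity), le_min_iff]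
          constructor
          · refine h2'.trans ?_
            gcongr
            linarith
          · refine h1'.trans ?_
            rw [pow_one]
            gcongr <;> linarith
      _ ≤ _ := by
          rw [← Finset.mul_sum]
          gcongr
          exact h3 F _ hu'.le

theorem IsCutoff.exists_lintegral_cv_sum_kern_sq_le (h : IsCutoff L Ξ)
    (h0 : ∫ t, hprof r (bump Ξ) t = 0) :
    ∃ C : ℝ≥0∞, C ≠ ∞ ∧ ∀ (d : ℕ), 1 ≤ d → ∀ Ω : EuclideanSpace ℝ (Fin d) → ℝ, Measurable Ω →
      IsHomogZero Ω → Integrable (fun θ : sphere (0 : EuclideanSpace ℝ (Fin d)) 1 => Ω θ)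
        (sphereMeasure d) → ∀ (F : Finset ℤ) (g : EuclideanSpace ℝ (Fin d) → ℂ), Integrable g →
      ∀ D : ℝ, (∀ x, ‖g x‖ ≤ D) →
      ∫⁻ x, ‖cv (fun x => ∑ j ∈ F, kern r (bump Ξ) Ω j x) g x‖ₑ ^ 2 ≤
        C * (∫⁻ θ : sphere (0 : EuclideanSpace ℝ (Fin d)) 1, ‖Ω θ‖ₑ ∂(sphereMeasure d)) ^ 2 *
          ∫⁻ x, ‖g x‖ₑ ^ 2 := by
  obtain ⟨C, hC, hsum⟩ := h.exists_sum_fourier_le h0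
  refine ⟨ENNReal.ofReal C ^ 2, by finiteness, fun d hd Ω hΩ hom hi F g hg D hD => ?_⟩
  set ω := ∫⁻ θ : sphere (0 : EuclideanSpace ℝ (Fin d)) 1, ‖Ω θ‖ₑ ∂(sphereMeasure d) with hω
  have hk := fun j => h.integrable_kern (r := r) hd hΩ hom hi j
  have hK : Integrable fun x => ∑ j ∈ F, kern r (bump Ξ) Ω j x := integrable_finsetSum _ fun j _ => hk j
  have hH : Continuous (𝓕 (hprof r (bump Ξ))) := fourier_continuous (h.integrable_hprof r)
  have hmul : ∀ ξ, ‖𝓕 (fun x => ∑ j ∈ F, kern r (bump Ξ) Ω j x) ξ‖ₑ ≤ ENNReal.ofReal C * ω := by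
    intro ξ
    rw [fourier_sum_apply _ fun j _ => hk j]
    have : ∀ j ∈ F, ‖𝓕 (kern r (bump Ξ) Ω j) ξ‖ₑ ≤ ∫⁻ θ : sphere (0 : EuclideanSpace ℝ (Fin d)) 1,
        ‖Ω θ‖ₑ * ‖𝓕 (hprof r (bump Ξ)) (2 ^ j * ⟪(θ : EuclideanSpace ℝ (Fin d)), ξ⟫)‖ₑ
          ∂(sphereMeasure d) := by
      intro j _
      rw [h.fourier_kern hd hom j (hk j)]
      refine (enorm_integral_le_lintegral_enorm _).trans_eq (lintegral_congr fun θ => ?_)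
      rw [enorm_mul, enorm_mul, ← ofReal_norm (Complex.exp _), norm_cexp_neg_I_mul,
        ENNReal.ofReal_one, one_mul, ← ofReal_norm (Ω θ : ℂ), Complex.norm_real, ofReal_norm]
    refine (enorm_sum_le _ _).trans ((Finset.sum_le_sum this).trans ?_)
    have hΩm : Measurable fun θ : sphere (0 : EuclideanSpace ℝ (Fin d)) 1 => ‖Ω θ‖ₑ :=
      (hΩ.comp measurable_subtype_coe).enorm
    rw [← lintegral_finsetSum]
    · rw [hω, mul_comm, ← lintegral_mul_const _ hΩm]
      refine lintegral_mono fun θ => ?_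
      dsimp only
      rw [← Finset.mul_sum]
      gcongr
      simp only [← ofReal_norm]
      rw [← ENNReal.ofReal_sum_of_nonneg fun _ _ => norm_nonneg _]
      exact ENNReal.ofReal_le_ofReal (hsum F _)
    · intro j _
      have : Continuous fun θ : sphere (0 : EuclideanSpace ℝ (Fin d)) 1 =>
        𝓕 (hprof r (bump Ξ)) (2 ^ j * ⟪(θ : EuclideanSpace ℝ (Fin d)), ξ⟫) := by fun_prop
      exact hΩm.mul this.measurable.enorm
  rw [← lintegral_fourier_sq (integrable_cv hK hg) (norm_cv_le_right hK hD),
    ← lintegral_fourier_sq hg hD, ← lintegral_const_mul' _ _ ?_]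
  · refine lintegral_mono fun ξ => ?_
    dsimp only
    rw [fourier_cv hK hg, enorm_mul, ← mul_pow, ← mul_pow]
    gcongr
    exact hmul ξ
  · have : ω ≠ ∞ := hi.2.ne
    finiteness

end multiplier

section truncation
variable {d : ℕ} {r L τ : ℝ} {Ξ ψ : ℝ → ℝ} {Ω : EuclideanSpace ℝ (Fin d) → ℝ}
  {K η B : EuclideanSpace ℝ (Fin d) → ℂ} {C : ℝ≥0∞} {t : ℝ}

/-- The part of `Ω` where it is at most `τ`. -/
def low (τ : ℝ) (Ω : EuclideanSpace ℝ (Fin d) → ℝ) : EuclideanSpace ℝ (Fin d) → ℝ :=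
  {x | |Ω x| ≤ τ}.indicator Ω

/-- The part of `Ω` where it exceeds `τ`. -/
def high (τ : ℝ) (Ω : EuclideanSpace ℝ (Fin d) → ℝ) : EuclideanSpace ℝ (Fin d) → ℝ :=
  {x | τ < |Ω x|}.indicator Ω

theorem low_add_high (x : EuclideanSpace ℝ (Fin d)) : low τ Ω x + high τ Ω x = Ω x := by
  rcases le_or_gt (|Ω x|) τ with h | h
  · simp [low, high, h, not_lt.2 h]
  · simp [low, high, h, not_le.2 h]

theorem measurable_low (hΩ : Measurable Ω) : Measurable (low τ Ω) :=
  hΩ.indicator (measurableSet_le (by fun_prop) measurable_const)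

theorem measurable_high (hΩ : Measurable Ω) : Measurable (high τ Ω) :=
  hΩ.indicator (measurableSet_lt measurable_const (by fun_prop))

theorem IsHomogZero.low (h : IsHomogZero Ω) : IsHomogZero (low τ Ω) := fun ρ hρ x hx => by
  simp only [_root_.low, Set.indicator, Set.mem_ofPred_eq, h ρ hρ x hx]

theorem IsHomogZero.high (h : IsHomogZero Ω) : IsHomogZero (high τ Ω) := fun ρ hρ x hx => by
  simp only [_root_.high, Set.indicator, Set.mem_ofPred_eq, h ρ hρ x hx]

theorem abs_low_le (hτ : 0 ≤ τ) (x : EuclideanSpace ℝ (Fin d)) : |low τ Ω x| ≤ τ := by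
  by_cases hx : |Ω x| ≤ τ <;> simp [low, hx, hτ]

theorem enorm_low_le (x : EuclideanSpace ℝ (Fin d)) : ‖low τ Ω x‖ₑ ≤ ‖Ω x‖ₑ :=
  enorm_indicator_le_enorm_self _ _

theorem enorm_high_le (x : EuclideanSpace ℝ (Fin d)) : ‖high τ Ω x‖ₑ ≤ ‖Ω x‖ₑ :=
  enorm_indicator_le_enorm_self _ _

theorem integrable_low (hΩ : Measurable Ω)
    (hi : Integrable (fun θ : sphere (0 : EuclideanSpace ℝ (Fin d)) 1 => Ω θ) (sphereMeasure d)) :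
    Integrable (fun θ : sphere (0 : EuclideanSpace ℝ (Fin d)) 1 => low τ Ω θ) (sphereMeasure d) :=
  hi.mono ((measurable_low hΩ).comp measurable_subtype_coe).aestronglyMeasurable
    (Eventually.of_forall fun _ => norm_indicator_le_norm_self _ _)

theorem integrable_high (hΩ : Measurable Ω)
    (hi : Integrable (fun θ : sphere (0 : EuclideanSpace ℝ (Fin d)) 1 => Ω θ) (sphereMeasure d)) :
    Integrable (fun θ : sphere (0 : EuclideanSpace ℝ (Fin d)) 1 => high τ Ω θ) (sphereMeasure d) :=
  hi.mono ((measurable_high hΩ).comp measurable_subtype_coe).aestronglyMeasurable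
    (Eventually.of_forall fun _ => norm_indicator_le_norm_self _ _)

theorem kern_low_add_high (j : ℤ) (x : EuclideanSpace ℝ (Fin d)) :
    kern r ψ (low τ Ω) j x + kern r ψ (high τ Ω) j x = kern r ψ Ω j x := by
  simp only [kern, radKern]
  rw [← low_add_high (τ := τ) (Ω := Ω) x]
  push_cast
  ring

theorem cv_add_left {K₁ K₂ : EuclideanSpace ℝ (Fin d) → ℂ} (h₁ : Integrable K₁)
    (h₂ : Integrable K₂) (hB : Measurable B) {D : ℝ} (hD : ∀ x, ‖B x‖ ≤ D)
    (x : EuclideanSpace ℝ (Fin d)) : cv (fun x => K₁ x + K₂ x) B x = cv K₁ B x + cv K₂ B x := by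
  unfold cv
  rw [← integral_add (integrable_cv_integrand h₁ hB hD x) (integrable_cv_integrand h₂ hB hD x)]
  simp only [add_mul]

theorem cv_sum_left {F : Finset ℤ} {K : ℤ → EuclideanSpace ℝ (Fin d) → ℂ}
    (hK : ∀ j, Integrable (K j)) (hB : Measurable B) {D : ℝ} (hD : ∀ x, ‖B x‖ ≤ D)
    (x : EuclideanSpace ℝ (Fin d)) :
    cv (fun x => ∑ j ∈ F, K j x) B x = ∑ j ∈ F, cv (K j) B x := by
  unfold cv
  rw [← integral_finsetSum _ fun j _ => integrable_cv_integrand (hK j) hB hD x]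
  simp only [Finset.sum_mul]

theorem cv_sum_right {S : Finset ℤ} {B : ℤ → EuclideanSpace ℝ (Fin d) → ℂ}
    (hK : Integrable K) (hB : ∀ k, Measurable (B k)) {D : ℝ} (hD : ∀ k x, ‖B k x‖ ≤ D)
    (x : EuclideanSpace ℝ (Fin d)) :
    cv K (fun x => ∑ k ∈ S, B k x) x = ∑ k ∈ S, cv K (B k) x := by
  unfold cv
  rw [← integral_finsetSum _ fun k _ => integrable_cv_integrand hK (hB k) (hD k) x]
  simp only [Finset.mul_sum]

theorem cv_comm (K B : EuclideanSpace ℝ (Fin d) → ℂ) : cv K B = cv B K := by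
  ext x
  unfold cv
  rw [← integral_sub_left_eq_self _ volume x]
  simp only [_root_.sub_sub_cancel, mul_comm]

/-- Convolution with a mollifier inherits the modulus of continuity. -/
theorem IsMollifier.lintegral_cv_sub_le (h : IsMollifier C t η) (hKm : Measurable K)
    (hK : Integrable K) (y z : EuclideanSpace ℝ (Fin d)) :
    ∫⁻ x, ‖cv K η (x - y) - cv K η (x - z)‖ₑ ≤
      C * ENNReal.ofReal (‖y - z‖ / t) * ∫⁻ x, ‖K x‖ₑ := by
  have hm := h.measurable
  obtain ⟨D, hD⟩ := h.bounded
  have e : ∀ x, cv K η (x - y) - cv K η (x - z) = cv (fun x => η (x - y) - η (x - z)) K x := by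
    intro x
    rw [cv_comm K η]
    unfold cv
    have hi : ∀ v, Integrable fun w => η (v - w) * K w := fun v =>
      hK.bdd_mul (c := D) (hm.comp (by fun_prop)).aestronglyMeasurable
        (Eventually.of_forall fun w => hD _)
    rw [← integral_sub (hi _) (hi _)]
    refine integral_congr_ae (Eventually.of_forall fun w => ?_)
    simp only [sub_mul, sub_right_comm]
  simp only [e]
  refine (lintegral_cv_le (Measurable.sub (hm.comp (by fun_prop)) (hm.comp (by fun_prop)))
    hKm).trans ?_
  gcongr
  exact h.modulus y z

theorem IsMollifier.lintegral_cv_cv_le (h : IsMollifier C t η) (ht : 0 < t) (hKm : Measurable K)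
    (hK : Integrable K) (hB : Measurable B) (hBi : Integrable B) {k : ℤ}
    (hc : ∀ x, ∫ y in cube k x, B y = 0) :
    ∫⁻ x, ‖cv (cv K η) B x‖ₑ ≤
      C * ENNReal.ofReal (d * 2 ^ k / t) * (∫⁻ x, ‖K x‖ₑ) * ∫⁻ x, ‖B x‖ₑ := by
  obtain ⟨D, hD⟩ := h.bounded
  refine lintegral_cv_le_of_cancel (measurable_cv hKm h.measurable) (norm_cv_le_right hK hD)
    (integrable_cv hK h.integrable) hB hBi hc fun y z hyz => ?_
  refine (h.lintegral_cv_sub_le hKm hK y z).trans ?_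
  gcongr

theorem IsBadFamily.mono {S S' : Finset ℤ} {B : ℤ → EuclideanSpace ℝ (Fin d) → ℂ} {M : ℝ≥0∞}
    (h : IsBadFamily S B M) (hS : S' ⊆ S) : IsBadFamily S' B M where
  measurable := h.measurable
  bounded := h.bounded
  integrable := h.integrable
  mass S'' h'' := h.mass S'' (h''.trans hS)
  cancel := h.cancel

/-- The tails of `Ω` beyond a geometric sequence of heights are controlled by a logarithm. -/
theorem sum_enorm_high_le {q W : ℝ} (hq : 1 < q) (hW : 0 < W) (N : ℕ)
    (x : EuclideanSpace ℝ (Fin d)) :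
    ∑ s ∈ Finset.Icc 1 N, ‖high (q ^ s * W) Ω x‖ₑ ≤ ENNReal.ofReal (Real.log q)⁻¹ *
      (‖Ω x‖ₑ * ENNReal.ofReal (max (Real.log (|Ω x| / W)) 0)) := by
  have hlq : 0 < Real.log q := Real.log_pos hq
  set m : ℝ := max (Real.log (|Ω x| / W)) 0 with hm
  have hm0 : 0 ≤ m := le_max_right _ _
  have h1 : ∀ s ∈ Finset.Icc 1 N, high (q ^ s * W) Ω x ≠ 0 → s ∈ Finset.Icc 1 ⌊m / Real.log q⌋₊ := by
    intro s hs hne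
    rw [Finset.mem_Icc] at hs ⊢
    refine ⟨hs.1, Nat.le_floor ?_⟩
    have h2 : q ^ s * W < |Ω x| := by
      by_contra hcon
      exact hne (Set.indicator_of_notMem (s := {x | q ^ s * W < |Ω x|}) hcon _)
    rw [le_div_iff₀ hlq, ← Real.log_pow]
    refine le_trans (Real.log_le_log (by positivity) ?_) (le_max_left _ _)
    rw [le_div_iff₀ hW]
    exact h2.le
  calc _ ≤ ∑ s ∈ Finset.Icc 1 ⌊m / Real.log q⌋₊, ‖Ω x‖ₑ := by
        rw [← Finset.sum_filter_ne_zero]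
        refine (Finset.sum_le_sum fun s _ => enorm_high_le x).trans
          (Finset.sum_le_sum_of_subset fun s hs => ?_)
        rw [Finset.mem_filter] at hs
        exact h1 s hs.1 fun h0 => hs.2 (by rw [h0, enorm_zero])
    _ = (⌊m / Real.log q⌋₊ : ℝ≥0∞) * ‖Ω x‖ₑ := by
        rw [Finset.sum_const, Nat.card_Icc, Nat.add_sub_cancel, nsmul_eq_mul]
    _ ≤ ENNReal.ofReal (m / Real.log q) * ‖Ω x‖ₑ := by
        gcongr
        rw [← ENNReal.ofReal_natCast]
        exact ENNReal.ofReal_le_ofReal (Nat.floor_le (by positivity))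
    _ = _ := by
        rw [div_eq_inv_mul, ENNReal.ofReal_mul (by positivity)]
        ring

/-- A weighted Cauchy-Schwarz inequality. -/
theorem enorm_sum_sq_le (N : ℕ) {q : ℝ} (hq : 1 < q) (a : ℕ → ℂ) :
    ‖∑ s ∈ Finset.Icc 1 N, a s‖ₑ ^ 2 ≤ ENNReal.ofReal (1 - q⁻¹)⁻¹ *
      ∑ s ∈ Finset.Icc 1 N, ENNReal.ofReal (q ^ s) * ‖a s‖ₑ ^ 2 := by
  have hq0 : 0 < q := by linarith
  have hq1 : q⁻¹ < 1 := inv_lt_one_of_one_lt₀ hq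
  have hgeo : ∑ s ∈ Finset.Icc 1 N, q⁻¹ ^ s ≤ (1 - q⁻¹)⁻¹ :=
    (Summable.sum_le_tsum _ (fun _ _ => by positivity)
      (summable_geometric_of_lt_one (by positivity) hq1)).trans_eq
      (tsum_geometric_of_lt_one (by positivity) hq1)
  have hr : ‖∑ s ∈ Finset.Icc 1 N, a s‖ ^ 2 ≤ (1 - q⁻¹)⁻¹ *
      ∑ s ∈ Finset.Icc 1 N, q ^ s * ‖a s‖ ^ 2 := by
    calc _ ≤ (∑ s ∈ Finset.Icc 1 N, ‖a s‖) ^ 2 := by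
          gcongr
          exact norm_sum_le _ _
      _ ≤ (∑ s ∈ Finset.Icc 1 N, q⁻¹ ^ s) * ∑ s ∈ Finset.Icc 1 N, q ^ s * ‖a s‖ ^ 2 := by
          refine Finset.sum_sq_le_sum_mul_sum_of_sq_le_mul _ (fun _ _ => by positivity)
            (fun _ _ => by positivity) fun s _ => le_of_eq ?_
          rw [← mul_assoc, ← mul_pow, inv_mul_cancel₀ hq0.ne', one_pow, one_mul]
      _ ≤ _ := by gcongr
  have hc : 0 ≤ (1 - q⁻¹)⁻¹ := inv_nonneg.2 (by linarith)
  have := ENNReal.ofReal_le_ofReal hr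
  rw [ENNReal.ofReal_mul hc, ENNReal.ofReal_sum_of_nonneg fun _ _ => by positivity,
    ENNReal.ofReal_pow (norm_nonneg _), ofReal_norm] at this
  refine this.trans_eq ?_
  congr 1
  refine Finset.sum_congr rfl fun s _ => ?_
  rw [ENNReal.ofReal_mul (by positivity), ENNReal.ofReal_pow (norm_nonneg _), ofReal_norm]

end truncation

section badFamily
variable {d : ℕ} {r L : ℝ} {Ξ : ℝ → ℝ} {Ω : EuclideanSpace ℝ (Fin d) → ℝ}

theorem sum_ofReal_inv_pow_le {q : ℝ} (hq : 1 < q) (N : ℕ) :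
    ∑ s ∈ Finset.Icc 1 N, ENNReal.ofReal (q ^ s)⁻¹ ≤ ENNReal.ofReal (1 - q⁻¹)⁻¹ := by
  have hq0 : 0 < q := by linarith
  rw [← ENNReal.ofReal_sum_of_nonneg fun s _ => by positivity]
  refine ENNReal.ofReal_le_ofReal ?_
  have h := hasSum_geometric_of_lt_one (inv_nonneg.2 hq0.le) (inv_lt_one_of_one_lt₀ hq)
  refine (Finset.sum_congr rfl fun s _ => (inv_pow q s).symm).trans_le ?_
  exact sum_le_hasSum _ (fun s _ => by positivity) h

theorem IsMollifier.cv_eq_rough_add {η K B : EuclideanSpace ℝ (Fin d) → ℂ} {C : ℝ≥0∞} {t : ℝ}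
    (h : IsMollifier C t η) (hK : Integrable K) (hB : Measurable B) {D : ℝ} (hD : ∀ x, ‖B x‖ ≤ D)
    (x : EuclideanSpace ℝ (Fin d)) :
    cv K B x = cv (rough K η) B x + cv (cv K η) B x := by
  rw [← cv_add_left (h.integrable_rough hK) (integrable_cv hK h.integrable) hB hD]
  simp [rough]

/-- The part of the bad contribution at distance `2^s` that is coarse at scale `2^k`. -/
def smoothSum (r : ℝ) (ψ : ℝ → ℝ) (Ω : EuclideanSpace ℝ (Fin d) → ℝ) (S : Finset ℤ) (s : ℤ)
    (η : ℤ → EuclideanSpace ℝ (Fin d) → ℂ) (B : ℤ → EuclideanSpace ℝ (Fin d) → ℂ) :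
    EuclideanSpace ℝ (Fin d) → ℂ :=
  fun x => ∑ k ∈ S, cv (cv (kern r ψ Ω (k + s)) (η (k + s))) (B k) x

/-- The bad contribution at distance `2^s`. -/
def plainSum (r : ℝ) (ψ : ℝ → ℝ) (Ω : EuclideanSpace ℝ (Fin d) → ℝ) (S : Finset ℤ) (s : ℤ)
    (B : ℤ → EuclideanSpace ℝ (Fin d) → ℂ) : EuclideanSpace ℝ (Fin d) → ℂ :=
  fun x => ∑ k ∈ S, cv (kern r ψ Ω (k + s)) (B k) x

variable {S : Finset ℤ} {B : ℤ → EuclideanSpace ℝ (Fin d) → ℂ} {M C : ℝ≥0∞}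

theorem measurable_plainSum (h : IsCutoff L Ξ) (hΩ : Measurable Ω) (hB : IsBadFamily S B M)
    (s : ℤ) : Measurable (plainSum r (bump Ξ) Ω S s B) :=
  Finset.measurable_sum _ fun k _ => measurable_cv (h.measurable_kern hΩ _) (hB.measurable k)

theorem measurable_smoothSum (h : IsCutoff L Ξ) (hΩ : Measurable Ω) (hB : IsBadFamily S B M)
    {t : ℤ → ℝ} {η : ℤ → EuclideanSpace ℝ (Fin d) → ℂ} (hη : ∀ j, IsMollifier C (t j) (η j))
    (s : ℤ) : Measurable (smoothSum r (bump Ξ) Ω S s η B) :=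
  Finset.measurable_sum _ fun k _ => measurable_cv
    (measurable_cv (h.measurable_kern hΩ _) (hη _).measurable) (hB.measurable k)

theorem measurable_roughSum (h : IsCutoff L Ξ) (hΩ : Measurable Ω) (hB : IsBadFamily S B M)
    {t : ℤ → ℝ} {η : ℤ → EuclideanSpace ℝ (Fin d) → ℂ} (hη : ∀ j, IsMollifier C (t j) (η j))
    (s : ℤ) : Measurable (roughSum r (bump Ξ) Ω S s η B) :=
  Finset.measurable_sum _ fun k _ => measurable_cv
    ((hη _).measurable_rough (h.measurable_kern hΩ _)) (hB.measurable k)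

theorem plainSum_eq_add (h : IsCutoff L Ξ) (hd : 1 ≤ d) (hΩ : Measurable Ω) (hom : IsHomogZero Ω)
    (hi : Integrable (fun θ : sphere (0 : EuclideanSpace ℝ (Fin d)) 1 => Ω θ) (sphereMeasure d))
    (hB : IsBadFamily S B M) {t : ℤ → ℝ} {η : ℤ → EuclideanSpace ℝ (Fin d) → ℂ}
    (hη : ∀ j, IsMollifier C (t j) (η j)) (s : ℤ) (τ : ℝ) (x : EuclideanSpace ℝ (Fin d)) :
    plainSum r (bump Ξ) Ω S s B x = roughSum r (bump Ξ) (low τ Ω) S s η B x +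
      (smoothSum r (bump Ξ) (low τ Ω) S s η B x + plainSum r (bump Ξ) (high τ Ω) S s B x) := by
  obtain ⟨D, hD⟩ := hB.bounded
  simp only [plainSum, roughSum, smoothSum, ← Finset.sum_add_distrib]
  refine Finset.sum_congr rfl fun k _ => ?_
  have hl := h.integrable_kern (r := r) hd (measurable_low (τ := τ) hΩ) hom.low
    (integrable_low hΩ hi) (k + s)
  have hh := h.integrable_kern (r := r) hd (measurable_high (τ := τ) hΩ) hom.high
    (integrable_high hΩ hi) (k + s)
  rw [← add_assoc, ← (hη (k + s)).cv_eq_rough_add hl (hB.measurable k) (hD k),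
    ← cv_add_left hl hh (hB.measurable k) (hD k)]
  simp only [kern_low_add_high]

theorem lintegral_plainSum_le (h : IsCutoff L Ξ) (hd : 1 ≤ d) (hΩ : Measurable Ω)
    (hom : IsHomogZero Ω) (hB : IsBadFamily S B M) (s : ℤ) :
    ∫⁻ x, ‖plainSum r (bump Ξ) Ω S s B x‖ₑ ≤ ENNReal.ofReal (2 * L) *
      (∫⁻ θ : sphere (0 : EuclideanSpace ℝ (Fin d)) 1, ‖Ω θ‖ₑ ∂(sphereMeasure d)) *
        ∑ k ∈ S, ∫⁻ x, ‖B k x‖ₑ := by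
  calc ∫⁻ x, ‖plainSum r (bump Ξ) Ω S s B x‖ₑ
      ≤ ∫⁻ x, ∑ k ∈ S, ‖cv (kern r (bump Ξ) Ω (k + s)) (B k) x‖ₑ :=
        lintegral_mono fun x => enorm_sum_le _ _
    _ = ∑ k ∈ S, ∫⁻ x, ‖cv (kern r (bump Ξ) Ω (k + s)) (B k) x‖ₑ :=
        lintegral_finsetSum _ fun k _ =>
          (measurable_cv (h.measurable_kern hΩ _) (hB.measurable k)).enorm
    _ ≤ _ := by
        rw [Finset.mul_sum]
        refine Finset.sum_le_sum fun k _ => ?_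
        refine (lintegral_cv_le (h.measurable_kern hΩ _) (hB.measurable k)).trans ?_
        gcongr
        exact h.lintegral_kern_le hd hΩ hom _

theorem lintegral_smoothSum_le (h : IsCutoff L Ξ) (hd : 1 ≤ d) (hΩ : Measurable Ω)
    (hom : IsHomogZero Ω)
    (hi : Integrable (fun θ : sphere (0 : EuclideanSpace ℝ (Fin d)) 1 => Ω θ) (sphereMeasure d))
    (hB : IsBadFamily S B M) {t δ : ℝ} (ht : 0 < t) {s : ℤ} (hδ : (2 ^ s * t)⁻¹ ≤ δ)
    {η : ℤ → EuclideanSpace ℝ (Fin d) → ℂ} (hη : ∀ j : ℤ, IsMollifier C (2 ^ j * t) (η j)) :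
    ∫⁻ x, ‖smoothSum r (bump Ξ) Ω S s η B x‖ₑ ≤ C * ENNReal.ofReal (d * δ) *
      (ENNReal.ofReal (2 * L) *
      (∫⁻ θ : sphere (0 : EuclideanSpace ℝ (Fin d)) 1, ‖Ω θ‖ₑ ∂(sphereMeasure d))) *
        ∑ k ∈ S, ∫⁻ x, ‖B k x‖ₑ := by
  calc ∫⁻ x, ‖smoothSum r (bump Ξ) Ω S s η B x‖ₑ
      ≤ ∫⁻ x, ∑ k ∈ S, ‖cv (cv (kern r (bump Ξ) Ω (k + s)) (η (k + s))) (B k) x‖ₑ :=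
        lintegral_mono fun x => enorm_sum_le _ _
    _ = ∑ k ∈ S, ∫⁻ x, ‖cv (cv (kern r (bump Ξ) Ω (k + s)) (η (k + s))) (B k) x‖ₑ :=
        lintegral_finsetSum _ fun k _ => (measurable_cv
          (measurable_cv (h.measurable_kern hΩ _) (hη _).measurable) (hB.measurable k)).enorm
    _ ≤ _ := by
        rw [Finset.mul_sum]
        refine Finset.sum_le_sum fun k _ => ?_
        refine ((hη (k + s)).lintegral_cv_cv_le (by positivity) (h.measurable_kern hΩ _)
          (h.integrable_kern hd hΩ hom hi _) (hB.measurable k) (hB.integrable k)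
          (hB.cancel k)).trans ?_
        gcongr
        · rw [mul_div_assoc]
          gcongr
          refine le_trans (le_of_eq ?_) hδ
          rw [zpow_add₀ two_ne_zero]
          field_simp
        · exact h.lintegral_kern_le hd hΩ hom _

end badFamily

section smallSum
variable {d : ℕ} {r L : ℝ} {Ξ : ℝ → ℝ} {Ω : EuclideanSpace ℝ (Fin d) → ℝ}

theorem sum_lintegral_plainSum_high_le (h : IsCutoff L Ξ) (hd : 1 ≤ d) (hΩ : Measurable Ω)
    (hom : IsHomogZero Ω) {S : Finset ℤ} {B : ℤ → EuclideanSpace ℝ (Fin d) → ℂ} {M : ℝ≥0∞}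
    (hB : IsBadFamily S B M) {S' : ℕ → Finset ℤ} (hS : ∀ s, S' s ⊆ S) {q W : ℝ} (hq : 1 < q)
    (hW : 0 < W) (N : ℕ) :
    ∑ s ∈ Finset.Icc 1 N, ∫⁻ x, ‖plainSum r (bump Ξ) (high (q ^ s * W) Ω) (S' s) s B x‖ₑ ≤
      ENNReal.ofReal (2 * L) * (ENNReal.ofReal (Real.log q)⁻¹ *
      (∫⁻ θ : sphere (0 : EuclideanSpace ℝ (Fin d)) 1,
        ‖Ω θ‖ₑ * ENNReal.ofReal (max (Real.log (|Ω θ| / W)) 0) ∂(sphereMeasure d))) *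
      ∑ k ∈ S, ∫⁻ x, ‖B k x‖ₑ := by
  calc _ ≤ ∑ s ∈ Finset.Icc 1 N, ENNReal.ofReal (2 * L) *
          (∫⁻ θ : sphere (0 : EuclideanSpace ℝ (Fin d)) 1,
            ‖high (q ^ s * W) Ω θ‖ₑ ∂(sphereMeasure d)) * ∑ k ∈ S, ∫⁻ x, ‖B k x‖ₑ := by
        refine Finset.sum_le_sum fun s _ => ?_
        refine (lintegral_plainSum_le h hd (measurable_high hΩ) hom.high (hB.mono (hS s)) s).trans ?_
        gcongr
        exact hS s
    _ = ENNReal.ofReal (2 * L) * (∫⁻ θ : sphere (0 : EuclideanSpace ℝ (Fin d)) 1,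
          ∑ s ∈ Finset.Icc 1 N, ‖high (q ^ s * W) Ω θ‖ₑ ∂(sphereMeasure d)) *
            ∑ k ∈ S, ∫⁻ x, ‖B k x‖ₑ := by
        rw [lintegral_finsetSum (f := fun (s : ℕ) (θ : sphere (0 : EuclideanSpace ℝ (Fin d)) 1) =>
          ‖high (q ^ s * W) Ω θ‖ₑ) _ fun s _ =>
          ((measurable_high hΩ).comp measurable_subtype_coe).enorm, ← Finset.sum_mul,
          ← Finset.mul_sum]
    _ ≤ _ := by
        refine mul_le_mul_left (mul_le_mul_right ?_ _) _
        rw [← lintegral_const_mul' _ _ ENNReal.ofReal_ne_top]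
        refine lintegral_mono fun θ => ?_
        exact sum_enorm_high_le hq hW N (θ : EuclideanSpace ℝ (Fin d))

theorem sum_lintegral_smoothSum_low_le (h : IsCutoff L Ξ) (hd : 1 ≤ d) (hΩ : Measurable Ω)
    (hom : IsHomogZero Ω)
    (hi : Integrable (fun θ : sphere (0 : EuclideanSpace ℝ (Fin d)) 1 => Ω θ) (sphereMeasure d))
    {S : Finset ℤ} {B : ℤ → EuclideanSpace ℝ (Fin d) → ℂ} {M C : ℝ≥0∞}
    (hB : IsBadFamily S B M) {S' : ℕ → Finset ℤ} (hS : ∀ s, S' s ⊆ S) {q : ℝ} (hq : 1 < q)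
    {τ t : ℕ → ℝ} (ht : ∀ s, 0 < t s) (hqt : ∀ s, q ^ s ≤ 2 ^ s * t s)
    {η : ℕ → ℤ → EuclideanSpace ℝ (Fin d) → ℂ}
    (hη : ∀ s (j : ℤ), IsMollifier C (2 ^ j * t s) (η s j)) (N : ℕ) :
    ∑ s ∈ Finset.Icc 1 N,
      ∫⁻ x, ‖smoothSum r (bump Ξ) (low (τ s) Ω) (S' s) s (η s) B x‖ₑ ≤
      C * d * ENNReal.ofReal (1 - q⁻¹)⁻¹ * (ENNReal.ofReal (2 * L) *
      (∫⁻ θ : sphere (0 : EuclideanSpace ℝ (Fin d)) 1, ‖Ω θ‖ₑ ∂(sphereMeasure d))) *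
      ∑ k ∈ S, ∫⁻ x, ‖B k x‖ₑ := by
  have hq0 : 0 < q := by linarith
  calc _ ≤ ∑ s ∈ Finset.Icc 1 N, C * d * ENNReal.ofReal (q ^ s)⁻¹ * (ENNReal.ofReal (2 * L) *
      (∫⁻ θ : sphere (0 : EuclideanSpace ℝ (Fin d)) 1, ‖Ω θ‖ₑ ∂(sphereMeasure d))) *
      ∑ k ∈ S, ∫⁻ x, ‖B k x‖ₑ := by
        refine Finset.sum_le_sum fun s _ => ?_
        refine (lintegral_smoothSum_le h hd (measurable_low hΩ) hom.low (integrable_low hΩ hi)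
          (hB.mono (hS s)) (ht s) (δ := (q ^ s)⁻¹) ?_ (hη s)).trans ?_
        · rw [zpow_natCast]
          exact inv_anti₀ (by positivity) (hqt s)
        · rw [ENNReal.ofReal_mul (by positivity), ENNReal.ofReal_natCast, ← mul_assoc C]
          exact mul_le_mul' (mul_le_mul_right (mul_le_mul_right
            (lintegral_mono fun θ => enorm_low_le _) _) _) (Finset.sum_le_sum_of_subset (hS s))
    _ = C * d * (∑ s ∈ Finset.Icc 1 N, ENNReal.ofReal (q ^ s)⁻¹) * (ENNReal.ofReal (2 * L) *
      (∫⁻ θ : sphere (0 : EuclideanSpace ℝ (Fin d)) 1, ‖Ω θ‖ₑ ∂(sphereMeasure d))) *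
      ∑ k ∈ S, ∫⁻ x, ‖B k x‖ₑ := by
        rw [← Finset.sum_mul, ← Finset.sum_mul, ← Finset.mul_sum]
    _ ≤ _ := by
        gcongr
        exact sum_ofReal_inv_pow_le hq N

theorem lintegral_sum_sq_le {q : ℝ} (hq : 1 < q) (N : ℕ) {R : ℕ → EuclideanSpace ℝ (Fin d) → ℂ}
    (hR : ∀ s, Measurable (R s)) {D : ℝ≥0∞}
    (hD : ∀ s, ENNReal.ofReal (q ^ (2 * s)) * ∫⁻ x, ‖R s x‖ₑ ^ 2 ≤ D) :
    ∫⁻ x, ‖∑ s ∈ Finset.Icc 1 N, R s x‖ₑ ^ 2 ≤ ENNReal.ofReal (1 - q⁻¹)⁻¹ ^ 2 * D := by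
  have hq0 : 0 < q := by linarith
  calc _ ≤ ∫⁻ x, ENNReal.ofReal (1 - q⁻¹)⁻¹ *
          ∑ s ∈ Finset.Icc 1 N, ENNReal.ofReal (q ^ s) * ‖R s x‖ₑ ^ 2 :=
        lintegral_mono fun x => enorm_sum_sq_le N hq fun s => R s x
    _ = ENNReal.ofReal (1 - q⁻¹)⁻¹ *
          ∑ s ∈ Finset.Icc 1 N, ENNReal.ofReal (q ^ s) * ∫⁻ x, ‖R s x‖ₑ ^ 2 := by
        rw [lintegral_const_mul' _ _ ENNReal.ofReal_ne_top,
          lintegral_finsetSum _ fun s _ => ((hR s).enorm.pow_const 2).const_mul _]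
        simp only [lintegral_const_mul' _ _ ENNReal.ofReal_ne_top]
    _ ≤ ENNReal.ofReal (1 - q⁻¹)⁻¹ *
          ∑ s ∈ Finset.Icc 1 N, ENNReal.ofReal (q ^ s)⁻¹ * D := by
        refine mul_le_mul_right (Finset.sum_le_sum fun s _ => ?_) _
        refine le_trans (le_of_eq ?_) (mul_le_mul_right (hD s) _)
        rw [← mul_assoc, ← ENNReal.ofReal_mul (by positivity)]
        congr 2
        field_simp
        ring
    _ ≤ _ := by
        rw [← Finset.sum_mul, pow_two, mul_assoc]
        gcongr
        exact sum_ofReal_inv_pow_le hq N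

set_option maxHeartbeats 1000000 in
theorem IsCutoff.exists_bad_decomposition (h : IsCutoff L Ξ) (hd : 1 ≤ d) (r : ℝ) :
    ∃ C : ℝ≥0∞, C ≠ ∞ ∧ ∀ Ω : EuclideanSpace ℝ (Fin d) → ℝ, Measurable Ω → IsHomogZero Ω →
      Integrable (fun θ : sphere (0 : EuclideanSpace ℝ (Fin d)) 1 => Ω θ) (sphereMeasure d) →
      ∀ W Λ : ℝ, 0 < W → W ≤ Λ →
      ∫⁻ θ : sphere (0 : EuclideanSpace ℝ (Fin d)) 1, ‖Ω θ‖ₑ ∂(sphereMeasure d) ≤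
        ENNReal.ofReal W →
      ∫⁻ θ : sphere (0 : EuclideanSpace ℝ (Fin d)) 1,
        ‖Ω θ‖ₑ * ENNReal.ofReal (max (Real.log (|Ω θ| / W)) 0) ∂(sphereMeasure d) ≤
        ENNReal.ofReal Λ →
      ∀ S B M, IsBadFamily S B M → ∀ (S' : ℕ → Finset ℤ), (∀ s, S' s ⊆ S) → ∀ N : ℕ,
      ∃ R E : EuclideanSpace ℝ (Fin d) → ℂ, Measurable R ∧ Measurable E ∧
        (∀ x, ∑ s ∈ Finset.Icc 1 N, plainSum r (bump Ξ) Ω (S' s) s B x = R x + E x) ∧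
        ∫⁻ x, ‖R x‖ₑ ^ 2 ≤ C * (ENNReal.ofReal W ^ 2 * M * ∑ k ∈ S, ∫⁻ x, ‖B k x‖ₑ) ∧
        ∫⁻ x, ‖E x‖ₑ ≤ C * (ENNReal.ofReal Λ * ∑ k ∈ S, ∫⁻ x, ‖B k x‖ₑ) := by
  obtain ⟨C₁, hC₁, H₁⟩ := h.exists_roughSum_sq_le hd r
  obtain ⟨C₂, hC₂, H₂⟩ := exists_isMollifier d
  obtain ⟨q, hq, hq12⟩ : ∃ q : ℝ, 1 < q ∧ q ^ 12 = 2 := by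
    refine ⟨2 ^ (1 / 12 : ℝ), Real.one_lt_rpow (by norm_num) (by norm_num), ?_⟩
    rw [← Real.rpow_natCast, ← Real.rpow_mul (by norm_num)]
    norm_num
  have hq0 : 0 < q := by linarith
  set G := ENNReal.ofReal (1 - q⁻¹)⁻¹
  set CE := C₂ * d * G * ENNReal.ofReal (2 * L) +
    ENNReal.ofReal (2 * L) * ENNReal.ofReal (Real.log q)⁻¹
  refine ⟨G ^ 2 * C₁ + CE, by finiteness, fun Ω hΩ hom hi W Λ hW hWΛ hΩW hΩΛ S B M hB S' hS N => ?_⟩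
  set b := ∑ k ∈ S, ∫⁻ x, ‖B k x‖ₑ
  let ρ : ℕ → ℝ := fun s => (q ^ (4 * s))⁻¹
  have hρ : ∀ s, 0 < ρ s := fun s => by positivity
  have h2 : ∀ s : ℕ, (2 : ℝ) ^ s = q ^ (12 * s) := fun s => by rw [pow_mul, hq12]
  choose η hη using fun (s : ℕ) (j : ℤ) => H₂ (2 ^ j * ρ s ^ 2) (by have := hρ s; positivity)
  let τ : ℕ → ℝ := fun s => q ^ s * W
  have hτ : ∀ s, 0 ≤ τ s := fun s => by positivity
  have hRm : ∀ s : ℕ, Measurable (roughSum r (bump Ξ) (low (τ s) Ω) (S' s) s (η s) B) := fun s =>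
    measurable_roughSum h (measurable_low hΩ) (hB.mono (hS s)) (hη s) s
  have hEm : ∀ s : ℕ, Measurable (smoothSum r (bump Ξ) (low (τ s) Ω) (S' s) s (η s) B) := fun s =>
    measurable_smoothSum h (measurable_low hΩ) (hB.mono (hS s)) (hη s) s
  have hHm : ∀ s : ℕ, Measurable (plainSum r (bump Ξ) (high (τ s) Ω) (S' s) s B) := fun s =>
    measurable_plainSum h (measurable_high hΩ) (hB.mono (hS s)) s
  refine ⟨fun x => ∑ s ∈ Finset.Icc 1 N, roughSum r (bump Ξ) (low (τ s) Ω) (S' s) s (η s) B x,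
    fun x => ∑ s ∈ Finset.Icc 1 N, (smoothSum r (bump Ξ) (low (τ s) Ω) (S' s) s (η s) B x +
      plainSum r (bump Ξ) (high (τ s) Ω) (S' s) s B x),
    Finset.measurable_sum _ fun s _ => hRm s,
    Finset.measurable_sum _ fun s _ => (hEm s).add (hHm s), fun x => ?_, ?_, ?_⟩
  · rw [← Finset.sum_add_distrib]
    exact Finset.sum_congr rfl fun s _ =>
      plainSum_eq_add h hd hΩ hom hi (hB.mono (hS s)) (hη s) s (τ s) x
  · refine (lintegral_sum_sq_le hq N hRm
      (D := C₁ * (ENNReal.ofReal W ^ 2 * M * b)) fun s => ?_).trans ?_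
    · have := H₁ (low (τ s) Ω) (τ s) (measurable_low hΩ) hom.low (abs_low_le (hτ s)) (S' s) B M
        (hB.mono (hS s)) s (ρ s) (hρ s) (inv_le_one_of_one_le₀ (one_le_pow₀ hq.le)) ?_ C₂ (η s)
        (hη s)
      · refine (mul_le_mul_right this _).trans ?_
        have e : ENNReal.ofReal (q ^ (2 * s)) * (ENNReal.ofReal (τ s) ^ 2 * ENNReal.ofReal (ρ s))
            = ENNReal.ofReal W ^ 2 := by
          rw [← ENNReal.ofReal_pow (hτ s), ← ENNReal.ofReal_mul (by positivity),
            ← ENNReal.ofReal_mul (by positivity), ← ENNReal.ofReal_pow hW.le]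
          congr 1
          simp only [τ, ρ]
          field_simp
          ring
        calc _ = C₁ * ((ENNReal.ofReal (q ^ (2 * s)) *
              (ENNReal.ofReal (τ s) ^ 2 * ENNReal.ofReal (ρ s))) * M *
                ∑ k ∈ S' s, ∫⁻ x, ‖B k x‖ₑ) := by ring
          _ ≤ _ := by
            rw [e]
            gcongr
            exact Finset.sum_le_sum_of_subset (hS s)
      · rw [zpow_natCast, h2]
        simp only [ρ]
        rw [← div_eq_mul_inv, one_le_div (by positivity)]
        exact pow_le_pow_right₀ hq.le (by omega)
    · rw [← mul_assoc]
      gcongr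
      exact le_self_add
  · calc _ ≤ ∫⁻ x, ∑ s ∈ Finset.Icc 1 N, (‖smoothSum r (bump Ξ) (low (τ s) Ω) (S' s) s (η s) B x‖ₑ +
          ‖plainSum r (bump Ξ) (high (τ s) Ω) (S' s) s B x‖ₑ) :=
          lintegral_mono fun x => (enorm_sum_le _ _).trans
            (Finset.sum_le_sum fun s _ => enorm_add_le _ _)
      _ = (∑ s ∈ Finset.Icc 1 N, ∫⁻ x, ‖smoothSum r (bump Ξ) (low (τ s) Ω) (S' s) s (η s) B x‖ₑ) +
          ∑ s ∈ Finset.Icc 1 N, ∫⁻ x, ‖plainSum r (bump Ξ) (high (τ s) Ω) (S' s) s B x‖ₑ := by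
          rw [lintegral_finsetSum (f := fun (s : ℕ) x =>
            ‖smoothSum r (bump Ξ) (low (τ s) Ω) (S' s) s (η s) B x‖ₑ +
            ‖plainSum r (bump Ξ) (high (τ s) Ω) (S' s) s B x‖ₑ) _
            fun s _ => (hEm s).enorm.add (hHm s).enorm,
            ← Finset.sum_add_distrib]
          exact Finset.sum_congr rfl fun s _ => lintegral_add_left (hEm s).enorm _
      _ ≤ C₂ * d * G * (ENNReal.ofReal (2 * L) * ENNReal.ofReal Λ) * b +
          ENNReal.ofReal (2 * L) * (ENNReal.ofReal (Real.log q)⁻¹ * ENNReal.ofReal Λ) * b := by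
          refine add_le_add ((sum_lintegral_smoothSum_low_le h hd hΩ hom hi hB hS hq
            (t := fun s => ρ s ^ 2) (fun s => by have := hρ s; positivity) (fun s => ?_)
            hη N).trans ?_) ((sum_lintegral_plainSum_high_le h hd hΩ hom hB hS hq hW N).trans ?_)
          · simp only [ρ]
            rw [h2, ← inv_pow, inv_pow, inv_pow, ← div_eq_mul_inv, le_div_iff₀ (by positivity),
              ← pow_mul, ← pow_add]
            exact pow_le_pow_right₀ hq.le (by omega)
          · gcongr
            exact hΩW.trans (ENNReal.ofReal_le_ofReal hWΛ)
          · gcongr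
      _ = CE * (ENNReal.ofReal Λ * b) := by ring
      _ ≤ _ := by gcongr; exact le_add_self

end smallSum

section weakType
variable {d : ℕ} {r L : ℝ} {Ξ : ℝ → ℝ} {Ω : EuclideanSpace ℝ (Fin d) → ℝ}

theorem exists_sum_sum_eq (F S : Finset ℤ) : ∃ N : ℕ, ∀ u : ℤ → ℤ → ℂ,
    (∀ j ∈ F, ∀ k ∈ S, j ≤ k → u j k = 0) → ∑ k ∈ S, ∑ j ∈ F, u j k =
      ∑ s ∈ Finset.Icc 1 N, ∑ k ∈ S with k + (s : ℤ) ∈ F, u (k + s) k := by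
  refine ⟨F.sup fun j => S.sup fun k => (j - k).toNat, fun u hu => ?_⟩
  simp only [Finset.sum_filter]
  rw [Finset.sum_comm]
  conv_rhs => rw [Finset.sum_comm]
  conv_lhs => rw [Finset.sum_comm]
  refine Finset.sum_congr rfl fun k hk => ?_
  rw [← Finset.sum_filter, ← Finset.sum_filter_of_ne (p := fun j => k < j)
    fun j hj h => not_le.1 fun h' => h (hu j hj k hk h')]
  refine Finset.sum_bij' (fun j _ => (j - k).toNat) (fun s _ => k + s) ?_ ?_ ?_ ?_ ?_
  · intro j hj
    rw [Finset.mem_filter] at hj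
    rw [Finset.mem_filter, Finset.mem_Icc]
    have h1 : (j - k).toNat ≤ S.sup fun k => (j - k).toNat :=
      Finset.le_sup (f := fun k => (j - k).toNat) hk
    have h2 := Finset.le_sup (f := fun j => S.sup fun k => (j - k).toNat) hj.1
    refine ⟨⟨by omega, h1.trans h2⟩, ?_⟩
    convert hj.1
    omega
  · intro s hs
    rw [Finset.mem_filter, Finset.mem_Icc] at hs
    rw [Finset.mem_filter]
    exact ⟨hs.2, by omega⟩
  · intro j hj
    rw [Finset.mem_filter] at hj
    omega
  · intro s _
    simp
  · intro j hj
    rw [Finset.mem_filter] at hj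
    congr 1
    omega

theorem measure_le_norm_le {R : EuclideanSpace ℝ (Fin d) → ℂ} (hR : Measurable R) {c : ℝ}
    (hc : 0 < c) : volume {x | c ≤ ‖R x‖} ≤ (ENNReal.ofReal c)⁻¹ * ∫⁻ x, ‖R x‖ₑ := by
  have e : {x | c ≤ ‖R x‖} = {x | ENNReal.ofReal c ≤ ‖R x‖ₑ} := by
    ext x
    simp only [Set.mem_ofPred_eq, ← ofReal_norm, ENNReal.ofReal_le_ofReal_iff (norm_nonneg _)]
  rw [e, mul_comm, ← div_eq_mul_inv]
  exact meas_ge_le_lintegral_div hR.enorm.aemeasurable (by simpa using hc) ENNReal.ofReal_ne_top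

theorem measure_le_norm_le_sq {R : EuclideanSpace ℝ (Fin d) → ℂ} (hR : Measurable R) {c : ℝ}
    (hc : 0 < c) : volume {x | c ≤ ‖R x‖} ≤ (ENNReal.ofReal (c ^ 2))⁻¹ * ∫⁻ x, ‖R x‖ₑ ^ 2 := by
  have e : {x | c ≤ ‖R x‖} = {x | ENNReal.ofReal (c ^ 2) ≤ ‖R x‖ₑ ^ 2} := by
    ext x
    simp only [Set.mem_ofPred_eq, ← ofReal_norm, ← ENNReal.ofReal_pow (norm_nonneg _),
      ENNReal.ofReal_le_ofReal_iff (sq_nonneg _)]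
    exact (pow_le_pow_iff_left₀ hc.le (norm_nonneg _) two_ne_zero).symm
  rw [e, mul_comm, ← div_eq_mul_inv]
  exact meas_ge_le_lintegral_div (hR.enorm.pow_const 2).aemeasurable
    (by simpa using hc.ne') ENNReal.ofReal_ne_top

theorem IsCutoff.cv_kern_eq_zero (h : IsCutoff L Ξ) {B : EuclideanSpace ℝ (Fin d) → ℂ}
    {U : Set (EuclideanSpace ℝ (Fin d))} (hB : ∀ y, B y ≠ 0 → y ∈ U) {j k : ℤ} (hjk : j ≤ k)
    {x : EuclideanSpace ℝ (Fin d)} (hx : ∀ y ∈ U, L * 2 ^ k < ‖x - y‖) :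
    cv (kern r (bump Ξ) Ω j) B x = 0 := by
  have : ∀ y, kern r (bump Ξ) Ω j (x - y) * B y = 0 := fun y => by
    by_cases hy : B y = 0
    · rw [hy, mul_zero]
    · rw [h.kern_eq_zero (Or.inr ?_), zero_mul]
      refine le_trans ?_ (hx y (hB y hy)).le
      have := h.one_le
      gcongr
      norm_num
  simp [cv, this]

theorem cv_add_right {K B₁ B₂ : EuclideanSpace ℝ (Fin d) → ℂ} (hK : Integrable K)
    (h₁ : Measurable B₁) (h₂ : Measurable B₂) {D₁ D₂ : ℝ} (hD₁ : ∀ x, ‖B₁ x‖ ≤ D₁)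
    (hD₂ : ∀ x, ‖B₂ x‖ ≤ D₂) (x : EuclideanSpace ℝ (Fin d)) :
    cv K (fun x => B₁ x + B₂ x) x = cv K B₁ x + cv K B₂ x := by
  simp only [cv, mul_add]
  exact integral_add (integrable_cv_integrand hK h₁ hD₁ x) (integrable_cv_integrand hK h₂ hD₂ x)

theorem badPart_ne_zero {f : EuclideanSpace ℝ (Fin d) → ℂ} {a : ℝ≥0∞} {k : ℤ}
    {y : EuclideanSpace ℝ (Fin d)} (h : badPart f a k y ≠ 0) :
    y ∈ stopSet (fun x => ‖f x‖ₑ) a k := by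
  by_contra h'
  exact h (Set.indicator_of_notMem h' _)

theorem lintegral_sq_le_of_le {g : EuclideanSpace ℝ (Fin d) → ℂ} {D : ℝ≥0∞} (hD : D ≠ ∞)
    (hg : ∀ x, ‖g x‖ₑ ≤ D) : ∫⁻ x, ‖g x‖ₑ ^ 2 ≤ D * ∫⁻ x, ‖g x‖ₑ := by
  rw [← lintegral_const_mul' _ _ hD]
  refine lintegral_mono fun x => ?_
  rw [pow_two]
  exact mul_le_mul_left (hg x) _

theorem ofReal_scaling_le {W Λ lam : ℝ} (hW : 0 < W) (hWΛ : W ≤ Λ) (hlam : 0 < lam) :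
    (ENNReal.ofReal ((lam / 3) ^ 2))⁻¹ *
      (ENNReal.ofReal W ^ 2 * ENNReal.ofReal (lam / Λ)) ≤ 9 * ENNReal.ofReal (Λ / lam) := by
  have hΛ : 0 < Λ := hW.trans_le hWΛ
  rw [← ENNReal.ofReal_inv_of_pos (by positivity), ← ENNReal.ofReal_pow hW.le,
    ← ENNReal.ofReal_mul (by positivity), ← ENNReal.ofReal_mul (by positivity),
    show (9 : ℝ≥0∞) = ENNReal.ofReal 9 by simp, ← ENNReal.ofReal_mul (by positivity)]
  refine ENNReal.ofReal_le_ofReal ?_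
  calc ((lam / 3) ^ 2)⁻¹ * (W ^ 2 * (lam / Λ)) ≤ ((lam / 3) ^ 2)⁻¹ * (Λ ^ 2 * (lam / Λ)) := by
        gcongr
    _ = 9 * (Λ / lam) := by field_simp; norm_num

set_option maxHeartbeats 1000000 in
theorem IsCutoff.exists_weak_bound (h : IsCutoff L Ξ) (h0 : ∫ t, hprof r (bump Ξ) t = 0)
    (hd : 1 ≤ d) :
    ∃ C : ℝ≥0∞, C ≠ ∞ ∧ ∀ Ω : EuclideanSpace ℝ (Fin d) → ℝ, Measurable Ω → IsHomogZero Ω →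
      Integrable (fun θ : sphere (0 : EuclideanSpace ℝ (Fin d)) 1 => Ω θ) (sphereMeasure d) →
      ∀ W Λ : ℝ, 0 < W → W ≤ Λ →
      ∫⁻ θ : sphere (0 : EuclideanSpace ℝ (Fin d)) 1, ‖Ω θ‖ₑ ∂(sphereMeasure d) ≤
        ENNReal.ofReal W →
      ∫⁻ θ : sphere (0 : EuclideanSpace ℝ (Fin d)) 1,
        ‖Ω θ‖ₑ * ENNReal.ofReal (max (Real.log (|Ω θ| / W)) 0) ∂(sphereMeasure d) ≤
        ENNReal.ofReal Λ →
      ∀ F : Finset ℤ, ∀ f : EuclideanSpace ℝ (Fin d) → ℂ, Continuous f → HasCompactSupport f →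
      ∀ lam : ℝ, 0 < lam →
      volume {x | lam < ‖cv (fun x => ∑ j ∈ F, kern r (bump Ξ) Ω j x) f x‖} ≤
        C * (ENNReal.ofReal (Λ / lam) * ∫⁻ x, ‖f x‖ₑ) := by
  obtain ⟨C₁, hC₁, H₁⟩ := h.exists_bad_decomposition hd r
  obtain ⟨C₂, hC₂, H₂⟩ := h.exists_lintegral_cv_sum_kern_sq_le h0
  obtain ⟨C₃, hC₃, H₃⟩ := exists_exceptional_set d L
  refine ⟨C₃ + (C₂ * (9 * 2 ^ d * 3) + (C₁ * (9 * 2 ^ (d + 1) * 2) + C₁ * 6)), by finiteness,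
    fun Ω hΩ hom hi W Λ hW hWΛ hΩW hΩΛ F f hf hfc lam hlam => ?_⟩
  have hΛ : 0 < Λ := hW.trans_le hWΛ
  have hα : 0 < lam / Λ := by positivity
  set a := ENNReal.ofReal (lam / Λ) with ha
  have ha0 : a ≠ 0 := by simpa [ha] using hα
  have hat : a ≠ ∞ := ENNReal.ofReal_ne_top
  have hfi : Integrable f := hf.integrable_of_hasCompactSupport hfc
  obtain ⟨D, hD⟩ := hfc.exists_bound_of_continuous hf
  obtain ⟨S, hS⟩ := exists_calderonZygmund hd hf hfc hα
  set B := badPart f a with hBdef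
  have hB : IsBadFamily S B (2 ^ (d + 1) * a) := isBadFamily_badPart hf.measurable hfi hD a S
  have hb : ∑ k ∈ S, ∫⁻ x, ‖B k x‖ₑ ≤ 2 * ∫⁻ x, ‖f x‖ₑ := sum_lintegral_badPart_le hf.measurable a S
  obtain ⟨D', hD'⟩ := hB.bounded
  obtain ⟨X, hXm, hX, hXS⟩ := H₃ (fun x => ‖f x‖ₑ) hf.measurable.enorm a ha0 hat S
  obtain ⟨N, hN⟩ := exists_sum_sum_eq F S
  let S' : ℕ → Finset ℤ := fun s => S.filter fun k => k + (s : ℤ) ∈ F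
  obtain ⟨R, E, hRm, hEm, hRE, hR, hE⟩ := H₁ Ω hΩ hom hi W Λ hW hWΛ hΩW hΩΛ S B _ hB S'
    (fun s => Finset.filter_subset _ _) N
  set b := ∑ k ∈ S, ∫⁻ x, ‖B k x‖ₑ
  set n := ∫⁻ x, ‖f x‖ₑ
  set K : EuclideanSpace ℝ (Fin d) → ℂ := fun x => ∑ j ∈ F, kern r (bump Ξ) Ω j x with hK
  have hKj : ∀ j, Integrable (kern r (bump Ξ) Ω j) := fun j => h.integrable_kern hd hΩ hom hi j
  have hKm : Measurable K := Finset.measurable_sum _ fun j _ => h.measurable_kern hΩ j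
  have hKi : Integrable K := integrable_finsetSum _ fun j _ => hKj j
  let g : EuclideanSpace ℝ (Fin d) → ℂ := fun x => f x - ∑ k ∈ S, B k x
  have hsm : Measurable fun x => ∑ k ∈ S, B k x := Finset.measurable_sum _ fun k _ => hB.measurable k
  have hsi : Integrable fun x => ∑ k ∈ S, B k x := integrable_finsetSum _ fun k _ => hB.integrable k
  have hgm : Measurable g := hf.measurable.sub hsm
  have hgi : Integrable g := hfi.sub hsi
  have hgb : ∀ x, ‖g x‖ ≤ 2 ^ d * (lam / Λ) := fun x => by
    have := hS x
    rw [← ofReal_norm, show (2 : ℝ≥0∞) ^ d = ENNReal.ofReal (2 ^ d) by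
      rw [ENNReal.ofReal_pow (by norm_num)]; simp, ← ENNReal.ofReal_mul (by positivity)] at this
    exact (ENNReal.ofReal_le_ofReal_iff (by positivity)).1 this
  have hg1 : ∫⁻ x, ‖g x‖ₑ ≤ 3 * n := by
    calc ∫⁻ x, ‖g x‖ₑ ≤ ∫⁻ x, (‖f x‖ₑ + ∑ k ∈ S, ‖B k x‖ₑ) :=
          lintegral_mono fun x => (enorm_sub_le).trans (add_le_add_right (enorm_sum_le _ _) _)
      _ = n + b := by
          rw [lintegral_add_left hf.measurable.enorm,
            lintegral_finsetSum _ fun k _ => (hB.measurable k).enorm]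
      _ ≤ n + 2 * n := add_le_add_right hb _
      _ = 3 * n := by ring
  have hg2 : ∫⁻ x, ‖g x‖ₑ ^ 2 ≤ 2 ^ d * a * (3 * n) :=
    (lintegral_sq_le_of_le (by finiteness) hS).trans (mul_le_mul_right hg1 _)
  have hsb : ∀ x, ‖∑ k ∈ S, B k x‖ ≤ ∑ k ∈ S, D' := fun x =>
    (norm_sum_le _ _).trans (Finset.sum_le_sum fun k _ => hD' k x)
  have key : ∀ x ∉ X, cv K f x = cv K g x + (R x + E x) := fun x hx => by
    have e : f = fun x => g x + ∑ k ∈ S, B k x := by ext x; simp [g]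
    conv_lhs => rw [e]
    rw [cv_add_right hKi hgm hsm hgb hsb, cv_sum_right hKi hB.measurable hD', ← hRE]
    congr 1
    have : ∀ k, cv K (B k) x = ∑ j ∈ F, cv (kern r (bump Ξ) Ω j) (B k) x := fun k =>
      cv_sum_left hKj (hB.measurable k) (hD' k) x
    simp only [this]
    refine hN (fun j k => cv (kern r (bump Ξ) Ω j) (B k) x) fun j _ k hk hjk => ?_
    refine h.cv_kern_eq_zero (fun y hy => badPart_ne_zero hy) hjk fun y hy => ?_
    by_contra! hxy
    exact hx (hXS k hk x y hy hxy)
  have hsub : {x | lam < ‖cv K f x‖} ⊆ X ∪ ({x | lam / 3 ≤ ‖cv K g x‖} ∪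
      ({x | lam / 3 ≤ ‖R x‖} ∪ {x | lam / 3 ≤ ‖E x‖})) := fun x hx => by
    by_contra hx'
    simp only [Set.mem_union, Set.mem_ofPred_eq, not_or, not_le] at hx' hx
    rw [key x hx'.1] at hx
    linarith [norm_add_le (cv K g x) (R x + E x), norm_add_le (R x) (E x), hx'.2.1, hx'.2.2.1,
      hx'.2.2.2]
  have hl3 : 0 < lam / 3 := by positivity
  set p := ENNReal.ofReal (Λ / lam) with hp
  have hsc := ofReal_scaling_le hW hWΛ hlam
  rw [← ha, ← hp] at hsc
  set c := (ENNReal.ofReal ((lam / 3) ^ 2))⁻¹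
  set w := ENNReal.ofReal W
  have hap : a⁻¹ = p := by
    rw [ha, hp, ← ENNReal.ofReal_inv_of_pos hα, inv_div]
  have hb1 : volume {x | lam / 3 ≤ ‖cv K g x‖} ≤ C₂ * (9 * 2 ^ d * 3) * (p * n) := by
    refine (measure_le_norm_le_sq (measurable_cv hKm hgm) hl3).trans ?_
    calc c * ∫⁻ x, ‖cv K g x‖ₑ ^ 2 ≤ c * (C₂ * w ^ 2 * (2 ^ d * a * (3 * n))) := by
          gcongr
          refine (H₂ d hd Ω hΩ hom hi F g hgi _ hgb).trans ?_
          gcongr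
      _ = (c * (w ^ 2 * a)) * (C₂ * 2 ^ d * 3 * n) := by ring
      _ ≤ 9 * p * (C₂ * 2 ^ d * 3 * n) := by gcongr
      _ = _ := by ring
  have hb2 : volume {x | lam / 3 ≤ ‖R x‖} ≤ C₁ * (9 * 2 ^ (d + 1) * 2) * (p * n) := by
    refine (measure_le_norm_le_sq hRm hl3).trans ?_
    calc c * ∫⁻ x, ‖R x‖ₑ ^ 2 ≤ c * (C₁ * (w ^ 2 * (2 ^ (d + 1) * a) * (2 * n))) := by
          gcongr
          refine hR.trans ?_
          gcongr
      _ = (c * (w ^ 2 * a)) * (C₁ * 2 ^ (d + 1) * 2 * n) := by ring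
      _ ≤ 9 * p * (C₁ * 2 ^ (d + 1) * 2 * n) := by gcongr
      _ = _ := by ring
  have hb3 : volume {x | lam / 3 ≤ ‖E x‖} ≤ C₁ * 6 * (p * n) := by
    refine (measure_le_norm_le hEm hl3).trans ?_
    calc _ ≤ (ENNReal.ofReal (lam / 3))⁻¹ * (C₁ * (ENNReal.ofReal Λ * (2 * n))) := by
          gcongr
          refine hE.trans ?_
          gcongr
      _ = ((ENNReal.ofReal (lam / 3))⁻¹ * ENNReal.ofReal Λ) * (C₁ * 2 * n) := by ring
      _ = 3 * p * (C₁ * 2 * n) := by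
          congr 1
          rw [← ENNReal.ofReal_inv_of_pos hl3, ← ENNReal.ofReal_mul (by positivity), hp,
            show (3 : ℝ≥0∞) = ENNReal.ofReal 3 by simp, ← ENNReal.ofReal_mul (by positivity)]
          congr 1
          field_simp
      _ = _ := by ring
  rw [hap] at hX
  refine (measure_mono hsub).trans ((measure_union_le _ _).trans ?_)
  refine (add_le_add hX ((measure_union_le _ _).trans (add_le_add hb1
    ((measure_union_le _ _).trans (add_le_add hb2 hb3))))).trans_eq ?_
  ring

end weakType

section truncatedOperator
variable {d : ℕ} {r L δ : ℝ} {Ξ : ℝ → ℝ} {Ω : EuclideanSpace ℝ (Fin d) → ℝ}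

/-- The radial profile of the difference between the smooth and the sharp truncation at scale `δ`. -/
def coreProfile (L δ : ℝ) (Ξ : ℝ → ℝ) : ℝ → ℝ :=
  {t | t ≤ L * δ}.indicator fun t => 1 - Ξ (δ⁻¹ * t)

theorem IsCutoff.measurable_coreProfile (h : IsCutoff L Ξ) : Measurable (coreProfile L δ Ξ) := by
  have := h.smooth.continuous
  exact Measurable.indicator (by fun_prop) measurableSet_Iic

theorem IsCutoff.abs_coreProfile_le (h : IsCutoff L Ξ) (hδ : 0 < δ) (t : ℝ) :
    |coreProfile L δ Ξ t| ≤ (Set.Icc 0 (L * δ)).indicator (fun _ => δ⁻¹ * t) t := by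
  by_cases ht : t ≤ L * δ
  · rw [coreProfile, Set.indicator_of_mem (s := {t | t ≤ L * δ}) ht]
    by_cases h0 : 0 ≤ t
    · rw [Set.indicator_of_mem (s := Set.Icc 0 (L * δ)) ⟨h0, ht⟩]
      by_cases h1 : δ⁻¹ * t ≤ 1
      · rw [h.eq_one _ h1, sub_self, abs_zero]
        positivity
      · have h2 := h.nonneg (δ⁻¹ * t)
        have h3 := h.le_one (δ⁻¹ * t)
        rw [abs_of_nonneg (by linarith)]
        linarith
    · have : δ⁻¹ * t ≤ 0 := mul_nonpos_of_nonneg_of_nonpos (by positivity) (not_le.1 h0).le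
      rw [h.eq_one _ (by linarith), sub_self, abs_zero, Set.indicator_of_notMem]
      exact fun h' => h0 h'.1
  · rw [coreProfile, Set.indicator_of_notMem (s := {t | t ≤ L * δ}) ht, Set.indicator_of_notMem,
      abs_zero]
    exact fun h' => ht h'.2

theorem IsCutoff.lintegral_radKern_coreProfile_le (h : IsCutoff L Ξ) (hd : 1 ≤ d) (hδ : 0 < δ)
    (hΩ : Measurable Ω) (hom : IsHomogZero Ω) :
    ∫⁻ x, ‖radKern r (coreProfile L δ Ξ) Ω x‖ₑ ≤
      (∫⁻ θ : sphere (0 : EuclideanSpace ℝ (Fin d)) 1, ‖Ω θ‖ₑ ∂(sphereMeasure d)) *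
        ENNReal.ofReal L := by
  rw [lintegral_radKern hd h.measurable_coreProfile hΩ hom]
  gcongr
  calc _ ≤ ∫⁻ t in Set.Ioi (0 : ℝ), (Set.Icc 0 (L * δ)).indicator
          (fun _ => ENNReal.ofReal δ⁻¹) t := by
        refine setLIntegral_mono' measurableSet_Ioi fun t ht => ?_
        have ht' : 0 < t := ht
        have := h.abs_coreProfile_le hδ t
        rw [← ofReal_norm, hprof, norm_mul, norm_cexp_neg_I_mul, mul_one, Complex.norm_real, norm_div,
          Real.norm_eq_abs, Real.norm_of_nonneg ht'.le]
        by_cases htL : t ∈ Set.Icc 0 (L * δ)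
        · rw [Set.indicator_of_mem htL] at this ⊢
          apply ENNReal.ofReal_le_ofReal
          rwa [div_le_iff₀ ht']
        · rw [Set.indicator_of_notMem htL] at this ⊢
          rw [le_antisymm this (abs_nonneg _)]
          simp
    _ ≤ ∫⁻ t, (Set.Icc 0 (L * δ)).indicator (fun _ => ENNReal.ofReal δ⁻¹) t :=
        setLIntegral_le_lintegral _ _
    _ = _ := by
        rw [lintegral_indicator_const measurableSet_Icc, Real.volume_Icc,
          ← ENNReal.ofReal_mul (by positivity)]
        congr 1
        field_simp
        ring

theorem integral_radKern_eq_zero {m : ℝ → ℝ} (hd : 1 ≤ d) (hom : IsHomogZero Ω)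
    (hi : Integrable (radKern r m Ω))
    (h0 : ∫ θ : sphere (0 : EuclideanSpace ℝ (Fin d)) 1, Ω θ ∂(sphereMeasure d) = 0) :
    ∫ x, radKern r m Ω x = 0 := by
  rw [integral_polar hd hi]
  have : ∀ θ : sphere (0 : EuclideanSpace ℝ (Fin d)) 1, (∫ t in Set.Ioi (0 : ℝ),
      t ^ (d - 1) • radKern r m Ω (t • (θ : EuclideanSpace ℝ (Fin d)))) =
      (Ω θ : ℂ) * ∫ t in Set.Ioi (0 : ℝ), hprof r m t := fun θ => by
    rw [← integral_const_mul]
    exact setIntegral_congr_fun measurableSet_Ioi fun t ht => smul_radKern hd hom θ ht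
  simp only [this]
  rw [integral_mul_const, integral_complex_ofReal, h0]
  simp

theorem sum_kern {ψ : ℝ → ℝ} (F : Finset ℤ) (x : EuclideanSpace ℝ (Fin d)) :
    ∑ j ∈ F, kern r ψ Ω j x = radKern r (fun t => ∑ j ∈ F, ψ ((2 ^ j)⁻¹ * t)) Ω x := by
  simp only [kern, radKern]
  rw [← Finset.sum_mul, Finset.mul_sum, Finset.sum_div, Complex.ofReal_sum]

/-- The scales `-J, …, J`. -/
def scales (J : ℕ) : Finset ℤ := (Finset.range (2 * J + 1)).image fun i : ℕ => (i : ℤ) - J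

theorem sum_scales_bump (J : ℕ) (t : ℝ) :
    ∑ j ∈ scales J, bump Ξ ((2 ^ j)⁻¹ * t) = Ξ ((2 ^ J)⁻¹ * t) - Ξ (2 ^ (J + 1) * t) := by
  rw [scales, Finset.sum_image fun a _ b _ hab => by simpa using hab]
  have := Finset.sum_range_sub (fun i : ℕ => Ξ (((2 : ℝ) ^ ((i : ℤ) - J - 1))⁻¹ * t)) (2 * J + 1)
  have e1 : ((2 * J + 1 : ℕ) : ℤ) - J - 1 = J := by push_cast; ring
  have e2 : ((0 : ℕ) : ℤ) - J - 1 = -((J + 1 : ℕ) : ℤ) := by push_cast; ring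
  rw [e1, e2, zpow_neg, inv_inv, zpow_natCast, zpow_natCast] at this
  rw [← this]
  refine Finset.sum_congr rfl fun i _ => ?_
  have e3 : ((i + 1 : ℕ) : ℤ) - J - 1 = i - J := by push_cast; ring
  rw [bump, e3, zpow_sub_one₀ two_ne_zero, mul_inv, inv_inv]
  congr 2
  ring

theorem IsCutoff.sum_scales_bump_eq (h : IsCutoff L Ξ) {J : ℕ} {t : ℝ} (ht : t ≤ 2 ^ J) :
    ∑ j ∈ scales J, bump Ξ ((2 ^ j)⁻¹ * t) =
      {t | L * (2 ^ (J + 1))⁻¹ < t}.indicator 1 t + coreProfile L (2 ^ (J + 1))⁻¹ Ξ t := by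
  have h2 : (0 : ℝ) < 2 ^ (J + 1) := by positivity
  rw [sum_scales_bump, h.eq_one _ (by rw [inv_mul_le_iff₀ (by positivity)]; simpa using ht),
    coreProfile, inv_inv]
  by_cases hc : t ≤ L * (2 ^ (J + 1))⁻¹
  · rw [Set.indicator_of_notMem (s := {t : ℝ | L * (2 ^ (J + 1))⁻¹ < t}) (not_lt.2 hc),
      Set.indicator_of_mem (s := {t | t ≤ L * (2 ^ (J + 1))⁻¹}) hc, zero_add]
  · rw [Set.indicator_of_mem (s := {t : ℝ | L * (2 ^ (J + 1))⁻¹ < t}) (not_le.1 hc),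
      Set.indicator_of_notMem (s := {t | t ≤ L * (2 ^ (J + 1))⁻¹}) hc, h.eq_zero]
    · simp
    · rw [not_le, ← div_eq_mul_inv, div_lt_iff₀ h2] at hc
      linarith

theorem tendsto_cv_of_cancel {K : ℕ → EuclideanSpace ℝ (Fin d) → ℂ} (hK : ∀ J, Integrable (K J))
    (h0 : ∀ J, ∫ x, K J x = 0) {A : ℝ≥0∞} (hA : A ≠ ∞) (hKA : ∀ J, ∫⁻ x, ‖K J x‖ₑ ≤ A)
    {δ : ℕ → ℝ} (hδ : Tendsto δ atTop (𝓝 0)) (hs : ∀ J x, δ J < ‖x‖ → K J x = 0)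
    {f : EuclideanSpace ℝ (Fin d) → ℂ} (hf : Continuous f) (hfc : HasCompactSupport f)
    (x : EuclideanSpace ℝ (Fin d)) : Tendsto (fun J => cv (K J) f x) atTop (𝓝 0) := by
  obtain ⟨D, hD⟩ := hfc.exists_bound_of_continuous hf
  have e : ∀ J, cv (K J) f x = ∫ y, K J (x - y) * (f y - f x) := fun J => by
    have h1 : ∫ y, K J (x - y) * f x = 0 := by
      rw [integral_mul_const, integral_sub_left_eq_self, h0, zero_mul]
    simp only [mul_sub]
    rw [integral_sub (integrable_cv_integrand (hK J) hf.measurable hD x)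
      (((hK J).comp_sub_left x).mul_const _), h1, sub_zero, cv]
  rw [Metric.tendsto_atTop]
  intro ε hε
  set c := ε / (A.toReal + 1) with hc
  have hA0 : 0 ≤ A.toReal := ENNReal.toReal_nonneg
  have hc0 : 0 < c := by positivity
  obtain ⟨κ, hκ, hfκ⟩ := Metric.continuous_iff.1 hf x c hc0
  obtain ⟨N, hN⟩ := (hδ.eventually (gt_mem_nhds hκ)).exists_forall_of_atTop
  refine ⟨N, fun J hJ => ?_⟩
  rw [dist_zero_right, e]
  have hmass : ∫ y, ‖K J (x - y)‖ ≤ A.toReal := by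
    rw [integral_sub_left_eq_self (fun y => ‖K J y‖), integral_norm_eq_lintegral_enorm
      (hK J).aestronglyMeasurable]
    exact ENNReal.toReal_mono hA (hKA J)
  calc ‖∫ y, K J (x - y) * (f y - f x)‖ ≤ ∫ y, ‖K J (x - y)‖ * c := by
        refine norm_integral_le_of_norm_le (((hK J).comp_sub_left x).norm.mul_const _)
          (Eventually.of_forall fun y => ?_)
        rw [norm_mul]
        by_cases hy : ‖x - y‖ ≤ δ J
        · gcongr
          rw [← dist_eq_norm]
          refine (hfκ y ?_).le
          rw [dist_comm, dist_eq_norm]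
          exact hy.trans_lt (hN J hJ)
        · rw [hs J _ (not_le.1 hy)]; simp
    _ ≤ A.toReal * c := by
        rw [integral_mul_const]
        gcongr
    _ < ε := by
        rw [hc, mul_div_assoc', div_lt_iff₀ (by positivity)]
        nlinarith

theorem IsCutoff.tendsto_cv (h : IsCutoff L Ξ) (hd : 1 ≤ d) (hΩ : Measurable Ω)
    (hom : IsHomogZero Ω)
    (hi : Integrable (fun θ : sphere (0 : EuclideanSpace ℝ (Fin d)) 1 => Ω θ) (sphereMeasure d))
    (h0 : ∫ θ : sphere (0 : EuclideanSpace ℝ (Fin d)) 1, Ω θ ∂(sphereMeasure d) = 0)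
    {f : EuclideanSpace ℝ (Fin d) → ℂ} (hf : Continuous f) (hfc : HasCompactSupport f)
    (x : EuclideanSpace ℝ (Fin d)) {ℓ : ℂ}
    (hT : Tendsto (fun ε : ℝ => ∫ y in {y : EuclideanSpace ℝ (Fin d) | ε < ‖x - y‖},
      ((Ω (x - y) / ‖x - y‖ ^ d : ℝ) : ℂ) *
        Complex.exp (-(Complex.I * r * Real.log ‖x - y‖)) * f y) (𝓝[>] 0) (𝓝 ℓ)) :
    Tendsto (fun J => cv (fun x => ∑ j ∈ scales J, kern r (bump Ξ) Ω j x) f x) atTop (𝓝 ℓ) := by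
  have hL : 0 < L := zero_lt_one.trans_le h.one_le
  obtain ⟨D, hD⟩ := hfc.exists_bound_of_continuous hf
  let δ : ℕ → ℝ := fun J => (2 ^ (J + 1))⁻¹
  have hδ0 : ∀ J, 0 < δ J := fun J => by positivity
  have hLδ : Tendsto (fun J => L * δ J) atTop (𝓝 0) := by
    have : Tendsto (fun J : ℕ => ((2 : ℝ) ^ (J + 1))⁻¹) atTop (𝓝 0) :=
      ((tendsto_inv_atTop_zero (𝕜 := ℝ)).comp (tendsto_pow_atTop_atTop_of_one_lt one_lt_two)).comp
        (tendsto_add_atTop_nat 1)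
    simpa using this.const_mul L
  have hLδ' : Tendsto (fun J => L * δ J) atTop (𝓝[>] 0) :=
    tendsto_nhdsWithin_iff.2 ⟨hLδ, Eventually.of_forall fun J => mul_pos hL (hδ0 J)⟩
  have hcm : ∀ J, Measurable (radKern r (coreProfile L (δ J) Ξ) Ω) := fun J =>
    measurable_radKern h.measurable_coreProfile hΩ
  have hcl : ∀ J, ∫⁻ x, ‖radKern r (coreProfile L (δ J) Ξ) Ω x‖ₑ ≤ _ := fun J =>
    h.lintegral_radKern_coreProfile_le hd (hδ0 J) hΩ hom
  have hfin : (∫⁻ θ : sphere (0 : EuclideanSpace ℝ (Fin d)) 1, ‖Ω θ‖ₑ ∂(sphereMeasure d)) *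
      ENNReal.ofReal L ≠ ∞ := ENNReal.mul_ne_top hi.2.ne ENNReal.ofReal_ne_top
  have hci : ∀ J, Integrable (radKern r (coreProfile L (δ J) Ξ) Ω) := fun J =>
    ⟨(hcm J).aestronglyMeasurable, (hcl J).trans_lt hfin.lt_top⟩
  have hcore := tendsto_cv_of_cancel hci (fun J => integral_radKern_eq_zero hd hom (hci J) h0)
    hfin hcl hLδ (fun J x hx => by
      have : coreProfile L (δ J) Ξ ‖x‖ = 0 :=
        Set.indicator_of_notMem (s := {t | t ≤ L * δ J}) (not_le.2 hx) _
      simp [radKern, this]) hf hfc x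
  have hsum := (hT.comp hLδ').add hcore
  rw [add_zero] at hsum
  refine hsum.congr' ?_
  obtain ⟨ρ, hρ⟩ : ∃ ρ, ∀ y, f y ≠ 0 → ‖x - y‖ ≤ ρ := by
    obtain ⟨ρ, hρ⟩ := hfc.isCompact.isBounded.exists_norm_le
    exact ⟨‖x‖ + ρ, fun y hy => (norm_sub_le _ _).trans
      (add_le_add_right (hρ y (subset_tsupport f hy)) _)⟩
  filter_upwards [(tendsto_pow_atTop_atTop_of_one_lt (one_lt_two (α := ℝ))).eventually_ge_atTop ρ]
    with J hJ
  have hKi : Integrable fun x => ∑ j ∈ scales J, kern r (bump Ξ) Ω j x :=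
    integrable_finsetSum _ fun j _ => h.integrable_kern hd hΩ hom hi j
  have hms : MeasurableSet {y : EuclideanSpace ℝ (Fin d) | L * δ J < ‖x - y‖} :=
    measurableSet_lt measurable_const (by fun_prop)
  rw [Function.comp_apply, ← integral_indicator hms, ← eq_sub_iff_add_eq, cv, cv,
    ← integral_sub (integrable_cv_integrand hKi hf.measurable hD x)
      (integrable_cv_integrand (hci J) hf.measurable hD x)]
  refine integral_congr_ae (Eventually.of_forall fun y => ?_)
  by_cases hy : f y = 0
  · simp [hy, Set.indicator]
  · dsimp only
    rw [sum_kern, ← sub_mul]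
    simp only [radKern]
    rw [h.sum_scales_bump_eq ((hρ y hy).trans hJ), ← sub_mul, ← Complex.ofReal_sub, mul_add, add_div,
      add_sub_cancel_right]
    by_cases hy' : L * δ J < ‖x - y‖
    · rw [Set.indicator_of_mem (s := {y | L * δ J < ‖x - y‖}) hy',
        Set.indicator_of_mem (s := {t : ℝ | L * (2 ^ (J + 1))⁻¹ < t}) hy']
      simp
    · rw [Set.indicator_of_notMem (s := {y | L * δ J < ‖x - y‖}) hy',
        Set.indicator_of_notMem (s := {t : ℝ | L * (2 ^ (J + 1))⁻¹ < t}) hy']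
      simp

end truncatedOperator

section orlicz
variable {d : ℕ} {r L : ℝ} {Ξ : ℝ → ℝ} {Ω : EuclideanSpace ℝ (Fin d) → ℝ}

theorem integrable_of_LlogL (hΩ : Measurable Ω)
    (hl : Integrable (fun θ : sphere (0 : EuclideanSpace ℝ (Fin d)) 1 =>
      |Ω θ| * Real.log (2 + |Ω θ|)) (sphereMeasure d)) :
    Integrable (fun θ : sphere (0 : EuclideanSpace ℝ (Fin d)) 1 => Ω θ) (sphereMeasure d) := by
  refine (hl.const_mul (Real.log 2)⁻¹).mono' (hΩ.comp measurable_subtype_coe).aestronglyMeasurable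
    (Eventually.of_forall fun θ => ?_)
  have h2 : 0 < Real.log 2 := Real.log_pos one_lt_two
  rw [Real.norm_eq_abs, ← div_eq_inv_mul, le_div_iff₀ h2]
  gcongr
  linarith [abs_nonneg (Ω θ)]

theorem max_log_div_le (a ℓ : ℝ) :
    max (Real.log (|a| / ℓ)) 0 ≤ Real.log (2 + |a|) + |Real.log ℓ| := by
  have h0 : 0 ≤ Real.log (2 + |a|) := Real.log_nonneg (by linarith [abs_nonneg a])
  refine max_le ?_ (add_nonneg h0 (abs_nonneg _))
  by_cases ha : |a| = 0
  · rw [ha, zero_div, Real.log_zero]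
    rw [ha] at h0
    exact add_nonneg h0 (abs_nonneg _)
  by_cases hℓ : ℓ = 0
  · rw [hℓ, _root_.div_zero, Real.log_zero]
    exact add_nonneg h0 (abs_nonneg _)
  rw [Real.log_div ha hℓ]
  have ha' : 0 < |a| := lt_of_le_of_ne (abs_nonneg _) (Ne.symm ha)
  have h1 : Real.log |a| ≤ Real.log (2 + |a|) := Real.log_le_log ha' (by linarith)
  linarith [neg_abs_le (Real.log ℓ)]

theorem integrable_mul_one_add_log (hΩ : Measurable Ω)
    (hl : Integrable (fun θ : sphere (0 : EuclideanSpace ℝ (Fin d)) 1 =>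
      |Ω θ| * Real.log (2 + |Ω θ|)) (sphereMeasure d)) (ℓ : ℝ) :
    Integrable (fun θ : sphere (0 : EuclideanSpace ℝ (Fin d)) 1 =>
      |Ω θ| * (1 + max (Real.log (|Ω θ| / ℓ)) 0)) (sphereMeasure d) := by
  have hΩ' : Measurable fun θ : sphere (0 : EuclideanSpace ℝ (Fin d)) 1 => Ω θ :=
    hΩ.comp measurable_subtype_coe
  have ha : Measurable fun θ : sphere (0 : EuclideanSpace ℝ (Fin d)) 1 => |Ω θ| := hΩ'.norm
  refine (((integrable_of_LlogL hΩ hl).norm.mul_const (1 + |Real.log ℓ|)).add hl).mono'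
    (Measurable.aestronglyMeasurable (by fun_prop)) (Eventually.of_forall fun θ => ?_)
  have := max_log_div_le (Ω θ) ℓ
  have h0 := le_max_right (Real.log (|Ω θ| / ℓ)) 0
  rw [Real.norm_of_nonneg (by positivity), Pi.add_apply, Real.norm_eq_abs]
  rw [← mul_add]
  exact mul_le_mul_of_nonneg_left (by linarith) (abs_nonneg _)

theorem exists_log_bounds (hΩ : Measurable Ω)
    (hl : Integrable (fun θ : sphere (0 : EuclideanSpace ℝ (Fin d)) 1 =>
      |Ω θ| * Real.log (2 + |Ω θ|)) (sphereMeasure d)) {ε : ℝ} (hε : 0 < ε) :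
    ∃ W, 0 < W ∧ W ≤ COmega d Ω + ε ∧
      ∫⁻ θ : sphere (0 : EuclideanSpace ℝ (Fin d)) 1, ‖Ω θ‖ₑ ∂(sphereMeasure d) ≤
        ENNReal.ofReal W ∧
      ∫⁻ θ : sphere (0 : EuclideanSpace ℝ (Fin d)) 1,
        ‖Ω θ‖ₑ * ENNReal.ofReal (max (Real.log (|Ω θ| / W)) 0) ∂(sphereMeasure d) ≤
        ENNReal.ofReal (COmega d Ω + ε) := by
  have hi := integrable_of_LlogL hΩ hl
  have hs := integrable_mul_one_add_log hΩ hl (sphL1 d Ω)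
  have h0 : 0 ≤ sphL1 d Ω := integral_nonneg fun θ => abs_nonneg _
  have h1 : 0 ≤ sphLlogL d Ω := integral_nonneg fun θ =>
    mul_nonneg (abs_nonneg _) (Real.log_nonneg (by linarith [abs_nonneg (Ω θ)]))
  have hnn : ∀ θ : sphere (0 : EuclideanSpace ℝ (Fin d)) 1,
      0 ≤ |Ω θ| * (1 + max (Real.log (|Ω θ| / sphL1 d Ω)) 0) := fun θ =>
    mul_nonneg (abs_nonneg _) (add_nonneg zero_le_one (le_max_right _ _))
  have h2 : sphL1 d Ω ≤ COmega d Ω := by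
    refine le_trans ?_ (le_add_of_nonneg_left h1)
    refine integral_mono hi.norm hs fun θ => ?_
    exact le_mul_of_one_le_right (abs_nonneg _) (le_add_of_nonneg_right (le_max_right _ _))
  refine ⟨sphL1 d Ω + ε, by linarith, by linarith, ?_, ?_⟩
  · rw [← ofReal_integral_norm_eq_lintegral_enorm hi]
    refine ENNReal.ofReal_le_ofReal ?_
    simp only [Real.norm_eq_abs]
    rw [← sphL1]
    linarith
  · calc _ ≤ ∫⁻ θ : sphere (0 : EuclideanSpace ℝ (Fin d)) 1,
          ENNReal.ofReal (|Ω θ| * (1 + max (Real.log (|Ω θ| / sphL1 d Ω)) 0))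
            ∂(sphereMeasure d) := by
          have hz : ∀ᵐ θ : sphere (0 : EuclideanSpace ℝ (Fin d)) 1 ∂(sphereMeasure d),
              sphL1 d Ω = 0 → Ω θ = 0 := by
            by_cases hz : sphL1 d Ω = 0
            · have := (integral_eq_zero_iff_of_nonneg (fun θ => abs_nonneg _) hi.norm).1 hz
              filter_upwards [this] with θ hθ _
              simpa using hθ
            · exact Eventually.of_forall fun θ h => absurd h hz
          refine lintegral_mono_ae ?_
          filter_upwards [hz] with θ hθ
          by_cases hΩθ : Ω θ = 0
          · simp [hΩθ]
          · have hp : 0 < sphL1 d Ω := lt_of_le_of_ne h0 fun h => hΩθ (hθ h.symm)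
            have ha : 0 < |Ω θ| := abs_pos.2 hΩθ
            rw [← ofReal_norm, Real.norm_eq_abs, ← ENNReal.ofReal_mul (abs_nonneg _)]
            refine ENNReal.ofReal_le_ofReal ?_
            gcongr
            refine le_trans (max_le_max_right 0 (Real.log_le_log (by positivity) ?_))
              (le_add_of_nonneg_left zero_le_one)
            gcongr
            linarith
      _ = ENNReal.ofReal (∫ θ : sphere (0 : EuclideanSpace ℝ (Fin d)) 1,
          |Ω θ| * (1 + max (Real.log (|Ω θ| / sphL1 d Ω)) 0) ∂(sphereMeasure d)) :=
          (ofReal_integral_eq_lintegral_ofReal hs (Eventually.of_forall hnn)).symm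
      _ ≤ _ := by
          refine ENNReal.ofReal_le_ofReal ?_
          rw [COmega]
          linarith

theorem measure_lt_norm_le_of_tendsto {u : ℕ → EuclideanSpace ℝ (Fin d) → ℂ}
    {v : EuclideanSpace ℝ (Fin d) → ℂ} (h : ∀ᵐ x, Tendsto (fun J => u J x) atTop (𝓝 (v x)))
    {lam : ℝ} {b : ℝ≥0∞} (hb : ∀ J, volume {x | lam < ‖u J x‖} ≤ b) :
    volume {x | lam < ‖v x‖} ≤ b := by
  let A : ℕ → Set (EuclideanSpace ℝ (Fin d)) := fun N => {x | ∀ J ≥ N, lam < ‖u J x‖}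
  have hA : Monotone A := fun N N' hN x hx J hJ => hx J (hN.trans hJ)
  calc volume {x | lam < ‖v x‖} ≤ volume (⋃ N, A N) := by
        refine measure_mono_ae ?_
        filter_upwards [h] with x hx hv
        obtain ⟨N, hN⟩ := (hx.norm.eventually (lt_mem_nhds hv)).exists_forall_of_atTop
        exact Set.mem_iUnion.2 ⟨N, hN⟩
    _ = ⨆ N, volume (A N) := hA.measure_iUnion
    _ ≤ b := iSup_le fun N =>
        (measure_mono fun x (hx : x ∈ A N) => hx N le_rfl).trans (hb N)

end orlicz

theorem muckenhoupt_singular_integral_weak11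
    (d : ℕ) (hd : 2 ≤ d) (r : ℝ) (hr : r ≠ 0) (A₀ : ℝ) (hA₀ : 0 < A₀) :
    ∃ C : ℝ, 0 < C ∧
      ∀ (Ω : EuclideanSpace ℝ (Fin d) → ℝ)
        (T : (EuclideanSpace ℝ (Fin d) → ℂ) → EuclideanSpace ℝ (Fin d) → ℂ),
        -- Ω is measurable, homogeneous of degree zero, in L log⁺ L(S^{d-1}),
        -- with vanishing mean on the sphere
        Measurable Ω →
        (∀ ρ : ℝ, 0 < ρ → ∀ x : EuclideanSpace ℝ (Fin d), x ≠ 0 → Ω (ρ • x) = Ω x) →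
        Integrable (fun θ : sphere (0 : EuclideanSpace ℝ (Fin d)) 1 =>
          |Ω θ| * Real.log (2 + |Ω θ|)) (sphereMeasure d) →
        (∫ θ : sphere (0 : EuclideanSpace ℝ (Fin d)) 1, Ω θ ∂(sphereMeasure d)) = 0 →
        -- T f is the a.e. principal value of the Muckenhoupt singular integral:
        -- kernel Ω(x-y)|x-y|^{-d-ir} = Ω(x-y)|x-y|^{-d} e^{-ir log|x-y|}
        (∀ f : EuclideanSpace ℝ (Fin d) → ℂ, ContDiff ℝ (⊤ : ℕ∞) f → HasCompactSupport f →
          ∀ᵐ x : EuclideanSpace ℝ (Fin d) ∂volume,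
            Tendsto (fun ε : ℝ =>
                ∫ y in {y : EuclideanSpace ℝ (Fin d) | ε < ‖x - y‖},
                  ((Ω (x - y) / ‖x - y‖ ^ d : ℝ) : ℂ) *
                    Complex.exp (-(Complex.I * r * Real.log ‖x - y‖)) * f y)
              (𝓝[>] 0) (𝓝 (T f x))) →
        -- Muckenhoupt's L² bound (Theorem H)
        (∀ f : EuclideanSpace ℝ (Fin d) → ℂ, ContDiff ℝ (⊤ : ℕ∞) f → HasCompactSupport f →
          eLpNorm (T f) 2 volume ≤
            ENNReal.ofReal (A₀ * sphLlogL d Ω) * eLpNorm f 2 volume) →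
        -- weak type (1,1) bound
        ∀ lam : ℝ, 0 < lam →
          ∀ f : EuclideanSpace ℝ (Fin d) → ℂ, ContDiff ℝ (⊤ : ℕ∞) f → HasCompactSupport f →
            volume {x : EuclideanSpace ℝ (Fin d) | lam < ‖T f x‖} ≤
              ENNReal.ofReal (C * lam⁻¹ * COmega d Ω) * eLpNorm f 1 volume := by
  obtain ⟨L, Ξ, h, h0⟩ := exists_isCutoff hr
  have hd1 : 1 ≤ d := by omega
  obtain ⟨C, hC, H⟩ := h.exists_weak_bound h0 hd1
  refine ⟨C.toReal + 1, add_pos_of_nonneg_of_pos ENNReal.toReal_nonneg one_pos,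
    fun Ω T hΩ hom hl hmean hT _ lam hlam f hf hfc => ?_⟩
  have hi := integrable_of_LlogL hΩ hl
  have hC' : C ≤ ENNReal.ofReal (C.toReal + 1) :=
    (ENNReal.ofReal_toReal hC).symm.trans_le (ENNReal.ofReal_le_ofReal (by linarith))
  have hn : ∫⁻ x, ‖f x‖ₑ ≠ ∞ := (hf.continuous.integrable_of_hasCompactSupport hfc).2.ne
  have hbound : ∀ ε : ℝ, 0 < ε → volume {x : EuclideanSpace ℝ (Fin d) | lam < ‖T f x‖} ≤
      ENNReal.ofReal ((C.toReal + 1) * lam⁻¹ * (COmega d Ω + ε)) * ∫⁻ x, ‖f x‖ₑ := fun ε hε => by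
    obtain ⟨W, hW, hWΛ, hΩW, hΩΛ⟩ := exists_log_bounds hΩ hl hε
    refine measure_lt_norm_le_of_tendsto
      (u := fun J => cv (fun x => ∑ j ∈ scales J, kern r (bump Ξ) Ω j x) f) ?_ fun J => ?_
    · filter_upwards [hT f hf hfc] with x hx
      exact h.tendsto_cv hd1 hΩ hom hi hmean hf.continuous hfc x hx
    · refine (H Ω hΩ hom hi W _ hW hWΛ hΩW hΩΛ (scales J) f hf.continuous hfc lam hlam).trans ?_
      rw [← mul_assoc, mul_assoc (_ + _), ENNReal.ofReal_mul (by positivity), ← div_eq_inv_mul]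
      gcongr
  rw [eLpNorm_one_eq_lintegral_enorm]
  have hlim : Tendsto (fun ε : ℝ => ENNReal.ofReal ((C.toReal + 1) * lam⁻¹ * (COmega d Ω + ε)) *
      ∫⁻ x, ‖f x‖ₑ) (𝓝[>] 0) (𝓝 (ENNReal.ofReal ((C.toReal + 1) * lam⁻¹ * (COmega d Ω + 0)) *
      ∫⁻ x, ‖f x‖ₑ)) := by
    refine ENNReal.Tendsto.mul_const (ENNReal.tendsto_ofReal ?_) (Or.inr hn)
    exact (Continuous.tendsto (by fun_prop) 0).mono_left nhdsWithin_le_nhds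
  rw [add_zero] at hlim
  exact ge_of_tendsto hlim (eventually_mem_nhdsWithin.mono fun ε hε => hbound ε hε)

end
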